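/- An integer c admits at least two representations of the form c = P_m − F_n with integers m > 3 and n > 1 (i.e., there exist pairs (m, n) ≠ (m₁, n₁) with m, m₁ > 3, n, n₁ > 1 and P_m − F_n = P_{m₁} − F_{n₁} = c) if and only if c belongs to the set {−226, −82, −52, −30, −27, −18, −9, −6, −5, −4, −3, −1, 0, 1, 2, 3, 4, 6, 7, 8, 10, 11, 13, 15, 16, 20, 25, 31, 32, 36, 44, 52, 62, 111, 262}. -/

import Mathlib

/-- The Padovan sequence: P 0 = P 1 = P 2 = 1 and P (k+3) = P (k+1) + P k. -/
def padovan : ℕ → ℕ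
  | 0 => 1
  | 1 => 1
  | 2 => 1
  | k + 3 => padovan (k + 1) + padovan k

/-! ### Analytic part: interpolation with approximate zeros -/

/-- Taylor expansion of the exponential with entire remainder. -/
lemma exp_taylor (T : ℕ) : ∃ (c : ℕ → ℂ) (r : ℂ → ℂ), Differentiable ℂ r ∧
    ∀ w, Complex.exp w = ∑ i ∈ Finset.range T, c i * w ^ i + w ^ T * r w := by
  induction T with
  | zero => exact ⟨fun _ => 0, Complex.exp, Complex.differentiable_exp, by simp⟩
  | succ T ih =>
    obtain ⟨c, r, hr, h⟩ := ih
    refine ⟨fun i => if i < T then c i else r 0, dslope r 0, ?_, ?_⟩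
    · rw [← differentiableOn_univ] at hr ⊢
      exact (Complex.differentiableOn_dslope Filter.univ_mem).2 hr
    · intro w
      rw [h w, Finset.sum_range_succ]
      have h1 : r w = r 0 + w * dslope r 0 w := by
        have := sub_smul_dslope r 0 w
        simp only [sub_zero, smul_eq_mul] at this
        rw [this]; ring
      have h2 : ∑ i ∈ Finset.range T, c i * w ^ i
          = ∑ i ∈ Finset.range T, (if i < T then c i else r 0) * w ^ i := by
        apply Finset.sum_congr rfl
        intro i hi
        rw [if_pos (Finset.mem_range.1 hi)]
      rw [h2]
      simp only [lt_irrefl, if_false]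
      conv_lhs => rw [h1]
      ring

/-- An exponential sum with vanishing moments is divisible by a power of `z - s`. -/
lemma expsum_div {I : Type*} [Fintype I] (b Ω : I → ℂ) (s : ℂ) (T : ℕ)
    (h : ∀ i < T, ∑ l, b l * Ω l ^ i = 0) :
    ∃ u : ℂ → ℂ, Differentiable ℂ u ∧
      ∀ z, ∑ l, b l * Complex.exp (Ω l * (z - s)) = (z - s) ^ T * u z := by
  obtain ⟨c, r, hr, hexp⟩ := exp_taylor T
  refine ⟨fun z => ∑ l, b l * Ω l ^ T * r (Ω l * (z - s)), ?_, ?_⟩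
  · apply Differentiable.fun_sum
    intro l _
    apply Differentiable.const_mul
    exact hr.comp (by fun_prop)
  · intro z
    have : ∀ l, b l * Complex.exp (Ω l * (z - s)) =
        ∑ i ∈ Finset.range T, (c i * (z - s) ^ i) * (b l * Ω l ^ i)
          + (z - s) ^ T * (b l * Ω l ^ T * r (Ω l * (z - s))) := by
      intro l
      rw [hexp, mul_add, Finset.mul_sum]
      congr 1
      · apply Finset.sum_congr rfl; intro i _; rw [mul_pow]; ring
      · rw [mul_pow]; ring
    simp_rw [this]
    rw [Finset.sum_add_distrib, Finset.sum_comm, ← Finset.mul_sum]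
    simp_rw [← Finset.mul_sum]
    rw [Finset.sum_eq_zero, zero_add]
    intro i hi
    rw [h i (Finset.mem_range.1 hi), mul_zero]

/-- Neville type interpolation with small data. -/
lemma neville (f : ℂ → ℂ) (S T : ℕ) (R ε : ℝ) (hR : (S : ℝ) ≤ R) (hR1 : 1 ≤ R) (hε : 0 ≤ ε)
    (d : ℕ → ℂ → ℂ) (hd : ∀ s < S, Differentiable ℂ (d s))
    (hdb : ∀ s < S, ∀ z, ‖z‖ ≤ R → ‖d s z‖ ≤ ε)
    (hu : ∀ s < S, ∃ u : ℂ → ℂ, Differentiable ℂ u ∧ ∀ z, f z - d s z = (z - s) ^ T * u z)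
    (k : ℕ) : ∀ i, i + k < S * T →
    ∃ H u : ℂ → ℂ, Differentiable ℂ H ∧ Differentiable ℂ u ∧
      (∀ z, f z - H z = (∏ r ∈ Finset.range (k + 1), (z - ((i + r) / T : ℕ))) * u z) ∧
      ∀ z, ‖z‖ ≤ R → ‖H z‖ ≤ ε * (4 * R) ^ k := by
  induction k with
  | zero =>
    intro i hi
    have hT : 0 < T := by
      rcases Nat.eq_zero_or_pos T with h | h
      · simp [h] at hi
      · exact h
    have hs : i / T < S := by
      rw [Nat.div_lt_iff_lt_mul hT]; simpa using hi
    obtain ⟨u, hu1, hu2⟩ := hu _ hs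
    refine ⟨d (i / T), fun z => (z - (i / T : ℕ)) ^ (T - 1) * u z, hd _ hs, by fun_prop, ?_, ?_⟩
    · intro z
      rw [hu2 z]
      simp only [zero_add, Finset.prod_range_one, add_zero]
      rw [← mul_assoc, ← pow_succ', Nat.sub_add_cancel hT]
    · intro z hz
      simpa using hdb _ hs z hz
  | succ k ih =>
    intro i hi
    have hT : 0 < T := by
      rcases Nat.eq_zero_or_pos T with h | h
      · simp [h] at hi
      · exact h
    have hs : (i + (k + 1)) / T < S := by
      rw [Nat.div_lt_iff_lt_mul hT]; exact hi
    have hs0 : i / T < S := lt_of_le_of_lt (Nat.div_le_div_right (by omega)) hs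
    have h4R : 1 ≤ 4 * R := by linarith
    by_cases heq : i / T = (i + (k + 1)) / T
    · -- all nodes equal
      obtain ⟨u, hu1, hu2⟩ := hu _ hs0
      have hnode : ∀ r ∈ Finset.range (k + 1 + 1), (i + r) / T = i / T := by
        intro r hr
        have hr' := Finset.mem_range.1 hr
        apply le_antisymm
        · rw [heq]; exact Nat.div_le_div_right (by omega)
        · exact Nat.div_le_div_right (by omega)
      have hk : k + 2 ≤ T := by
        have h1 := Nat.div_add_mod i T
        have h2 := Nat.div_add_mod (i + (k + 1)) T
        have h3 := Nat.mod_lt (i + (k + 1)) hT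
        rw [← heq] at h2
        omega
      refine ⟨d (i / T), fun z => (z - (i / T : ℕ)) ^ (T - (k + 2)) * u z, hd _ hs0,
        by fun_prop, ?_, ?_⟩
      · intro z
        rw [hu2 z]
        have : ∏ r ∈ Finset.range (k + 1 + 1), (z - ((i + r) / T : ℕ))
            = (z - ((i / T : ℕ) : ℂ)) ^ (k + 2) := by
          rw [Finset.prod_congr rfl (g := fun _ => (z - ((i / T : ℕ) : ℂ)))]
          · simp
          · intro r hr; rw [hnode r hr]
        rw [this, ← mul_assoc, ← pow_add]
        congr 2; omega
      · intro z hz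
        calc ‖d (i / T) z‖ ≤ ε := hdb _ hs0 z hz
          _ = ε * 1 := by ring
          _ ≤ ε * (4 * R) ^ (k + 1) := by gcongr; exact one_le_pow₀ h4R
    · obtain ⟨H1, u1, hH1, hu1, he1, hb1⟩ := ih (i + 1) (by omega)
      obtain ⟨H0, u0, hH0, hu0, he0, hb0⟩ := ih i (by omega)
      set a := i / T with ha
      set b := (i + (k + 1)) / T with hb
      have hab : a < b := lt_of_le_of_ne (Nat.div_le_div_right (by omega)) heq
      have hab' : (1 : ℝ) ≤ (b : ℝ) - a := by
        have : a + 1 ≤ b := hab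
        have : ((a + 1 : ℕ) : ℝ) ≤ b := by exact_mod_cast this
        push_cast at this; linarith
      have hne : (b : ℂ) - a ≠ 0 := by
        rw [sub_ne_zero]; exact_mod_cast hab.ne'
      refine ⟨fun z => ((z - a) * H1 z - (z - b) * H0 z) / (b - a),
        fun z => (u1 z - u0 z) / (b - a), by fun_prop, by fun_prop, ?_, ?_⟩
      · intro z
        have e1 : ∏ r ∈ Finset.range (k + 1 + 1), (z - ((i + r) / T : ℕ))
            = (∏ r ∈ Finset.range (k + 1), (z - ((i + 1 + r) / T : ℕ))) * (z - a) := by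
          rw [Finset.prod_range_succ']
          congr 1
          apply Finset.prod_congr rfl
          intro r _
          rw [show i + (r + 1) = i + 1 + r by ring]
        have e0 : ∏ r ∈ Finset.range (k + 1 + 1), (z - ((i + r) / T : ℕ))
            = (∏ r ∈ Finset.range (k + 1), (z - ((i + r) / T : ℕ))) * (z - b) := by
          rw [Finset.prod_range_succ]
        have : (∏ r ∈ Finset.range (k + 1 + 1), (z - ((i + r) / T : ℕ))) * ((u1 z - u0 z) / (b - a))
          = ((z - a) * ((∏ r ∈ Finset.range (k + 1), (z - ((i + 1 + r) / T : ℕ))) * u1 z)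
            - (z - b) * ((∏ r ∈ Finset.range (k + 1), (z - ((i + r) / T : ℕ))) * u0 z)) / (b - a) := by
          rw [mul_div_assoc', mul_sub]
          congr 1
          congr 1
          · rw [e1]; ring
          · rw [e0]; ring
        rw [this, ← he1, ← he0]
        field_simp
        ring
      · intro z hz
        have hbS : (b : ℝ) ≤ R := le_trans (by exact_mod_cast hs.le) hR
        have haS : (a : ℝ) ≤ R := le_trans (by exact_mod_cast hs0.le) hR
        have hza : ‖z - a‖ ≤ 2 * R := by
          calc ‖z - a‖ ≤ ‖z‖ + ‖(a : ℂ)‖ := norm_sub_le _ _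
            _ ≤ R + R := by gcongr; simpa using haS
            _ = 2 * R := by ring
        have hzb : ‖z - b‖ ≤ 2 * R := by
          calc ‖z - b‖ ≤ ‖z‖ + ‖(b : ℂ)‖ := norm_sub_le _ _
            _ ≤ R + R := by gcongr; simpa using hbS
            _ = 2 * R := by ring
        have hden : 1 ≤ ‖(b : ℂ) - a‖ := by
          have : ((b : ℂ) - a) = (((b : ℝ) - a : ℝ) : ℂ) := by push_cast; ring
          rw [this, Complex.norm_real, Real.norm_eq_abs, abs_of_nonneg (by linarith)]
          exact hab'
        rw [norm_div]
        have hb1z := hb1 z hz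
        have hb0z := hb0 z hz
        have hE : 0 ≤ ε * (4 * R) ^ k := by positivity
        calc _ ≤ ‖(z - a) * H1 z - (z - b) * H0 z‖ := div_le_self (norm_nonneg _) hden
          _ ≤ ‖z - a‖ * ‖H1 z‖ + ‖z - b‖ * ‖H0 z‖ := by
              refine (norm_sub_le _ _).trans ?_
              rw [norm_mul, norm_mul]
          _ ≤ 2 * R * (ε * (4 * R) ^ k) + 2 * R * (ε * (4 * R) ^ k) := by gcongr
          _ = ε * (4 * R) ^ (k + 1) := by ring

/-- Extrapolation estimate. -/
lemma extrapolate (f : ℂ → ℂ) (hf : Differentiable ℂ f) (S T S' : ℕ) (ε F : ℝ)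
    (hS : 0 < S) (hT : 0 < T) (hSS : S ≤ S') (hε : 0 ≤ ε)
    (d : ℕ → ℂ → ℂ) (hd : ∀ s < S, Differentiable ℂ (d s))
    (hdb : ∀ s < S, ∀ z, ‖z‖ ≤ 5 * (S' : ℝ) → ‖d s z‖ ≤ ε)
    (hu : ∀ s < S, ∃ u : ℂ → ℂ, Differentiable ℂ u ∧ ∀ z, f z - d s z = (z - s) ^ T * u z)
    (hF : ∀ z, ‖z‖ ≤ 5 * (S' : ℝ) → ‖f z‖ ≤ F)
    (hεn : ε * (20 * (S' : ℝ)) ^ (S * T) * 4 ^ (S * T) ≤ 1) (hF1 : 1 ≤ F)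
    (s' : ℕ) (hs' : s' < S') :
    ‖f s'‖ ≤ 3 * F / 4 ^ (S * T) := by
  have hS'1 : (1 : ℝ) ≤ S' := by exact_mod_cast (by omega : 1 ≤ S')
  have hSS' : (S : ℝ) ≤ S' := by exact_mod_cast hSS
  have hn : 0 < S * T := Nat.mul_pos hS hT
  obtain ⟨H, u, hH, hu1, he, hb⟩ := neville f S T (5 * S') ε (by linarith) (by linarith) hε d hd
    hdb hu (S * T - 1) 0 (by omega)
  set n := S * T with hn_def
  have hn1 : n - 1 + 1 = n := by omega
  rw [hn1] at he
  have hnode : ∀ r ∈ Finset.range n, (0 + r) / T < S := by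
    intro r hr
    rw [Nat.div_lt_iff_lt_mul hT, zero_add]
    exact Finset.mem_range.1 hr
  have hHb : ∀ z, ‖z‖ ≤ 5 * (S' : ℝ) → ‖H z‖ ≤ 1 / 4 ^ n := by
    intro z hz
    refine (hb z hz).trans ?_
    rw [le_div_iff₀ (by positivity)]
    refine le_trans ?_ hεn
    gcongr
    rw [show (4 : ℝ) * (5 * S') = 20 * S' by ring]
    exact pow_le_pow_right₀ (by linarith) (by omega)
  have h4n : (1 : ℝ) ≤ 4 ^ n := one_le_pow₀ (by norm_num)
  -- bound of u on the circle
  have hub : ∀ z ∈ frontier (Metric.ball (0 : ℂ) (5 * S')), ‖u z‖ ≤ (F + 1) / (4 * S') ^ n := by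
    intro z hz
    rw [frontier_ball _ (by positivity)] at hz
    have hz' : ‖z‖ = 5 * S' := by simpa using hz
    have hprod : (4 * (S' : ℝ)) ^ n ≤ ‖∏ r ∈ Finset.range n, (z - ((0 + r) / T : ℕ))‖ := by
      rw [norm_prod]
      calc (4 * (S' : ℝ)) ^ n = ∏ _r ∈ Finset.range n, (4 * (S' : ℝ)) := by simp
        _ ≤ _ := by
          apply Finset.prod_le_prod
          · intros; positivity
          · intro r hr
            have h1 : (((0 + r) / T : ℕ) : ℝ) ≤ S' := by
              exact_mod_cast ((hnode r hr).le.trans hSS)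
            have h2 : ‖z‖ - ‖(((0 + r) / T : ℕ) : ℂ)‖ ≤ ‖z - ((0 + r) / T : ℕ)‖ := norm_sub_norm_le _ _
            rw [hz'] at h2
            simp only [Complex.norm_natCast] at h2
            linarith
    rw [le_div_iff₀ (by positivity)]
    calc ‖u z‖ * (4 * S') ^ n ≤ ‖u z‖ * ‖∏ r ∈ Finset.range n, (z - ((0 + r) / T : ℕ))‖ := by gcongr
      _ = ‖f z - H z‖ := by rw [he z, norm_mul, mul_comm]
      _ ≤ ‖f z‖ + ‖H z‖ := norm_sub_le _ _
      _ ≤ F + 1 := by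
        have := hF z hz'.le
        have h2 := hHb z hz'.le
        have : (1 : ℝ) / 4 ^ n ≤ 1 := by rw [div_le_one (by positivity)]; exact h4n
        linarith
  have hus : ‖u s'‖ ≤ (F + 1) / (4 * S') ^ n := by
    apply Complex.norm_le_of_forall_mem_frontier_norm_le (U := Metric.ball (0 : ℂ) (5 * S'))
      Metric.isBounded_ball hu1.diffContOnCl hub
    apply subset_closure
    simp only [Metric.mem_ball, dist_zero_right, Complex.norm_natCast]
    have : (s' : ℝ) < S' := by exact_mod_cast hs'
    linarith
  have hs'n : ‖(s' : ℂ)‖ ≤ 5 * (S' : ℝ) := by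
    simp only [Complex.norm_natCast]
    have : (s' : ℝ) < S' := by exact_mod_cast hs'
    linarith
  have hprod2 : ‖∏ r ∈ Finset.range n, ((s' : ℂ) - ((0 + r) / T : ℕ))‖ ≤ (S' : ℝ) ^ n := by
    rw [norm_prod]
    calc _ ≤ ∏ _r ∈ Finset.range n, (S' : ℝ) := by
          apply Finset.prod_le_prod
          · intros; positivity
          · intro r hr
            have h1 : (((0 + r) / T : ℕ) : ℝ) ≤ S' := by
              exact_mod_cast ((hnode r hr).le.trans hSS)
            have h3 : (s' : ℝ) < S' := by exact_mod_cast hs'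
            have : ((s' : ℂ) - ((0 + r) / T : ℕ)) = (((s' : ℝ) - ((0 + r) / T : ℕ) : ℝ) : ℂ) := by
              push_cast; ring
            rw [this, Complex.norm_real, Real.norm_eq_abs, abs_le]
            have h4 : (0 : ℝ) ≤ (((0 + r) / T : ℕ) : ℝ) := by positivity
            have h5 : (0 : ℝ) ≤ s' := by positivity
            constructor <;> linarith
      _ = _ := by simp
  have hfs : f s' = H s' + (∏ r ∈ Finset.range n, ((s' : ℂ) - ((0 + r) / T : ℕ))) * u s' := by
    rw [← he]; ring
  have hS'0 : (S' : ℝ) ^ n ≠ 0 := by positivity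
  calc ‖f s'‖ ≤ ‖H s'‖ + ‖∏ r ∈ Finset.range n, ((s' : ℂ) - ((0 + r) / T : ℕ))‖ * ‖u s'‖ := by
        rw [hfs, ← norm_mul]; exact norm_add_le _ _
    _ ≤ 1 / 4 ^ n + (S' : ℝ) ^ n * ((F + 1) / (4 * S') ^ n) := by
        gcongr
        exact hHb _ hs'n
    _ = (F + 2) / 4 ^ n := by rw [mul_pow]; field_simp; ring
    _ ≤ 3 * F / 4 ^ n := by gcongr; linarith

/-! ### Arithmetic data and the box principle -/

/-- A ring with a real place, a height and a Liouville inequality (degree six). -/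
structure LData (A : Type) [CommRing A] where
  ι : A →+* ℝ
  H : A → ℝ
  H_nonneg : ∀ x, 0 ≤ H x
  H_add : ∀ x y, H (x + y) ≤ H x + H y
  H_mul : ∀ x y, H (x * y) ≤ H x * H y
  H_int : ∀ n : ℤ, H (n : A) ≤ |(n : ℝ)|
  H_ι : ∀ x, |ι x| ≤ H x
  liou : ∀ x, ι x ≠ 0 → 1 ≤ |ι x| * H x ^ 5

namespace LData

variable {A : Type} [CommRing A] (D : LData A)

lemma H_sum {I : Type*} (s : Finset I) (f : I → A) : D.H (∑ i ∈ s, f i) ≤ ∑ i ∈ s, D.H (f i) := by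
  classical
  induction s using Finset.induction_on with
  | empty =>
    have := D.H_int 0
    simpa using this
  | insert a s ha ih =>
    rw [Finset.sum_insert ha, Finset.sum_insert ha]
    exact (D.H_add _ _).trans (by gcongr)

lemma H_one : D.H 1 ≤ 1 := by
  have := D.H_int 1
  simpa using this

lemma H_pow (x : A) (n : ℕ) : D.H (x ^ n) ≤ D.H x ^ n := by
  induction n with
  | zero => simpa using D.H_one
  | succ n ih =>
    rw [pow_succ, pow_succ]
    exact (D.H_mul _ _).trans (mul_le_mul_of_nonneg_right ih (D.H_nonneg x))

lemma H_pow_le (x : A) (n : ℕ) (B : ℝ) (h : D.H x ≤ B) : D.H (x ^ n) ≤ B ^ n :=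
  (D.H_pow x n).trans (pow_le_pow_left₀ (D.H_nonneg x) h n)

lemma H_mul_le (x y : A) (a b : ℝ) (hx : D.H x ≤ a) (hy : D.H y ≤ b) : D.H (x * y) ≤ a * b :=
  (D.H_mul x y).trans (mul_le_mul hx hy (D.H_nonneg y) ((D.H_nonneg x).trans hx))

lemma H_lin {I : Type*} [Fintype I] (p : I → ℤ) (w : I → A) (X W : ℝ)
    (hp : ∀ i, |(p i : ℝ)| ≤ X) (hw : ∀ i, D.H (w i) ≤ W) :
    D.H (∑ i, (p i : A) * w i) ≤ Fintype.card I * X * W := by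
  refine (D.H_sum _ _).trans ?_
  have : ∀ i ∈ (Finset.univ : Finset I), D.H ((p i : A) * w i) ≤ X * W := fun i _ =>
    D.H_mul_le _ _ _ _ ((D.H_int _).trans (hp i)) (hw i)
  refine (Finset.sum_le_card_nsmul _ _ _ this).trans ?_
  simp [mul_assoc]

/-- The box principle: small integer solutions of a linear system. -/
lemma box {I E : Type} [Fintype I] [Fintype E] (w : E → I → A) (x y k : ℕ)
    (hw : ∀ e i, D.H (w e i) ≤ 2 ^ k) (hN : Fintype.card I ≤ 2 ^ y)
    (hNE : 12 * Fintype.card E < Fintype.card I) (hx : x = y + k + 1) :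
    ∃ p : I → ℤ, p ≠ 0 ∧ (∀ i, |(p i : ℝ)| ≤ 2 ^ x) ∧ ∀ e, ∑ i, (p i : ℝ) * D.ι (w e i) = 0 := by
  classical
  have hI : 0 < Fintype.card I := by omega
  set C : ℝ := 2 ^ (y + x + k) with hC
  have hC0 : 0 < C := by positivity
  set Dn : ℕ := 2 ^ (6 * (y + x + k) + 2) with hDn
  have hval : ∀ (p : I → ℤ), (∀ i, |(p i : ℝ)| ≤ 2 ^ x) → ∀ e,
      D.H (∑ i, (p i : A) * w e i) ≤ C := by
    intro p hp e
    refine (D.H_lin p (w e) _ _ hp (hw e)).trans ?_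
    have : (Fintype.card I : ℝ) ≤ 2 ^ y := by exact_mod_cast hN
    rw [hC, pow_add, pow_add]
    gcongr
  have hmap : ∀ (p : I → ℤ) e, D.ι (∑ i, (p i : A) * w e i) = ∑ i, (p i : ℝ) * D.ι (w e i) := by
    intro p e
    simp
  let toP : (I → Fin (2 ^ x)) → I → ℤ := fun P i => ((P i : ℕ) : ℤ)
  have htoP : ∀ P i, |(toP P i : ℝ)| ≤ 2 ^ x := by
    intro P i
    have : ((P i : ℕ) : ℝ) ≤ 2 ^ x := by exact_mod_cast (P i).2.le
    simpa [toP] using this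
  let v : (I → Fin (2 ^ x)) → E → ℝ := fun P e => ∑ i, (toP P i : ℝ) * D.ι (w e i)
  have hv : ∀ P e, |v P e| ≤ C := by
    intro P e
    have := (D.H_ι _).trans (hval _ (htoP P) e)
    rwa [hmap] at this
  let cell : (I → Fin (2 ^ x)) → E → Fin (Dn + 1) := fun P e =>
    ⟨⌊(v P e + C) / (2 * C) * Dn⌋₊, by
      have h1 := hv P e
      rw [abs_le] at h1
      have : (v P e + C) / (2 * C) ≤ 1 := by
        rw [div_le_one (by positivity)]; linarith
      have h2 : (v P e + C) / (2 * C) * Dn ≤ Dn := by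
        nlinarith [(Nat.cast_nonneg Dn : (0:ℝ) ≤ Dn)]
      exact Nat.lt_succ_of_le (Nat.floor_le_of_le h2)⟩
  have hcard : Fintype.card (E → Fin (Dn + 1)) < Fintype.card (I → Fin (2 ^ x)) := by
    simp only [Fintype.card_fun, Fintype.card_fin]
    have hD2 : Dn + 1 ≤ 2 ^ (12 * x) := by
      have : Dn + Dn = 2 ^ (6 * (y + x + k) + 3) := by rw [hDn]; ring
      have h1 : 1 ≤ Dn := Nat.one_le_two_pow
      have h2 : 2 ^ (6 * (y + x + k) + 3) ≤ 2 ^ (12 * x) :=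
        Nat.pow_le_pow_right (by norm_num) (by omega)
      omega
    calc (Dn + 1) ^ Fintype.card E ≤ (2 ^ (12 * x)) ^ Fintype.card E := Nat.pow_le_pow_left hD2 _
      _ = 2 ^ (x * (12 * Fintype.card E)) := by rw [← pow_mul]; ring_nf
      _ < 2 ^ (x * Fintype.card I) := by
        apply Nat.pow_lt_pow_right (by norm_num)
        exact Nat.mul_lt_mul_of_pos_left hNE (by omega)
      _ = _ := by rw [pow_mul]
  obtain ⟨P, P', hne, heq⟩ := Fintype.exists_ne_map_eq_of_card_lt cell hcard
  let p : I → ℤ := fun i => toP P i - toP P' i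
  have hp : ∀ i, |(p i : ℝ)| ≤ 2 ^ x := by
    intro i
    have h1 := htoP P i
    have h2 := htoP P' i
    have h3 : (0:ℝ) ≤ toP P i := by simp [toP]
    have h4 : (0:ℝ) ≤ toP P' i := by simp [toP]
    simp only [p, Int.cast_sub]
    rw [abs_of_nonneg h3] at h1
    rw [abs_of_nonneg h4] at h2
    rw [abs_le]; constructor <;> linarith
  refine ⟨p, ?_, hp, ?_⟩
  · intro h0
    apply hne
    funext i
    have := congrFun h0 i
    simp only [p, toP, Pi.zero_apply] at this
    apply Fin.ext
    omega
  · intro e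
    by_contra hne0
    have hL := D.liou (∑ i, (p i : A) * w e i) (by rwa [hmap])
    rw [hmap] at hL
    have hdiff : ∑ i, (p i : ℝ) * D.ι (w e i) = v P e - v P' e := by
      simp only [v, p, ← Finset.sum_sub_distrib]
      refine Finset.sum_congr rfl fun i _ => ?_
      push_cast; ring
    have hce : ⌊(v P e + C) / (2 * C) * Dn⌋₊ = ⌊(v P' e + C) / (2 * C) * Dn⌋₊ := by
      have := congrFun heq e
      simpa [cell] using this
    have hDpos : (0:ℝ) < Dn := by rw [hDn]; positivity
    have hn : ∀ P, 0 ≤ (v P e + C) / (2 * C) * Dn := by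
      intro P
      have := abs_le.1 (hv P e)
      have : 0 ≤ v P e + C := by linarith
      positivity
    have h1 := Nat.floor_le (hn P)
    have h2 := Nat.lt_floor_add_one ((v P e + C) / (2 * C) * Dn)
    have h3 := Nat.floor_le (hn P')
    have h4 := Nat.lt_floor_add_one ((v P' e + C) / (2 * C) * Dn)
    rw [hce] at h1 h2
    have hsub : (v P e + C) / (2 * C) * Dn - (v P' e + C) / (2 * C) * Dn
        = (v P e - v P' e) * (Dn / (2 * C)) := by field_simp; ring
    have hlt : |v P e - v P' e| * (Dn / (2 * C)) ≤ 1 := by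
      rw [← abs_of_pos (show (0:ℝ) < Dn / (2 * C) by positivity), ← abs_mul, ← hsub, abs_le]
      constructor <;> linarith
    have hle : |v P e - v P' e| ≤ 2 * C / Dn := by
      rw [le_div_iff₀ hDpos]
      have := mul_le_mul_of_nonneg_right hlt (show 0 ≤ 2 * C by positivity)
      rw [one_mul, mul_assoc, div_mul_cancel₀ _ (by positivity)] at this
      exact this
    rw [hdiff] at hL
    have hH := hval p hp e
    have : |v P e - v P' e| * D.H (∑ i, (p i : A) * w e i) ^ 5 ≤ 2 * C / Dn * C ^ 5 := by
      gcongr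
      · exact pow_nonneg (D.H_nonneg _) _
      · exact D.H_nonneg _
    have hD' : (Dn : ℝ) = 4 * C ^ 6 := by
      rw [hDn, hC]; push_cast; rw [← pow_mul, pow_add]; ring
    have : 2 * C / Dn * C ^ 5 < 1 := by
      rw [hD', div_mul_eq_mul_div, div_lt_one (by positivity)]
      nlinarith [pow_pos hC0 6]
    linarith

end LData

/-! ### Extrapolation of zeros -/

/-- One extrapolation step for real exponential sums. -/
lemma step_analytic {I : Type} [Fintype I] (c a b om Om : I → ℝ) (q : I → ℕ)
    (l1 l2 Λ : ℝ) (S T S' Q L : ℕ) (F : ℝ) (hS : 0 < S) (hT : 0 < T) (hSS : S ≤ S')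
    (hom : ∀ i, Om i = a i * l1 + b i * l2) (hΛ : ∀ i, om i = Om i + q i * Λ)
    (hq : ∀ i, q i ≤ Q) (hOm : ∀ i, |Om i| ≤ 2 * L)
    (hF1 : 1 ≤ F) (hF : (∑ i, |c i|) * 2 ^ (15 * L * S') ≤ F)
    (hz : ∀ s < S, ∀ j1 j2, j1 + j2 < T →
      ∑ i, c i * a i ^ j1 * b i ^ j2 * Real.exp (s * om i) = 0)
    (hsm : S' * Q * |Λ| ≤ 1)
    (hε : F * (2 * (S' * Q * |Λ|)) * (20 * S') ^ (S * T) * 4 ^ (S * T) ≤ 1)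
    (s' : ℕ) (hs' : s' < S') :
    |∑ i, c i * Real.exp (s' * om i)| ≤ 4 * F / 4 ^ (S * T) := by
  set ε : ℝ := F * (2 * (S' * Q * |Λ|)) with hεd
  have hε0 : 0 ≤ ε := by positivity
  have hS'1 : 1 ≤ S' := by omega
  let f : ℂ → ℂ := fun z => ∑ i, (c i : ℂ) * Complex.exp (Om i * z)
  let fs : ℕ → ℂ → ℂ := fun s z =>
    ∑ i, ((c i * Real.exp (s * om i) : ℝ) : ℂ) * Complex.exp (Om i * (z - s))
  -- size of exponentials
  have hexp : ∀ i (z : ℂ), ‖z‖ ≤ 5 * S' → ‖Complex.exp (Om i * z)‖ ≤ 2 ^ (15 * L * S') := by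
    intro i z hz
    rw [Complex.norm_exp]
    have h1 : ((Om i : ℂ) * z).re ≤ ((5 * L * S' : ℕ) : ℝ) * 2 := by
      calc ((Om i : ℂ) * z).re ≤ ‖(Om i : ℂ) * z‖ := Complex.re_le_norm _
        _ = |Om i| * ‖z‖ := by rw [norm_mul, Complex.norm_real, Real.norm_eq_abs]
        _ ≤ (2 * L) * (5 * S') := mul_le_mul (hOm i) hz (norm_nonneg _) (by positivity)
        _ = _ := by push_cast; ring
    calc Real.exp _ ≤ Real.exp (((5 * L * S' : ℕ) : ℝ) * 2) := Real.exp_le_exp.2 h1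
      _ = (Real.exp 2) ^ (5 * L * S') := by rw [Real.exp_nat_mul]
      _ ≤ (2 ^ 3) ^ (5 * L * S') := by
        gcongr
        have := Real.exp_one_lt_d9
        have h2 : Real.exp 2 = Real.exp 1 * Real.exp 1 := by rw [← Real.exp_add]; norm_num
        rw [h2]
        nlinarith [Real.exp_pos 1]
      _ = _ := by rw [← pow_mul]; ring_nf
  have hdiff : ∀ s, s < S' → ∀ z : ℂ, ‖z‖ ≤ 5 * S' → ‖f z - fs s z‖ ≤ ε := by
    intro s hs z hz
    have h1 : f z - fs s z = ∑ i, (c i : ℂ) * Complex.exp (Om i * z) *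
        (1 - ((Real.exp (s * (q i * Λ)) : ℝ) : ℂ)) := by
      simp only [f, fs, ← Finset.sum_sub_distrib]
      refine Finset.sum_congr rfl fun i _ => ?_
      rw [hΛ i]
      push_cast
      have : Complex.exp ((s:ℂ) * (Om i + q i * Λ)) * Complex.exp (Om i * (z - s)) =
        Complex.exp (Om i * z) * Complex.exp (s * (q i * Λ)) := by
        rw [← Complex.exp_add, ← Complex.exp_add]; ring_nf
      rw [mul_assoc (c i : ℂ), this]; ring
    rw [h1]
    refine (norm_sum_le _ _).trans ?_
    have h2 : ∀ i ∈ (Finset.univ : Finset I), ‖(c i : ℂ) * Complex.exp (Om i * z) *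
        (1 - ((Real.exp (s * (q i * Λ)) : ℝ) : ℂ))‖ ≤
        |c i| * 2 ^ (15 * L * S') * (2 * (S' * Q * |Λ|)) := by
      intro i _
      rw [norm_mul, norm_mul, Complex.norm_real, Real.norm_eq_abs]
      have h3 : |(s:ℝ) * (q i * Λ)| ≤ S' * Q * |Λ| := by
        rw [abs_mul, abs_mul, Nat.abs_cast, Nat.abs_cast, ← mul_assoc]
        have : (q i : ℝ) ≤ Q := by exact_mod_cast hq i
        gcongr
      have h4 := Real.abs_exp_sub_one_le (h3.trans hsm)
      have h5 : ‖(1 - ((Real.exp (s * (q i * Λ)) : ℝ) : ℂ))‖ ≤ 2 * (S' * Q * |Λ|) := by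
        rw [← Complex.ofReal_one, ← Complex.ofReal_sub, Complex.norm_real, Real.norm_eq_abs,
          abs_sub_comm]
        linarith
      have := hexp i z hz
      gcongr
    refine (Finset.sum_le_sum h2).trans ?_
    rw [← Finset.sum_mul, ← Finset.sum_mul, hεd]
    gcongr
  have hfd : Differentiable ℂ f := by
    simp only [f]; fun_prop
  have hfsd : ∀ s, Differentiable ℂ (fs s) := by
    intro s; simp only [fs]; fun_prop
  have hfs' : f s' = f s' := rfl
  have hmain : ‖f s'‖ ≤ 3 * F / 4 ^ (S * T) := by
    refine extrapolate f hfd S T S' ε F hS hT hSS hε0 (fun s z => f z - fs s z)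
      (fun s _ => hfd.sub (hfsd s)) (fun s hs z hz => hdiff s (by omega) z hz) ?_ ?_ hε hF1 s' hs'
    · intro s hs
      obtain ⟨u, hu, hu'⟩ := expsum_div (fun i => ((c i * Real.exp (s * om i) : ℝ) : ℂ))
        (fun i => (Om i : ℂ)) s T (by
          intro j hj
          have : ∑ i, (c i * Real.exp (s * om i)) * Om i ^ j = 0 := by
            have h1 : ∀ i, (c i * Real.exp (s * om i)) * Om i ^ j =
                ∑ k ∈ Finset.range (j + 1), (l1 ^ k * l2 ^ (j - k) * (j.choose k)) *
                  (c i * a i ^ k * b i ^ (j - k) * Real.exp (s * om i)) := by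
              intro i
              rw [hom i, add_pow, Finset.mul_sum]
              refine Finset.sum_congr rfl fun k _ => ?_
              rw [mul_pow, mul_pow]; ring
            simp_rw [h1]
            rw [Finset.sum_comm]
            refine Finset.sum_eq_zero fun k hk => ?_
            rw [← Finset.mul_sum, hz s hs k (j - k) (by
              have := Finset.mem_range.1 hk; omega), mul_zero]
          have := congrArg (fun x : ℝ => (x : ℂ)) this
          push_cast at this ⊢
          exact this)
      refine ⟨u, hu, fun z => ?_⟩
      rw [← hu' z]
      simp only [fs]
      ring
    · intro z hz
      refine (norm_sum_le _ _).trans (le_trans ?_ hF)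
      rw [Finset.sum_mul]
      refine Finset.sum_le_sum fun i _ => ?_
      rw [norm_mul, Complex.norm_real, Real.norm_eq_abs]
      have := hexp i z hz
      gcongr
  have h6 := hdiff s' hs' s' (by
    rw [Complex.norm_natCast]
    have : (s':ℝ) ≤ S' := by exact_mod_cast hs'.le
    have : (0:ℝ) ≤ S' := by positivity
    linarith)
  have h7 : fs s' s' = ((∑ i, c i * Real.exp (s' * om i) : ℝ) : ℂ) := by
    simp [fs]
  rw [h7] at h6
  have hε4 : ε ≤ F / 4 ^ (S * T) := by
    rw [le_div_iff₀ (by positivity)]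
    have h8 : (1:ℝ) ≤ (20 * S') ^ (S * T) := by
      apply one_le_pow₀
      have : (1:ℝ) ≤ S' := by exact_mod_cast hS'1
      linarith
    calc ε * 4 ^ (S * T) ≤ ε * (20 * S') ^ (S * T) * 4 ^ (S * T) := by
          gcongr
          exact le_mul_of_one_le_right hε0 h8
      _ ≤ 1 := hε
      _ ≤ F := hF1
  have h9 : |∑ i, c i * Real.exp (s' * om i)| = ‖((∑ i, c i * Real.exp (s' * om i) : ℝ) : ℂ)‖ := by
    rw [Complex.norm_real, Real.norm_eq_abs]
  rw [h9]
  set w : ℂ := ((∑ i, c i * Real.exp (s' * om i) : ℝ) : ℂ)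
  calc ‖w‖ = ‖f s' - (f s' - w)‖ := by rw [sub_sub_cancel]
    _ ≤ ‖f s'‖ + ‖f s' - w‖ := norm_sub_le _ _
    _ ≤ 3 * F / 4 ^ (S * T) + F / 4 ^ (S * T) := add_le_add hmain (h6.trans hε4)
    _ = _ := by ring

/-! ### The lower bound for linear forms in three logarithms -/

theorem baker_core {A : Type} [CommRing A] (D : LData A) (a1 a2 g1 g2 : A) (l1 l2 l3 : ℝ) (m n : ℤ)
    (h Q L N v y k x u c S0 T' T J ρ U : ℕ)
    (ha1 : D.ι a1 = Real.exp l1) (ha2 : D.ι a2 = Real.exp l2) (hg2 : 0 < D.ι g2)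
    (hg1 : D.ι g1 = D.ι g2 * Real.exp l3)
    (Ha1 : D.H a1 ≤ 2) (Ha2 : D.H a2 ≤ 2) (Hg1 : D.H g1 ≤ 2 ^ h) (Hg2 : D.H g2 ≤ 2 ^ h)
    (hl1 : 0 ≤ l1) (hl2 : 0 ≤ l2) (hl12 : l1 + l2 ≤ 1) (hl3 : |l3| ≤ h - 1)
    (hind : ∀ a b c : ℤ, a * l1 + b * l2 + c * l3 = 0 → a = 0 ∧ b = 0 ∧ c = 0)
    (hL : L = h * Q) (hN : N = (L + 1) * ((L + 1) * (Q + 1))) (hT : T = J * T')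
    (hv1 : Q * m.natAbs + L ≤ 2 ^ v) (hv2 : Q * n.natAbs + L ≤ 2 ^ v)
    (hy : N ≤ 2 ^ y) (hbox : 12 * (S0 * (T * T)) < N)
    (hk : k = v * T + 3 * L * S0) (hx : x = y + k + 1)
    (hT'0 : 0 < T') (hS0 : 0 < S0) (hJ0 : 0 < J) (hρ : 0 < ρ)
    (hstep1 : 31 * L * ρ ≤ 2 * T')
    (hstep2 : 2 + 6 * (y + x + v * T) + 31 * L * ρ * S0 < 2 * S0 * T')
    (hJ : N ≤ S0 * ρ ^ (J - 1))
    (hu : 2 * (ρ * N) * Q ≤ 2 ^ u) (hc : 80 * (ρ * N) ≤ 2 ^ c)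
    (hU : y + x + v * T + 15 * L * (ρ * N) + u + c * (N * T') ≤ U) :
    1 ≤ |l3 + m * l1 - n * l2| * 2 ^ U := by
  by_contra hcon
  push Not at hcon
  set Λ : ℝ := l3 + m * l1 - n * l2 with hΛdef
  -- basic facts
  let I := Fin (L + 1) × Fin (L + 1) × Fin (Q + 1)
  have hcardI : Fintype.card I = N := by
    simp [I, hN]
  let Ac : I → ℤ := fun i => (i.1 : ℤ) - m * (i.2.2 : ℤ)
  let Bc : I → ℤ := fun i => (i.2.1 : ℤ) + n * (i.2.2 : ℤ)
  let om : I → ℝ := fun i => (i.1 : ℝ) * l1 + (i.2.1 : ℝ) * l2 + (i.2.2 : ℝ) * l3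
  let Om : I → ℝ := fun i => (Ac i : ℝ) * l1 + (Bc i : ℝ) * l2
  let ξ : I → ℕ → A := fun i s =>
    a1 ^ ((i.1 : ℕ) * s) * a2 ^ ((i.2.1 : ℕ) * s) * (g1 ^ ((i.2.2 : ℕ) * s) * g2 ^ ((Q - i.2.2) * s))
  have hi1 : ∀ i : I, (i.1 : ℕ) ≤ L := fun i => Nat.lt_succ_iff.1 i.1.2
  have hi2 : ∀ i : I, (i.2.1 : ℕ) ≤ L := fun i => Nat.lt_succ_iff.1 i.2.1.2
  have hi3 : ∀ i : I, (i.2.2 : ℕ) ≤ Q := fun i => Nat.lt_succ_iff.1 i.2.2.2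
  have hAc : ∀ i, |(Ac i : ℝ)| ≤ 2 ^ v := by
    intro i
    have h1 : |Ac i| ≤ ((Q * m.natAbs + L : ℕ) : ℤ) := by
      simp only [Ac]
      refine (abs_sub _ _).trans ?_
      rw [abs_mul, Nat.abs_cast, Nat.abs_cast, Int.abs_eq_natAbs]
      have e1 := hi1 i
      have e3 := Nat.mul_le_mul_left m.natAbs (hi3 i)
      have : (i.1 : ℕ) + m.natAbs * (i.2.2 : ℕ) ≤ Q * m.natAbs + L := by
        rw [mul_comm Q]; omega
      exact_mod_cast this
    have h2 : |Ac i| ≤ ((2 ^ v : ℕ) : ℤ) := h1.trans (by exact_mod_cast hv1)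
    exact_mod_cast h2
  have hBc : ∀ i, |(Bc i : ℝ)| ≤ 2 ^ v := by
    intro i
    have h1 : |Bc i| ≤ ((Q * n.natAbs + L : ℕ) : ℤ) := by
      simp only [Bc]
      refine (abs_add_le _ _).trans ?_
      rw [abs_mul, Nat.abs_cast, Nat.abs_cast, Int.abs_eq_natAbs]
      have e1 := hi2 i
      have e3 := Nat.mul_le_mul_left n.natAbs (hi3 i)
      have : (i.2.1 : ℕ) + n.natAbs * (i.2.2 : ℕ) ≤ Q * n.natAbs + L := by
        rw [mul_comm Q]; omega
      exact_mod_cast this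
    have h2 : |Bc i| ≤ ((2 ^ v : ℕ) : ℤ) := h1.trans (by exact_mod_cast hv2)
    exact_mod_cast h2
  have hAB : ∀ i t1 t2, t1 + t2 ≤ T → |((Ac i ^ t1 * Bc i ^ t2 : ℤ) : ℝ)| ≤ 2 ^ (v * T) := by
    intro i t1 t2 ht
    push_cast
    rw [abs_mul, abs_pow, abs_pow]
    calc |(Ac i : ℝ)| ^ t1 * |(Bc i : ℝ)| ^ t2 ≤ (2 ^ v) ^ t1 * (2 ^ v) ^ t2 := by
          have := hAc i
          have := hBc i
          gcongr
      _ = 2 ^ (v * (t1 + t2)) := by rw [← pow_add, ← pow_mul]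
      _ ≤ _ := pow_le_pow_right₀ (by norm_num) (by gcongr)
  have hΛ : ∀ i, om i = Om i + ((i.2.2 : ℕ) : ℝ) * Λ := by
    intro i
    simp only [om, Om, Ac, Bc, hΛdef]
    push_cast; ring
  have hιξ : ∀ i s, D.ι (ξ i s) = D.ι g2 ^ (Q * s) * Real.exp (s * om i) := by
    intro i s
    simp only [ξ, map_mul, map_pow, ha1, ha2, hg1, om]
    rw [mul_pow, ← Real.exp_nat_mul, ← Real.exp_nat_mul, ← Real.exp_nat_mul]
    have e1 : Q * s = (i.2.2 : ℕ) * s + (Q - i.2.2) * s := by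
      rw [← add_mul, Nat.add_sub_cancel' (hi3 i)]
    rw [e1, pow_add]
    have e2 : Real.exp (s * ((i.1 : ℝ) * l1 + (i.2.1 : ℝ) * l2 + (i.2.2 : ℝ) * l3)) =
      Real.exp (((i.1 : ℕ) * s : ℕ) * l1) * Real.exp (((i.2.1 : ℕ) * s : ℕ) * l2) *
      Real.exp (((i.2.2 : ℕ) * s : ℕ) * l3) := by
      rw [← Real.exp_add, ← Real.exp_add]; push_cast; ring_nf
    rw [e2]; ring
  have hHξ : ∀ i s, D.H (ξ i s) ≤ 2 ^ (3 * L * s) := by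
    intro i s
    have e1 := D.H_pow_le a1 ((i.1 : ℕ) * s) 2 Ha1
    have e2 := D.H_pow_le a2 ((i.2.1 : ℕ) * s) 2 Ha2
    have e3 := D.H_pow_le g1 ((i.2.2 : ℕ) * s) _ Hg1
    have e4 := D.H_pow_le g2 ((Q - i.2.2) * s) _ Hg2
    refine (D.H_mul_le _ _ _ _ (D.H_mul_le _ _ _ _ e1 e2) (D.H_mul_le _ _ _ _ e3 e4)).trans ?_
    rw [← pow_mul, ← pow_mul, ← pow_add, ← pow_add, ← pow_add]
    apply pow_le_pow_right₀ (by norm_num)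
    have e5 : h * ((i.2.2 : ℕ) * s) + h * ((Q - i.2.2) * s) = L * s := by
      rw [← mul_add, ← add_mul, Nat.add_sub_cancel' (hi3 i), hL]; ring
    have e6 := Nat.mul_le_mul_right s (hi1 i)
    have e7 := Nat.mul_le_mul_right s (hi2 i)
    have e8 : 3 * L * s = L * s + L * s + L * s := by ring
    omega
  -- elements
  let wt : ℕ → ℕ → ℕ → I → A := fun s t1 t2 i => ((Ac i ^ t1 * Bc i ^ t2 : ℤ) : A) * ξ i s
  have hHwt : ∀ s t1 t2 i, t1 + t2 ≤ T → D.H (wt s t1 t2 i) ≤ 2 ^ (v * T + 3 * L * s) := by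
    intro s t1 t2 i ht
    rw [pow_add]
    exact D.H_mul_le _ _ _ _ ((D.H_int _).trans (hAB i t1 t2 ht)) (hHξ i s)
  have hιwt : ∀ s t1 t2 i, D.ι (wt s t1 t2 i) =
      D.ι g2 ^ (Q * s) * ((Ac i : ℝ) ^ t1 * (Bc i : ℝ) ^ t2 * Real.exp (s * om i)) := by
    intro s t1 t2 i
    simp only [wt, map_mul, hιξ, map_intCast]
    push_cast; ring
  -- box principle
  let E := Fin S0 × Fin T × Fin T
  obtain ⟨p, hp0, hpx, hpz⟩ := D.box (E := E) (I := I)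
    (fun e i => if (e.2.1 : ℕ) + e.2.2 < T then wt e.1 e.2.1 e.2.2 i else 0) x y k
    (by
      intro e i
      split_ifs with hlt
      · refine (hHwt _ _ _ i hlt.le).trans ?_
        rw [hk]
        apply pow_le_pow_right₀ (by norm_num)
        have := Nat.mul_le_mul_left (3 * L) e.1.2.le
        omega
      · have := D.H_int 0
        simp only [Int.cast_zero, abs_zero] at this
        exact this.trans (by positivity))
    (by rw [hcardI]; exact hy)
    (by rw [hcardI]; simpa [E] using hbox) hx
  -- vanishing statements
  let Z : ℕ → ℕ → Prop := fun S R => ∀ s < S, ∀ t1 t2, t1 + t2 < R →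
    ∑ i, (p i : ℝ) * (Ac i : ℝ) ^ t1 * (Bc i : ℝ) ^ t2 * Real.exp (s * om i) = 0
  have hsum : ∀ s t1 t2, ∑ i, (p i : ℝ) * D.ι (wt s t1 t2 i) = D.ι g2 ^ (Q * s) *
      ∑ i, (p i : ℝ) * (Ac i : ℝ) ^ t1 * (Bc i : ℝ) ^ t2 * Real.exp (s * om i) := by
    intro s t1 t2
    rw [Finset.mul_sum]
    refine Finset.sum_congr rfl fun i _ => ?_
    rw [hιwt]; ring
  have hZ0 : Z S0 T := by
    intro s hs t1 t2 ht
    have := hpz (⟨s, hs⟩, ⟨t1, by omega⟩, ⟨t2, by omega⟩)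
    simp only [ht, if_true] at this
    rw [hsum] at this
    rcases mul_eq_zero.1 this with h1 | h1
    · exact absurd h1 (pow_pos hg2 _).ne'
    · exact h1
  have hN1 : 1 ≤ N := by rw [hN]; exact Nat.one_le_iff_ne_zero.2 (by positivity)
  -- smallness consequences
  have hΛ0 : 0 ≤ |Λ| := abs_nonneg _
  have hΛpow : ∀ e, e ≤ U → |Λ| * 2 ^ e ≤ 1 := by
    intro e he
    calc |Λ| * 2 ^ e ≤ |Λ| * 2 ^ U := by gcongr; norm_num
      _ ≤ 1 := hcon.le
  have hΛ1 : |Λ| ≤ 1 := by simpa using hΛpow 0 (by omega)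
  have hOm : ∀ i, |Om i| ≤ 2 * L := by
    intro i
    have e0 : Om i = om i - ((i.2.2 : ℕ) : ℝ) * Λ := by rw [hΛ]; ring
    have e1 : ((i.1 : ℕ) : ℝ) ≤ L := by exact_mod_cast hi1 i
    have e2 : ((i.2.1 : ℕ) : ℝ) ≤ L := by exact_mod_cast hi2 i
    have e3 : ((i.2.2 : ℕ) : ℝ) ≤ Q := by exact_mod_cast hi3 i
    rw [e0]
    have f1 : |((i.1 : ℕ) : ℝ) * l1| ≤ L * l1 := by
      rw [abs_mul, Nat.abs_cast, abs_of_nonneg hl1]; gcongr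
    have f2 : |((i.2.1 : ℕ) : ℝ) * l2| ≤ L * l2 := by
      rw [abs_mul, Nat.abs_cast, abs_of_nonneg hl2]; gcongr
    have f3 : |((i.2.2 : ℕ) : ℝ) * l3| ≤ Q * (h - 1) := by
      rw [abs_mul, Nat.abs_cast]; gcongr
    have f4 : |((i.2.2 : ℕ) : ℝ) * Λ| ≤ Q * 1 := by
      rw [abs_mul, Nat.abs_cast]; gcongr
    have f5 : (L:ℝ) = h * Q := by exact_mod_cast hL
    have f6 : (L:ℝ) * l1 + L * l2 ≤ L := by
      have : (L:ℝ) * (l1 + l2) ≤ L * 1 := by gcongr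
      linarith
    simp only [om]
    rw [abs_le] at f1 f2 f3 f4 ⊢
    constructor <;> linarith [f1.1, f1.2, f2.1, f2.2, f3.1, f3.2, f4.1, f4.2]
  -- step
  have hstep : ∀ S R, S0 ≤ S → S < N → R + T' ≤ T → Z S (R + T') → Z (S * ρ) R := by
    intro S R hS0S hSN hRT hz s' hs' t1 t2 ht
    have hS : 0 < S := by omega
    set S' := S * ρ with hS'
    have hSS' : S ≤ S' := Nat.le_mul_of_pos_right _ hρ
    have hS'N : S' ≤ ρ * N := by rw [hS', mul_comm]; gcongr
    set F : ℝ := 2 ^ (y + x + v * T + 15 * L * S') with hFd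
    have hct : ∀ i, |(p i : ℝ) * (Ac i : ℝ) ^ t1 * (Bc i : ℝ) ^ t2| ≤ 2 ^ x * 2 ^ (v * T) := by
      intro i
      have := hAB i t1 t2 (by omega)
      push_cast at this
      rw [mul_assoc, abs_mul]
      have := hpx i
      gcongr
    have hsumc : ∑ i, |(p i : ℝ) * (Ac i : ℝ) ^ t1 * (Bc i : ℝ) ^ t2| ≤ 2 ^ (y + x + v * T) := by
      refine (Finset.sum_le_card_nsmul _ _ _ (fun i _ => hct i)).trans ?_
      rw [Finset.card_univ, hcardI, nsmul_eq_mul, add_assoc, pow_add, pow_add]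
      have : (N : ℝ) ≤ 2 ^ y := by exact_mod_cast hy
      gcongr
    have hQS : (2:ℝ) * (S' * Q) ≤ 2 ^ u := by
      have : 2 * (S' * Q) ≤ 2 ^ u := by
        refine le_trans ?_ hu
        rw [← mul_assoc]
        exact Nat.mul_le_mul_right _ (Nat.mul_le_mul_left _ hS'N)
      exact_mod_cast this
    have hS'c : (80:ℝ) * S' ≤ 2 ^ c := by
      have : 80 * S' ≤ 2 ^ c := le_trans (by gcongr) hc
      exact_mod_cast this
    have key := step_analytic (fun i => (p i : ℝ) * (Ac i : ℝ) ^ t1 * (Bc i : ℝ) ^ t2)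
      (fun i => (Ac i : ℝ)) (fun i => (Bc i : ℝ)) om Om (fun i => (i.2.2 : ℕ)) l1 l2 Λ S T' S' Q L F
      hS hT'0 hSS' (fun i => rfl) hΛ hi3 hOm (one_le_pow₀ (by norm_num))
      (by rw [hFd, pow_add]; gcongr)
      (by
        intro s hs j1 j2 hj
        rw [← hz s hs (t1 + j1) (t2 + j2) (by omega)]
        refine Finset.sum_congr rfl fun i _ => ?_
        ring)
      (by
        have h1 := hΛpow u (by omega)
        have h2 : (S':ℝ) * Q ≤ 2 ^ u := by
          have : (0:ℝ) ≤ S' * Q := by positivity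
          linarith
        calc (S':ℝ) * Q * |Λ| ≤ 2 ^ u * |Λ| := by gcongr
          _ ≤ 1 := by rw [mul_comm]; exact h1)
      (by
        have hexpo : y + x + v * T + 15 * L * S' + u + c * (S * T') ≤ U := by
          refine le_trans ?_ hU
          gcongr
        have h1 := hΛpow _ hexpo
        have e1 : F * (2 * (S' * Q * |Λ|)) * (20 * S') ^ (S * T') * 4 ^ (S * T') =
          F * (2 * (S' * Q)) * (80 * S') ^ (S * T') * |Λ| := by
          rw [show (80:ℝ) * S' = 20 * S' * 4 by ring, mul_pow _ (4:ℝ)]; ring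
        rw [e1]
        calc F * (2 * (S' * Q)) * (80 * S') ^ (S * T') * |Λ| ≤
            F * 2 ^ u * (2 ^ c) ^ (S * T') * |Λ| := by gcongr
          _ = |Λ| * 2 ^ (y + x + v * T + 15 * L * S' + u + c * (S * T')) := by
            rw [hFd, ← pow_mul, ← pow_add, ← pow_add, mul_comm]
          _ ≤ 1 := h1) s' hs'
    by_contra hne
    have hιne : D.ι (∑ i, (p i : A) * wt s' t1 t2 i) ≠ 0 := by
      simp only [map_sum, map_mul, map_intCast]
      rw [hsum]
      exact mul_ne_zero (pow_pos hg2 _).ne' hne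
    have hLi := D.liou _ hιne
    have hHH := D.H_lin p (wt s' t1 t2) _ _ hpx (fun i => hHwt s' t1 t2 i (by omega))
    have hιle : |D.ι (∑ i, (p i : A) * wt s' t1 t2 i)| ≤ 2 ^ (L * S') * (4 * F / 4 ^ (S * T')) := by
      simp only [map_sum, map_mul, map_intCast]
      rw [hsum, abs_mul, abs_of_pos (pow_pos hg2 _)]
      have h1 : D.ι g2 ^ (Q * s') ≤ 2 ^ (L * S') := by
        have h2 : D.ι g2 ≤ 2 ^ h := (le_abs_self _).trans ((D.H_ι _).trans Hg2)
        calc D.ι g2 ^ (Q * s') ≤ (2 ^ h) ^ (Q * s') := by gcongr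
          _ = 2 ^ (L * s') := by rw [← pow_mul, hL, mul_assoc]
          _ ≤ _ := pow_le_pow_right₀ (by norm_num) (by gcongr)
      exact mul_le_mul h1 key (abs_nonneg _) (by positivity)
    have hHH' : D.H (∑ i, (p i : A) * wt s' t1 t2 i) ≤ 2 ^ (y + x + v * T + 3 * L * S') := by
      refine hHH.trans ?_
      rw [hcardI, add_assoc (y + x), pow_add _ (y + x), pow_add _ y]
      have : (N : ℝ) ≤ 2 ^ y := by exact_mod_cast hy
      have : (2:ℝ) ^ (v * T + 3 * L * s') ≤ 2 ^ (v * T + 3 * L * S') :=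
        pow_le_pow_right₀ (by norm_num) (by gcongr)
      gcongr
    have hfin : (1:ℝ) ≤ 2 ^ (L * S') * (4 * F / 4 ^ (S * T')) *
        (2 ^ (y + x + v * T + 3 * L * S')) ^ 5 := by
      refine hLi.trans ?_
      have := D.H_nonneg (∑ i, (p i : A) * wt s' t1 t2 i)
      gcongr
    have e2 : (2:ℝ) ^ (L * S') * (4 * F / 4 ^ (S * T')) * (2 ^ (y + x + v * T + 3 * L * S')) ^ 5
        = 2 ^ (L * S' + 2 + (y + x + v * T + 15 * L * S') + (y + x + v * T + 3 * L * S') * 5) /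
          2 ^ (2 * (S * T')) := by
      rw [show (4:ℝ) = 2 ^ 2 by norm_num, ← pow_mul, ← pow_mul, hFd]
      simp only [pow_add]
      ring
    rw [e2, one_le_div (by positivity)] at hfin
    have hfin2 := (pow_le_pow_iff_right₀ (by norm_num : (1:ℝ) < 2)).1 hfin
    obtain ⟨d, rfl⟩ := Nat.exists_eq_add_of_le hS0S
    have e3 := Nat.mul_le_mul_right d hstep1
    have e4 : L * S' = L * ρ * S0 + L * ρ * d := by rw [hS']; ring
    have e5 : 2 * ((S0 + d) * T') = 2 * S0 * T' + 2 * T' * d := by ring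
    have e6 : 31 * L * ρ * d = 31 * (L * ρ * d) := by ring
    have e7 : 31 * L * ρ * S0 = 31 * (L * ρ * S0) := by ring
    rw [mul_assoc 15, mul_assoc 3] at hfin2
    omega
  -- iteration
  have hiter : ∀ j, j < J → (∃ S, N ≤ S ∧ Z S 1) ∨ Z (S0 * ρ ^ j) ((J - j) * T') := by
    intro j
    induction j with
    | zero => intro _; right; simpa [← hT] using hZ0
    | succ j ih =>
      intro hj
      rcases ih (by omega) with h1 | h1
      · exact Or.inl h1
      · by_cases hlt : S0 * ρ ^ j < N
        · right
          have e1 : (J - j) * T' = (J - (j + 1)) * T' + T' := by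
            rw [← Nat.succ_mul]; congr 1; omega
          rw [e1] at h1
          rw [pow_succ, ← mul_assoc]
          refine hstep _ _ (Nat.le_mul_of_pos_right _ (by positivity)) hlt ?_ h1
          rw [← e1, hT]; gcongr; omega
        · left
          refine ⟨_, not_lt.1 hlt, fun s hs t1 t2 ht => h1 s hs t1 t2 (lt_of_lt_of_le ht ?_)⟩
          exact Nat.one_le_iff_ne_zero.2 (Nat.mul_ne_zero (by omega) (by omega))
  have hZfin : ∃ S, N ≤ S ∧ Z S 1 := by
    rcases hiter (J - 1) (by omega) with h1 | h1
    · exact h1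
    · refine ⟨_, hJ, fun s hs t1 t2 ht => h1 s hs t1 t2 (lt_of_lt_of_le ht ?_)⟩
      exact Nat.one_le_iff_ne_zero.2 (Nat.mul_ne_zero (by omega) (by omega))
  obtain ⟨S, hNS, hz⟩ := hZfin
  -- Vandermonde
  have hinj : Function.Injective (fun i => Real.exp (om i)) := by
    intro i j hij
    have h1 := Real.exp_injective hij
    have h2 := hind ((i.1 : ℤ) - (j.1 : ℤ)) ((i.2.1 : ℤ) - (j.2.1 : ℤ)) ((i.2.2 : ℤ) - (j.2.2 : ℤ)) (by
      simp only [om] at h1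
      push_cast
      linarith)
    obtain ⟨q1, q2, q3⟩ := h2
    refine Prod.ext (Fin.ext ?_) (Prod.ext (Fin.ext ?_) (Fin.ext ?_)) <;> omega
  let e := Fintype.equivFinOfCardEq hcardI
  have hvan : (fun a : Fin N => (p (e.symm a) : ℝ)) = 0 := by
    apply Matrix.eq_zero_of_forall_pow_sum_mul_pow_eq_zero
      (f := fun a : Fin N => Real.exp (om (e.symm a)))
    · exact hinj.comp e.symm.injective
    · intro s
      have h1 := hz s (by omega) 0 0 (by omega)
      simp only [pow_zero, mul_one] at h1
      rw [← e.symm.sum_comp] at h1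
      rw [← h1]
      refine Finset.sum_congr rfl fun a _ => ?_
      rw [Real.exp_nat_mul]
  apply hp0
  funext i
  have := congrFun hvan (e i)
  simpa using this

theorem baker_param {A : Type} [CommRing A] (D : LData A) (a1 a2 g1 g2 : A) (l1 l2 l3 : ℝ) (m n : ℤ)
    (h J : ℕ)
    (ha1 : D.ι a1 = Real.exp l1) (ha2 : D.ι a2 = Real.exp l2) (hg2 : 0 < D.ι g2)
    (hg1 : D.ι g1 = D.ι g2 * Real.exp l3)
    (Ha1 : D.H a1 ≤ 2) (Ha2 : D.H a2 ≤ 2) (Hg1 : D.H g1 ≤ 2 ^ h) (Hg2 : D.H g2 ≤ 2 ^ h)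
    (hl1 : 0 ≤ l1) (hl2 : 0 ≤ l2) (hl12 : l1 + l2 ≤ 1) (hl3 : |l3| ≤ h - 1)
    (hind : ∀ a b c : ℤ, a * l1 + b * l2 + c * l3 = 0 → a = 0 ∧ b = 0 ∧ c = 0)
    (hh : 1 ≤ h) (hJ : 1 ≤ J)
    (hN : 2 ^ 94 * h ^ 2 * J ^ 12 ≤ 2 ^ (5 * J))
    (hm : 2 ^ 31 * J ^ 4 * (m.natAbs + h) ≤ 2 ^ (8 * J))
    (hn : 2 ^ 31 * J ^ 4 * (n.natAbs + h) ≤ 2 ^ (8 * J)) :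
    1 ≤ |l3 + m * l1 - n * l2| * 2 ^ (2 ^ 140 * h ^ 3 * J ^ 17) := by
  obtain ⟨Q, hQ⟩ : ∃ Q, Q = 2 ^ 31 * J ^ 4 := ⟨_, rfl⟩
  obtain ⟨L, hL⟩ : ∃ L, L = h * Q := ⟨_, rfl⟩
  obtain ⟨N, hNd⟩ : ∃ N, N = (L + 1) * ((L + 1) * (Q + 1)) := ⟨_, rfl⟩
  obtain ⟨S0, hS0⟩ : ∃ S0, S0 = 2 ^ 7 * J ^ 2 := ⟨_, rfl⟩
  have hJ2 : 1 ≤ J ^ 2 := Nat.one_le_pow _ _ hJ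
  have hJ4 : 1 ≤ J ^ 4 := Nat.one_le_pow _ _ hJ
  have hJJ2 : J ≤ J ^ 2 := Nat.le_self_pow (by norm_num) _
  have hJ24 : J ^ 2 ≤ J ^ 4 := Nat.pow_le_pow_right hJ (by norm_num)
  have hQ1 : 2 ^ 31 ≤ Q := by rw [hQ]; exact Nat.le_mul_of_pos_right _ hJ4
  have hQL : Q ≤ L := by rw [hL]; exact Nat.le_mul_of_pos_left _ hh
  -- bounds for N
  have hNlow : L * L * Q ≤ N := by
    rw [hNd, mul_assoc]; gcongr <;> omega
  have hNup : N ≤ 2 * (L * L * Q) := by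
    have e1 : 5 * (L + 1) ≤ 6 * L := by omega
    have e2 : 5 * (Q + 1) ≤ 6 * Q := by omega
    have e3 : (5 * (L + 1)) * ((5 * (L + 1)) * (5 * (Q + 1))) ≤ 6 * L * (6 * L * (6 * Q)) := by
      gcongr
    have e4 : (5 * (L + 1)) * ((5 * (L + 1)) * (5 * (Q + 1))) = 125 * N := by rw [hNd]; ring
    have e5 : 6 * L * (6 * L * (6 * Q)) = 216 * (L * L * Q) := by ring
    omega
  have hN5 : N ≤ 2 ^ (5 * J) := by
    refine (hNup.trans (le_of_eq ?_)).trans hN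
    rw [hL, hQ]; ring
  have hQN : Q ≤ N := by
    refine le_trans ?_ hNlow
    exact Nat.le_mul_of_pos_left _ (Nat.mul_pos (by omega) (by omega))
  have hLS0 : 5 * J ≤ L * S0 := by
    have : J ≤ S0 := by rw [hS0]; omega
    have : 5 * S0 ≤ L * S0 := Nat.mul_le_mul_right _ (by omega)
    omega
  have hLN : 0 < L * S0 := Nat.mul_pos (by omega) (by rw [hS0]; omega)
  refine baker_core D a1 a2 g1 g2 l1 l2 l3 m n h Q L N (8 * J) (5 * J)
    (8 * J * (J * (2 ^ 10 * L)) + 3 * L * S0) (5 * J + (8 * J * (J * (2 ^ 10 * L)) + 3 * L * S0) + 1)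
    (6 + 10 * J) (12 + 5 * J) S0 (2 ^ 10 * L) (J * (2 ^ 10 * L)) J 32 _
    ha1 ha2 hg2 hg1 Ha1 Ha2 Hg1 Hg2 hl1 hl2 hl12 hl3 hind hL hNd rfl ?_ ?_ hN5 ?_ rfl rfl ?_ ?_ hJ
    (by norm_num) ?_ ?_ ?_ ?_ ?_ ?_
  · rw [hL, mul_comm h, ← mul_add, hQ]; exact hm
  · rw [hL, mul_comm h, ← mul_add, hQ]; exact hn
  · refine lt_of_lt_of_le ?_ hNlow
    have e1 : 12 * (S0 * (J * (2 ^ 10 * L) * (J * (2 ^ 10 * L)))) = L * L * (12 * 2 ^ 27 * J ^ 4) := by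
      rw [hS0]; ring
    rw [e1]
    apply Nat.mul_lt_mul_of_pos_left
    · rw [hQ]; omega
    · exact Nat.mul_pos (by omega) (by omega)
  · omega
  · rw [hS0]; omega
  · omega
  · have e1 : 8 * J * (J * (2 ^ 10 * L)) = 64 * (L * S0) := by rw [hS0]; ring
    have e2 : 3 * L * S0 = 3 * (L * S0) := by ring
    have e3 : 31 * L * 32 * S0 = 992 * (L * S0) := by ring
    have e4 : 2 * S0 * (2 ^ 10 * L) = 2048 * (L * S0) := by ring
    rw [e1, e2, e3, e4]
    omega
  · refine hN5.trans ?_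
    have e1 : 5 * J = 5 * (J - 1) + 5 := by omega
    rw [e1, pow_add, pow_mul, mul_comm]
    gcongr
    · rw [hS0]; omega
    · norm_num
  · calc 2 * (32 * N) * Q ≤ 2 * (32 * 2 ^ (5 * J)) * 2 ^ (5 * J) := by
          gcongr; exact hQN.trans hN5
      _ = _ := by rw [pow_add, show 10 * J = 5 * J + 5 * J by ring, pow_add]; ring
  · calc 80 * (32 * N) ≤ 128 * (32 * 2 ^ (5 * J)) := by gcongr; norm_num
      _ = _ := by rw [pow_add]; ring
  · have e1 : 8 * J * (J * (2 ^ 10 * L)) = 64 * (L * S0) := by rw [hS0]; ring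
    have e2 : 3 * L * S0 = 3 * (L * S0) := by ring
    have e3 : 15 * L * (32 * N) = 480 * (L * N) := by ring
    have e4 : (12 + 5 * J) * (N * (2 ^ 10 * L)) = 12288 * (L * N) + 5120 * (J * (L * N)) := by ring
    have e5 : L * S0 ≤ L * N := by
      apply Nat.mul_le_mul_left
      refine le_trans ?_ hQN
      rw [hS0, hQ]; omega
    have e6 : L * N ≤ J * (L * N) := Nat.le_mul_of_pos_left _ hJ
    have e7 : J * (L * N) ≤ J * (L * (2 * (L * L * Q))) := by gcongr
    have e8 : 2 ^ 140 * h ^ 3 * J ^ 17 = 32768 * (J * (L * (2 * (L * L * Q)))) := by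
      rw [hL, hQ]; ring
    rw [e1, e2, e3, e4, e8]
    omega

/-! ### The plastic number and the field -/

lemma plas_exists : ∃ x : ℝ, 1.3247 < x ∧ x < 1.3248 ∧ x ^ 3 = x + 1 := by
  have hc : ContinuousOn (fun x : ℝ => x ^ 3 - x - 1) (Set.Icc 1.3247 1.3248) := by fun_prop
  have := intermediate_value_Ioo (by norm_num : (1.3247:ℝ) ≤ 1.3248) hc
  obtain ⟨x, hx, hx0⟩ := this (show (0:ℝ) ∈ Set.Ioo _ _ by constructor <;> norm_num)
  exact ⟨x, hx.1, hx.2, by linarith⟩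

/-- The plastic number. -/
noncomputable def plas : ℝ := Classical.choose plas_exists

lemma plas_gt : 1.3247 < plas := (Classical.choose_spec plas_exists).1
lemma plas_lt : plas < 1.3248 := (Classical.choose_spec plas_exists).2.1
lemma plas_cube : plas ^ 3 = plas + 1 := (Classical.choose_spec plas_exists).2.2
lemma plas_pos : 0 < plas := by linarith [plas_gt]

/-- The sextic field. -/
noncomputable def KF : IntermediateField ℚ ℝ :=
  IntermediateField.adjoin ℚ {plas} ⊔ IntermediateField.adjoin ℚ {Real.goldenRatio}

lemma plas_int : IsIntegral ℤ plas :=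
  ⟨Polynomial.X ^ 3 - Polynomial.X - 1, by monicity!, by simp [plas_cube]⟩

lemma gold_int : IsIntegral ℤ Real.goldenRatio :=
  ⟨Polynomial.X ^ 2 - Polynomial.X - 1, by monicity!, by simp [Real.goldenRatio_sq]⟩

lemma plas_mem : plas ∈ KF :=
  (le_sup_left : IntermediateField.adjoin ℚ {plas} ≤ KF)
    (IntermediateField.mem_adjoin_simple_self ℚ _)

lemma gold_mem : Real.goldenRatio ∈ KF :=
  (le_sup_right : IntermediateField.adjoin ℚ {Real.goldenRatio} ≤ KF)
    (IntermediateField.mem_adjoin_simple_self ℚ _)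

lemma plas_intQ : IsIntegral ℚ plas := plas_int.tower_top
lemma gold_intQ : IsIntegral ℚ Real.goldenRatio := gold_int.tower_top

instance : FiniteDimensional ℚ (IntermediateField.adjoin ℚ {plas}) :=
  IntermediateField.adjoin.finiteDimensional plas_intQ

instance : FiniteDimensional ℚ (IntermediateField.adjoin ℚ {Real.goldenRatio}) :=
  IntermediateField.adjoin.finiteDimensional gold_intQ

instance : FiniteDimensional ℚ KF := by
  unfold KF; infer_instance

instance : NumberField KF where

lemma KF_finrank : Module.finrank ℚ KF ≤ 6 := by
  have h1 : Module.finrank ℚ (IntermediateField.adjoin ℚ {plas}) ≤ 3 := by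
    rw [IntermediateField.adjoin.finrank plas_intQ]
    refine (Polynomial.natDegree_le_of_dvd (minpoly.dvd ℚ plas
      (p := Polynomial.X ^ 3 - Polynomial.X - 1) (by simp [plas_cube])) ?_).trans ?_
    · exact Polynomial.Monic.ne_zero (by monicity!)
    · compute_degree
  have h2 : Module.finrank ℚ (IntermediateField.adjoin ℚ {Real.goldenRatio}) ≤ 2 := by
    rw [IntermediateField.adjoin.finrank gold_intQ]
    refine (Polynomial.natDegree_le_of_dvd (minpoly.dvd ℚ Real.goldenRatio
      (p := Polynomial.X ^ 2 - Polynomial.X - 1) (by simp [Real.goldenRatio_sq])) ?_).trans ?_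
    · exact Polynomial.Monic.ne_zero (by monicity!)
    · compute_degree
  have h3 := IntermediateField.finrank_sup_le (IntermediateField.adjoin ℚ {plas})
    (IntermediateField.adjoin ℚ {Real.goldenRatio})
  calc Module.finrank ℚ KF ≤ _ := h3
    _ ≤ 3 * 2 := Nat.mul_le_mul h1 h2
    _ = 6 := rfl

/-- The standard embedding. -/
noncomputable def KFstd : KF →ₐ[ℚ] ℂ :=
  (IsScalarTower.toAlgHom ℚ ℝ ℂ).comp KF.val

/-- The house of an algebraic number in the field. -/
noncomputable def KFhouse (x : KF) : ℝ :=
  Finset.univ.sup' ⟨KFstd, Finset.mem_univ _⟩ (fun σ : KF →ₐ[ℚ] ℂ => ‖σ x‖)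

lemma le_KFhouse (x : KF) (σ : KF →ₐ[ℚ] ℂ) : ‖σ x‖ ≤ KFhouse x :=
  Finset.le_sup' (fun σ : KF →ₐ[ℚ] ℂ => ‖σ x‖) (Finset.mem_univ σ)

lemma KFhouse_le (x : KF) (B : ℝ) (h : ∀ σ : KF →ₐ[ℚ] ℂ, ‖σ x‖ ≤ B) : KFhouse x ≤ B :=
  Finset.sup'_le _ _ (fun σ _ => h σ)

lemma KFhouse_nonneg (x : KF) : 0 ≤ KFhouse x := (norm_nonneg _).trans (le_KFhouse x KFstd)

lemma KFstd_apply (x : KF) : KFstd x = ((x : ℝ) : ℂ) := rfl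

lemma KF_liou (x : NumberField.RingOfIntegers KF) (hx : x ≠ 0) :
    1 ≤ |((x : KF) : ℝ)| * KFhouse (x : KF) ^ 5 := by
  classical
  have h0 : Algebra.norm ℤ x ≠ 0 := by
    rwa [Ne, Algebra.norm_eq_zero_iff]
  have h1 : (1:ℝ) ≤ |((Algebra.norm ℤ x : ℤ) : ℝ)| := by
    exact_mod_cast Int.one_le_abs h0
  have h2 : ((Algebra.norm ℤ x : ℤ) : ℂ) = ∏ σ : KF →ₐ[ℚ] ℂ, σ (x : KF) := by
    rw [← Algebra.norm_eq_prod_embeddings ℚ ℂ (x : KF), ← Algebra.coe_norm_int]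
    simp
  have h3 : |((Algebra.norm ℤ x : ℤ) : ℝ)| = ∏ σ : KF →ₐ[ℚ] ℂ, ‖σ (x : KF)‖ := by
    rw [← norm_prod, ← h2]
    simp
  rw [h3, ← Finset.mul_prod_erase _ _ (Finset.mem_univ KFstd)] at h1
  have h4 : ∏ σ ∈ Finset.univ.erase KFstd, ‖σ (x : KF)‖ ≤
      KFhouse (x : KF) ^ (Finset.univ.erase KFstd).card :=
    (Finset.prod_le_prod (fun σ _ => norm_nonneg _) (fun σ _ => le_KFhouse _ σ)).trans
      (by rw [Finset.prod_const])
  have hcard : (Finset.univ.erase KFstd).card ≤ 5 := by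
    rw [Finset.card_erase_of_mem (Finset.mem_univ _), Finset.card_univ, AlgHom.card]
    have := KF_finrank
    omega
  have h5 : ‖KFstd (x : KF)‖ = |((x : KF) : ℝ)| := by
    rw [KFstd_apply, Complex.norm_real, Real.norm_eq_abs]
  rw [h5] at h1
  have hH1 : 1 ≤ KFhouse (x : KF) := by
    by_contra hlt
    push Not at hlt
    have h6 : |((x : KF) : ℝ)| ≤ KFhouse (x : KF) := h5 ▸ le_KFhouse _ _
    have h7 : KFhouse (x : KF) ^ (Finset.univ.erase KFstd).card ≤ 1 :=
      pow_le_one₀ (KFhouse_nonneg _) hlt.le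
    nlinarith [abs_nonneg ((x : KF) : ℝ), mul_le_mul_of_nonneg_left (h4.trans h7) (abs_nonneg ((x : KF) : ℝ))]
  calc 1 ≤ _ := h1
    _ ≤ |((x : KF) : ℝ)| * KFhouse (x : KF) ^ 5 := by
      gcongr
      exact h4.trans (pow_le_pow_right₀ hH1 hcard)

/-- The arithmetic data of the sextic field. -/
noncomputable def KFdata : LData (NumberField.RingOfIntegers KF) where
  ι := (KF.val : KF →+* ℝ).comp (algebraMap (NumberField.RingOfIntegers KF) KF)
  H x := KFhouse (x : KF)
  H_nonneg x := KFhouse_nonneg _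
  H_add x y := KFhouse_le _ _ fun σ => by
    rw [show ((x + y : NumberField.RingOfIntegers KF) : KF) = x + y from rfl, map_add]
    exact (norm_add_le _ _).trans (add_le_add (le_KFhouse _ σ) (le_KFhouse _ σ))
  H_mul x y := KFhouse_le _ _ fun σ => by
    rw [show ((x * y : NumberField.RingOfIntegers KF) : KF) = x * y from rfl, map_mul, norm_mul]
    exact mul_le_mul (le_KFhouse _ σ) (le_KFhouse _ σ) (norm_nonneg _) (KFhouse_nonneg _)
  H_int n := KFhouse_le _ _ fun σ => by simp
  H_ι x := by
    have := le_KFhouse (x : KF) KFstd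
    rw [KFstd_apply, Complex.norm_real, Real.norm_eq_abs] at this
    exact this
  liou x hx := KF_liou x (by rintro rfl; simp at hx)

/-- The plastic number as an algebraic integer. -/
noncomputable def eD : NumberField.RingOfIntegers KF :=
  ⟨⟨plas, plas_mem⟩, by
    have := plas_int
    exact (isIntegral_algebraMap_iff (algebraMap KF ℝ).injective).1 this⟩

/-- The golden ratio as an algebraic integer. -/
noncomputable def eP : NumberField.RingOfIntegers KF :=
  ⟨⟨Real.goldenRatio, gold_mem⟩, by
    have := gold_int
    exact (isIntegral_algebraMap_iff (algebraMap KF ℝ).injective).1 this⟩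

lemma ι_eD : KFdata.ι eD = plas := rfl
lemma ι_eP : KFdata.ι eP = Real.goldenRatio := rfl

lemma KFι_inj : Function.Injective KFdata.ι := by
  intro x y h
  exact NumberField.RingOfIntegers.ext (Subtype.ext h)

lemma eD_cube : eD ^ 3 = eD + 1 := KFι_inj (by simp [ι_eD, plas_cube])
lemma eP_sq : eP ^ 2 = eP + 1 := KFι_inj (by simp [ι_eP, Real.goldenRatio_sq])

lemma H_of_forall (x : NumberField.RingOfIntegers KF) (B : ℝ)
    (h : ∀ σ : NumberField.RingOfIntegers KF →+* ℂ, ‖σ x‖ ≤ B) : KFdata.H x ≤ B :=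
  KFhouse_le _ _ fun σ => h ((σ : KF →+* ℂ).comp (algebraMap _ KF))

/-! ### Heights and the linear forms -/

/-- The factor attached to a gap of Padovan indices; the value zero stands for an infinite gap. -/
noncomputable def gd (k : ℕ) : ℝ := if k = 0 then 1 else 1 - (plas ^ k)⁻¹

/-- The factor attached to a gap of Fibonacci indices; the value zero stands for an infinite gap. -/
noncomputable def gp (l : ℕ) : ℝ := if l = 0 then 1 else 1 - (Real.goldenRatio ^ l)⁻¹

lemma gold_gt : 1.618 < Real.goldenRatio := by
  have h := Real.goldenRatio_sq
  have h1 := Real.one_lt_goldenRatio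
  nlinarith

lemma gold_lt : Real.goldenRatio < 1.6181 := by
  have h := Real.goldenRatio_sq
  have h1 := Real.one_lt_goldenRatio
  nlinarith

lemma gd_bounds (k : ℕ) : 0.24 < gd k ∧ gd k ≤ 1 := by
  unfold gd
  split_ifs with h
  · norm_num
  · have h1 : plas ≤ plas ^ k := le_self_pow₀ (by linarith [plas_gt]) h
    have h0 := plas_gt
    have hp : 0 < plas ^ k := pow_pos plas_pos k
    have h2 : (plas ^ k)⁻¹ ≤ (1.3247)⁻¹ := by
      gcongr; linarith
    constructor
    · have : (1.3247:ℝ)⁻¹ < 0.76 := by norm_num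
      linarith
    · have := inv_pos.2 hp
      linarith

lemma gp_bounds (k : ℕ) : 0.38 < gp k ∧ gp k ≤ 1 := by
  unfold gp
  split_ifs with h
  · norm_num
  · have h1 : Real.goldenRatio ≤ Real.goldenRatio ^ k := le_self_pow₀ (by linarith [gold_gt]) h
    have h0 := gold_gt
    have hp : 0 < Real.goldenRatio ^ k := pow_pos (by linarith) k
    have h2 : (Real.goldenRatio ^ k)⁻¹ ≤ (1.618)⁻¹ := by
      gcongr; linarith
    constructor
    · have : (1.618:ℝ)⁻¹ < 0.62 := by norm_num
      linarith
    · have := inv_pos.2 hp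
      linarith

lemma gd_pos (k : ℕ) : 0 < gd k := by linarith [(gd_bounds k).1]
lemma gp_pos (k : ℕ) : 0 < gp k := by linarith [(gp_bounds k).1]

/-- The constant logarithm. -/
noncomputable def gam (k l : ℕ) : ℝ :=
  ((2 * Real.goldenRatio - 1) * plas ^ 4 * gd k) / ((3 * plas ^ 2 - 1) * gp l)

/-- The ring element for `gd`. -/
noncomputable def egd (k : ℕ) : NumberField.RingOfIntegers KF :=
  if k = 0 then 1 else 1 - (eD ^ 2 - 1) ^ k

/-- The ring element for `gp`. -/
noncomputable def egp (k : ℕ) : NumberField.RingOfIntegers KF :=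
  if k = 0 then 1 else 1 - (eP - 1) ^ k

lemma plas_inv : plas⁻¹ = plas ^ 2 - 1 := by
  have := plas_cube
  have h := plas_pos
  field_simp
  linarith

lemma gold_inv : Real.goldenRatio⁻¹ = Real.goldenRatio - 1 := by
  have := Real.goldenRatio_sq
  exact inv_eq_of_mul_eq_one_right (by linear_combination this)

lemma ι_egd (k : ℕ) : KFdata.ι (egd k) = gd k := by
  unfold egd gd
  split_ifs
  · simp
  · rw [← inv_pow, plas_inv]; simp [ι_eD]

lemma ι_egp (k : ℕ) : KFdata.ι (egp k) = gp k := by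
  unfold egp gp
  split_ifs
  · simp
  · rw [← inv_pow, gold_inv]; simp [ι_eP]

lemma H_eD : KFdata.H eD ≤ 2 := H_of_forall _ _ fun σ => by
  have h : σ eD ^ 3 = σ eD + 1 := by rw [← map_pow, eD_cube]; simp
  have h2 : ‖σ eD‖ ^ 3 ≤ ‖σ eD‖ + 1 := by
    rw [← norm_pow, h]; exact (norm_add_le _ _).trans (by simp)
  by_contra hc
  push Not at hc
  nlinarith [mul_pos (sub_pos.2 hc) (sub_pos.2 hc)]

lemma H_eDi : KFdata.H (eD ^ 2 - 1) ≤ 2 := H_of_forall _ _ fun σ => by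
  have h : σ eD ^ 3 = σ eD + 1 := by rw [← map_pow, eD_cube]; simp
  have hz : σ (eD ^ 2 - 1) ^ 3 = 1 - σ (eD ^ 2 - 1) ^ 2 := by
    simp only [map_sub, map_pow, map_one]
    linear_combination (σ eD ^ 3 + 1 - σ eD) * h
  have h2 : ‖σ (eD ^ 2 - 1)‖ ^ 3 ≤ 1 + ‖σ (eD ^ 2 - 1)‖ ^ 2 := by
    rw [← norm_pow, hz]; exact (norm_sub_le _ _).trans (by simp)
  by_contra hc
  push Not at hc
  nlinarith [mul_pos (sub_pos.2 hc) (sub_pos.2 hc)]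

lemma H_eP : KFdata.H eP ≤ 2 := H_of_forall _ _ fun σ => by
  have h : σ eP ^ 2 = σ eP + 1 := by rw [← map_pow, eP_sq]; simp
  have h2 : ‖σ eP‖ ^ 2 ≤ ‖σ eP‖ + 1 := by
    rw [← norm_pow, h]; exact (norm_add_le _ _).trans (by simp)
  by_contra hc
  push Not at hc
  nlinarith

lemma H_ePi : KFdata.H (eP - 1) ≤ 2 := H_of_forall _ _ fun σ => by
  have h : σ eP ^ 2 = σ eP + 1 := by rw [← map_pow, eP_sq]; simp
  have hz : σ (eP - 1) ^ 2 = 1 - σ (eP - 1) := by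
    simp only [map_sub, map_one]
    linear_combination h
  have h2 : ‖σ (eP - 1)‖ ^ 2 ≤ 1 + ‖σ (eP - 1)‖ := by
    rw [← norm_pow, hz]; exact (norm_sub_le _ _).trans (by simp)
  by_contra hc
  push Not at hc
  nlinarith

lemma LData.H_neg_le {A : Type} [CommRing A] (D : LData A) (x : A) : D.H (-x) ≤ D.H x := by
  have h1 := D.H_mul ((-1 : ℤ) : A) x
  have h2 := D.H_int (-1)
  have h3 : ((-1 : ℤ) : A) * x = - x := by simp
  rw [h3] at h1
  have h4 : |((-1 : ℤ) : ℝ)| = 1 := by simp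
  rw [h4] at h2
  nlinarith [D.H_nonneg x]

lemma LData.H_sub_le {A : Type} [CommRing A] (D : LData A) (x y : A) (a b : ℝ)
    (hx : D.H x ≤ a) (hy : D.H y ≤ b) : D.H (x - y) ≤ a + b := by
  rw [sub_eq_add_neg]
  exact (D.H_add _ _).trans (add_le_add hx ((D.H_neg_le y).trans hy))

lemma H_one_sub_pow (z : NumberField.RingOfIntegers KF) (hz : KFdata.H z ≤ 2) (k : ℕ) :
    KFdata.H (1 - z ^ k) ≤ 2 ^ (k + 1) := by
  refine (KFdata.H_sub_le _ _ _ _ KFdata.H_one (KFdata.H_pow_le z k 2 hz)).trans ?_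
  have : (1:ℝ) ≤ 2 ^ k := one_le_pow₀ (by norm_num)
  rw [pow_succ]; linarith

lemma H_egd (k : ℕ) : KFdata.H (egd k) ≤ 2 ^ (k + 1) := by
  unfold egd
  split_ifs
  · exact KFdata.H_one.trans (one_le_pow₀ (by norm_num))
  · exact H_one_sub_pow _ H_eDi k

lemma H_egp (k : ℕ) : KFdata.H (egp k) ≤ 2 ^ (k + 1) := by
  unfold egp
  split_ifs
  · exact KFdata.H_one.trans (one_le_pow₀ (by norm_num))
  · exact H_one_sub_pow _ H_ePi k

lemma H_two : KFdata.H 2 ≤ 2 := by simpa using KFdata.H_int 2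
lemma H_three : KFdata.H 3 ≤ 3 := by simpa using KFdata.H_int 3

lemma H_g1 (k l : ℕ) : KFdata.H ((2 * eP - 1) * eD ^ 4 * egd k) ≤ 2 ^ (8 + k + l) := by
  refine (KFdata.H_mul_le _ _ _ _ (KFdata.H_mul_le _ _ _ _ (KFdata.H_sub_le _ _ _ _
    (KFdata.H_mul_le _ _ _ _ H_two H_eP) KFdata.H_one) (KFdata.H_pow_le _ 4 _ H_eD))
    (H_egd k)).trans ?_
  have : (1:ℝ) ≤ 2 ^ l := one_le_pow₀ (by norm_num)
  have h2 : (0:ℝ) < 2 ^ k := by positivity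
  rw [pow_add _ (8 + k), pow_add _ 8 k, pow_succ _ k]
  nlinarith [mul_le_mul_of_nonneg_left this h2.le]

lemma H_g2 (k l : ℕ) : KFdata.H ((3 * eD ^ 2 - 1) * egp l) ≤ 2 ^ (8 + k + l) := by
  refine (KFdata.H_mul_le _ _ _ _ (KFdata.H_sub_le _ _ _ _
    (KFdata.H_mul_le _ _ _ _ H_three (KFdata.H_pow_le _ 2 _ H_eD)) KFdata.H_one)
    (H_egp l)).trans ?_
  have : (1:ℝ) ≤ 2 ^ k := one_le_pow₀ (by norm_num)
  have h2 : (0:ℝ) < 2 ^ l := by positivity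
  rw [pow_add _ (8 + k), pow_add _ 8 k, pow_succ _ l]
  nlinarith [mul_le_mul_of_nonneg_left this h2.le]

lemma ι_two : KFdata.ι 2 = 2 := by exact_mod_cast map_natCast KFdata.ι 2
lemma ι_three : KFdata.ι 3 = 3 := by exact_mod_cast map_natCast KFdata.ι 3

lemma gam_bounds (k l : ℕ) : 0.1 < gam k l ∧ gam k l < 8 := by
  have h1 := gd_bounds k
  have h2 := gp_bounds l
  have h3 := plas_gt
  have h4 := plas_lt
  have h5 := gold_gt
  have h6 := gold_lt
  have h7 := plas_cube
  have h8 : plas ^ 4 = plas ^ 2 + plas := by rw [pow_succ, h7]; ring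
  have h9 : 1.75 < plas ^ 2 := by nlinarith
  have h10 : plas ^ 2 < 1.756 := by nlinarith
  have h11 : 6 < (2 * Real.goldenRatio - 1) * plas ^ 4 := by rw [h8]; nlinarith
  have h12 : (2 * Real.goldenRatio - 1) * plas ^ 4 < 7 := by rw [h8]; nlinarith
  unfold gam
  have hden : 0 < (3 * plas ^ 2 - 1) * gp l := by nlinarith
  rw [lt_div_iff₀ hden, div_lt_iff₀ hden]
  constructor <;> nlinarith

lemma gam_pos (k l : ℕ) : 0 < gam k l := by linarith [(gam_bounds k l).1]

lemma log_plas_bounds : 0 < Real.log plas ∧ Real.log plas ≤ 0.3248 := by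
  refine ⟨Real.log_pos (by linarith [plas_gt]), ?_⟩
  have := Real.log_le_sub_one_of_pos plas_pos
  linarith [plas_lt]

lemma log_gold_bounds : 0 < Real.log Real.goldenRatio ∧ Real.log Real.goldenRatio ≤ 0.6181 := by
  refine ⟨Real.log_pos (by linarith [gold_gt]), ?_⟩
  have := Real.log_le_sub_one_of_pos Real.goldenRatio_pos
  linarith [gold_lt]

theorem lower_of_ind (k l : ℕ) (m n : ℤ) (J : ℕ)
    (hind : ∀ a b c : ℤ, a * Real.log plas + b * Real.log Real.goldenRatio +
      c * Real.log (gam k l) = 0 → a = 0 ∧ b = 0 ∧ c = 0)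
    (hJ : 1 ≤ J) (hN : 2^94*(8 + k + l)^2*J^12 ≤ 2^(5*J))
    (hm : 2^31*J^4*(m.natAbs + (8 + k + l)) ≤ 2^(8*J))
    (hn : 2^31*J^4*(n.natAbs + (8 + k + l)) ≤ 2^(8*J)) :
    1 ≤ |Real.log (gam k l) + m * Real.log plas - n * Real.log Real.goldenRatio| *
      2^(2^140 * (8 + k + l)^3 * J^17) := by
  have hg := gam_bounds k l
  refine baker_param KFdata eD eP ((2 * eP - 1) * eD ^ 4 * egd k) ((3 * eD ^ 2 - 1) * egp l)
    (Real.log plas) (Real.log Real.goldenRatio) (Real.log (gam k l)) m n (8 + k + l) J ?_ ?_ ?_ ?_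
    H_eD H_eP (H_g1 k l) (H_g2 k l) log_plas_bounds.1.le log_gold_bounds.1.le
    (by linarith [log_plas_bounds.2, log_gold_bounds.2]) ?_ hind (by omega) hJ hN hm hn
  · rw [Real.exp_log plas_pos, ι_eD]
  · rw [Real.exp_log Real.goldenRatio_pos, ι_eP]
  · have : (0:ℝ) < 3 * plas ^ 2 - 1 := by nlinarith [plas_gt]
    simpa [ι_eD, ι_egp, ι_three] using mul_pos this (gp_pos l)
  · rw [Real.exp_log (gam_pos k l)]
    have : (0:ℝ) < 3 * plas ^ 2 - 1 := by nlinarith [plas_gt]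
    have h2 := gp_pos l
    unfold gam
    simp only [map_mul, map_sub, map_pow, ι_eD, ι_eP, ι_egp, ι_egd, map_one, ι_two, ι_three]
    exact (mul_div_cancel₀ _ (mul_pos this h2).ne').symm
  · have h1 := Real.log_le_sub_one_of_pos (gam_pos k l)
    have h2 := Real.log_le_sub_one_of_pos (inv_pos.2 (gam_pos k l))
    rw [Real.log_inv] at h2
    have h4 : Real.log (gam k l) ≤ 7 := by linarith
    have h3 : -7 ≤ Real.log (gam k l) := by
      rw [Real.le_log_iff_exp_le (gam_pos k l)]
      have : Real.exp (-7) ≤ 0.1 := by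
        rw [Real.exp_neg]
        have := Real.add_one_le_exp (7:ℝ)
        have h8 : (8:ℝ) ≤ Real.exp 7 := by linarith
        have h9 : Real.exp 7 = Real.exp 1 ^ 7 := by rw [← Real.exp_nat_mul]; norm_num
        have h10 : (2:ℝ) ≤ Real.exp 1 := by linarith [Real.add_one_le_exp (1:ℝ)]
        have h11 : (2:ℝ)^7 ≤ Real.exp 7 := by rw [h9]; gcongr
        calc (Real.exp 7)⁻¹ ≤ ((2:ℝ)^7)⁻¹ := by gcongr
          _ ≤ 0.1 := by norm_num
      linarith
    rw [abs_le]
    push_cast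
    have hk : (0:ℝ) ≤ k := by positivity
    have hl : (0:ℝ) ≤ l := by positivity
    constructor <;> linarith

/-! ### Multiplicative independence: transfer principles -/

lemma zero_of_two_pow_dvd (a : ℤ) (h : ∀ n : ℕ, (2:ℤ) ^ n ∣ a) : a = 0 := by
  refine Int.eq_zero_of_abs_lt_dvd (h a.natAbs) ?_
  rw [Int.abs_eq_natAbs]
  exact_mod_cast Nat.lt_two_pow_self

lemma even_of_zmod (a : ℤ) (h : (a : ZMod 2) = 0) : ∃ b, a = 2 * b := by
  obtain ⟨b, hb⟩ := (ZMod.intCast_zmod_eq_zero_iff_dvd a 2).1 h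
  exact ⟨b, by simpa using hb⟩

lemma dec3 : ∀ a b c : ZMod 2, a * ((a + c) ^ 2 - b * (b + c)) - c * (b * (a + c) - c * (b + c)) +
    b * (b ^ 2 - c * (a + c)) = 0 → a = 0 ∧ b = 0 ∧ c = 0 := by decide

lemma ind3_aux (n : ℕ) : ∀ a b c : ℤ, (a + b * plas + c * plas ^ 2 : ℝ) = 0 →
    (2:ℤ) ^ n ∣ a ∧ (2:ℤ) ^ n ∣ b ∧ (2:ℤ) ^ n ∣ c := by
  induction n with
  | zero => intro a b c _; simp
  | succ n ih =>
    intro a b c h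
    have hN : (a * ((a + c) ^ 2 - b * (b + c)) - c * (b * (a + c) - c * (b + c)) +
        b * (b ^ 2 - c * (a + c)) : ℝ) = 0 := by
      have h3 := plas_cube
      have : (a + b * plas + c * plas ^ 2 : ℝ) * (((a + c) ^ 2 - b * (b + c)) -
        (b * (a + c) - c * (b + c)) * plas + (b ^ 2 - c * (a + c)) * plas ^ 2) = 0 := by
        rw [h, zero_mul]
      have h4 : plas ^ 4 = plas ^ 2 + plas := by rw [pow_succ, h3]; ring
      linear_combination this - (b * (b ^ 2 - c * (a + c)) - c * (b * (a + c) - c * (b + c))) * h3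
        - c * (b ^ 2 - c * (a + c)) * h4
    have hZ : (a * ((a + c) ^ 2 - b * (b + c)) - c * (b * (a + c) - c * (b + c)) +
        b * (b ^ 2 - c * (a + c)) : ℤ) = 0 := by exact_mod_cast hN
    have h2 := congrArg (Int.cast : ℤ → ZMod 2) hZ
    push_cast at h2
    obtain ⟨h5, h6, h7⟩ := dec3 _ _ _ h2
    obtain ⟨a', rfl⟩ := even_of_zmod a h5
    obtain ⟨b', rfl⟩ := even_of_zmod b h6
    obtain ⟨c', rfl⟩ := even_of_zmod c h7
    push_cast at h
    obtain ⟨i1, i2, i3⟩ := ih a' b' c' (by linear_combination h / 2)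
    rw [pow_succ']
    exact ⟨mul_dvd_mul_left _ i1, mul_dvd_mul_left _ i2, mul_dvd_mul_left _ i3⟩

lemma ind3 (a b c : ℤ) (h : (a + b * plas + c * plas ^ 2 : ℝ) = 0) : a = 0 ∧ b = 0 ∧ c = 0 :=
  ⟨zero_of_two_pow_dvd _ fun n => (ind3_aux n a b c h).1,
   zero_of_two_pow_dvd _ fun n => (ind3_aux n a b c h).2.1,
   zero_of_two_pow_dvd _ fun n => (ind3_aux n a b c h).2.2⟩

/-- Coefficients of the relative norm. -/
def rn0 {S : Type} [CommRing S] (a0 a1 a2 b0 b1 b2 : S) : S :=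
  a0 ^ 2 + 2 * a1 * a2 + (a0 * b0 + (a1 * b2 + a2 * b1)) - (b0 ^ 2 + 2 * b1 * b2)
/-- Coefficients of the relative norm. -/
def rn1 {S : Type} [CommRing S] (a0 a1 a2 b0 b1 b2 : S) : S :=
  2 * a0 * a1 + 2 * a1 * a2 + a2 ^ 2 + (a0 * b1 + a1 * b0 + (a1 * b2 + a2 * b1) + a2 * b2)
    - (2 * b0 * b1 + 2 * b1 * b2 + b2 ^ 2)
/-- Coefficients of the relative norm. -/
def rn2 {S : Type} [CommRing S] (a0 a1 a2 b0 b1 b2 : S) : S :=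
  a1 ^ 2 + 2 * a0 * a2 + a2 ^ 2 + (a0 * b2 + a1 * b1 + a2 * b0 + a2 * b2)
    - (b1 ^ 2 + 2 * b0 * b2 + b2 ^ 2)

lemma dec6 : ∀ a0 a1 a2 b0 b1 b2 : ZMod 2, rn0 a0 a1 a2 b0 b1 b2 = 0 → rn1 a0 a1 a2 b0 b1 b2 = 0 →
    rn2 a0 a1 a2 b0 b1 b2 = 0 → a0 = 0 ∧ a1 = 0 ∧ a2 = 0 ∧ b0 = 0 ∧ b1 = 0 ∧ b2 = 0 := by
  unfold rn0 rn1 rn2; decide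

lemma ind6_aux (n : ℕ) : ∀ a0 a1 a2 b0 b1 b2 : ℤ,
    ((a0 + a1 * plas + a2 * plas ^ 2) + (b0 + b1 * plas + b2 * plas ^ 2) * Real.goldenRatio : ℝ) = 0 →
    (2:ℤ) ^ n ∣ a0 ∧ (2:ℤ) ^ n ∣ a1 ∧ (2:ℤ) ^ n ∣ a2 ∧ (2:ℤ) ^ n ∣ b0 ∧ (2:ℤ) ^ n ∣ b1 ∧
      (2:ℤ) ^ n ∣ b2 := by
  induction n with
  | zero => intros; simp
  | succ n ih =>
    intro a0 a1 a2 b0 b1 b2 h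
    have h3 := plas_cube
    have h4 : plas ^ 4 = plas ^ 2 + plas := by rw [pow_succ, h3]; ring
    have hg := Real.goldenRatio_sq
    have hN : ((rn0 a0 a1 a2 b0 b1 b2 : ℤ) + (rn1 a0 a1 a2 b0 b1 b2 : ℤ) * plas +
        (rn2 a0 a1 a2 b0 b1 b2 : ℤ) * plas ^ 2 : ℝ) = 0 := by
      unfold rn0 rn1 rn2
      push_cast
      have : ((a0 + a1 * plas + a2 * plas ^ 2) +
        (b0 + b1 * plas + b2 * plas ^ 2) * Real.goldenRatio : ℝ) *
        ((a0 + a1 * plas + a2 * plas ^ 2) +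
        (b0 + b1 * plas + b2 * plas ^ 2) * (1 - Real.goldenRatio)) = 0 := by
        rw [h, zero_mul]
      linear_combination this + (b0 + b1 * plas + b2 * plas ^ 2 : ℝ) ^ 2 * hg
        - (2 * a1 * a2 + (a1 * b2 + a2 * b1) - 2 * b1 * b2) * h3
        - (a2 ^ 2 + a2 * b2 - b2 ^ 2) * h4
    obtain ⟨e0, e1, e2⟩ := ind3 _ _ _ hN
    have f0 := congrArg (Int.cast : ℤ → ZMod 2) e0
    have f1 := congrArg (Int.cast : ℤ → ZMod 2) e1
    have f2 := congrArg (Int.cast : ℤ → ZMod 2) e2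
    unfold rn0 at f0
    unfold rn1 at f1
    unfold rn2 at f2
    push_cast at f0 f1 f2
    obtain ⟨j1, j2, j3, j4, j5, j6⟩ := dec6 _ _ _ _ _ _ f0 f1 f2
    obtain ⟨a0, rfl⟩ := even_of_zmod _ j1
    obtain ⟨a1, rfl⟩ := even_of_zmod _ j2
    obtain ⟨a2, rfl⟩ := even_of_zmod _ j3
    obtain ⟨b0, rfl⟩ := even_of_zmod _ j4
    obtain ⟨b1, rfl⟩ := even_of_zmod _ j5
    obtain ⟨b2, rfl⟩ := even_of_zmod _ j6
    push_cast at h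
    obtain ⟨i1, i2, i3, i4, i5, i6⟩ := ih a0 a1 a2 b0 b1 b2 (by linear_combination h / 2)
    rw [pow_succ']
    exact ⟨mul_dvd_mul_left _ i1, mul_dvd_mul_left _ i2, mul_dvd_mul_left _ i3,
      mul_dvd_mul_left _ i4, mul_dvd_mul_left _ i5, mul_dvd_mul_left _ i6⟩

lemma ind6 (a0 a1 a2 b0 b1 b2 : ℤ)
    (h : ((a0 + a1 * plas + a2 * plas ^ 2) +
      (b0 + b1 * plas + b2 * plas ^ 2) * Real.goldenRatio : ℝ) = 0) :
    a0 = 0 ∧ a1 = 0 ∧ a2 = 0 ∧ b0 = 0 ∧ b1 = 0 ∧ b2 = 0 :=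
  ⟨zero_of_two_pow_dvd _ fun n => (ind6_aux n _ _ _ _ _ _ h).1,
   zero_of_two_pow_dvd _ fun n => (ind6_aux n _ _ _ _ _ _ h).2.1,
   zero_of_two_pow_dvd _ fun n => (ind6_aux n _ _ _ _ _ _ h).2.2.1,
   zero_of_two_pow_dvd _ fun n => (ind6_aux n _ _ _ _ _ _ h).2.2.2.1,
   zero_of_two_pow_dvd _ fun n => (ind6_aux n _ _ _ _ _ _ h).2.2.2.2.1,
   zero_of_two_pow_dvd _ fun n => (ind6_aux n _ _ _ _ _ _ h).2.2.2.2.2⟩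

lemma nf2 (P : MvPolynomial (Fin 2) ℤ) : ∃ a0 a1 a2 b0 b1 b2 : ℤ,
    ∀ (S : Type) [CommRing S] (x y : S), x ^ 3 = x + 1 → y ^ 2 = y + 1 →
      MvPolynomial.aeval ![x, y] P =
        (a0 + a1 * x + a2 * x ^ 2) + (b0 + b1 * x + b2 * x ^ 2) * y := by
  induction P using MvPolynomial.induction_on with
  | C a =>
    refine ⟨a, 0, 0, 0, 0, 0, ?_⟩
    intro S _ x y _ _
    simp
  | add p q hp hq =>
    obtain ⟨a0, a1, a2, b0, b1, b2, h⟩ := hp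
    obtain ⟨c0, c1, c2, d0, d1, d2, h'⟩ := hq
    refine ⟨a0 + c0, a1 + c1, a2 + c2, b0 + d0, b1 + d1, b2 + d2, ?_⟩
    intro S _ x y hx hy
    rw [map_add, h S x y hx hy, h' S x y hx hy]
    push_cast; ring
  | mul_X p i hp =>
    obtain ⟨a0, a1, a2, b0, b1, b2, h⟩ := hp
    fin_cases i
    · refine ⟨a2, a0 + a2, a1, b2, b0 + b2, b1, ?_⟩
      intro S _ x y hx hy
      rw [map_mul, h S x y hx hy]
      simp
      linear_combination (a2 + b2 * y) * hx
    · refine ⟨b0, b1, b2, a0 + b0, a1 + b1, a2 + b2, ?_⟩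
      intro S _ x y hx hy
      rw [map_mul, h S x y hx hy]
      simp
      linear_combination (b0 + b1 * x + b2 * x ^ 2) * hy

lemma nf1 (P : Polynomial ℤ) : ∃ a0 a1 a2 : ℤ,
    ∀ (S : Type) [CommRing S] (x : S), x ^ 3 = x + 1 →
      Polynomial.aeval x P = a0 + a1 * x + a2 * x ^ 2 := by
  induction P using Polynomial.induction_on with
  | C a =>
    refine ⟨a, 0, 0, ?_⟩
    intro S _ x _
    simp
  | add p q hp hq =>
    obtain ⟨a0, a1, a2, h⟩ := hp
    obtain ⟨c0, c1, c2, h'⟩ := hq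
    refine ⟨a0 + c0, a1 + c1, a2 + c2, ?_⟩
    intro S _ x hx
    rw [map_add, h S x hx, h' S x hx]
    push_cast; ring
  | monomial n a hp =>
    obtain ⟨a0, a1, a2, h⟩ := hp
    refine ⟨a2, a0 + a2, a1, ?_⟩
    intro S _ x hx
    rw [pow_succ, ← mul_assoc, map_mul, h S x hx]
    simp
    linear_combination a2 * hx

lemma tr2 (P : MvPolynomial (Fin 2) ℤ)
    (h : MvPolynomial.aeval ![plas, Real.goldenRatio] P = (0:ℝ))
    (S : Type) [CommRing S] (x y : S) (hx : x ^ 3 = x + 1) (hy : y ^ 2 = y + 1) :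
    MvPolynomial.aeval ![x, y] P = 0 := by
  obtain ⟨a0, a1, a2, b0, b1, b2, hn⟩ := nf2 P
  rw [hn ℝ _ _ plas_cube Real.goldenRatio_sq] at h
  obtain ⟨rfl, rfl, rfl, rfl, rfl, rfl⟩ := ind6 _ _ _ _ _ _ h
  rw [hn S x y hx hy]
  simp

lemma tr1 (P : Polynomial ℤ) (h : Polynomial.aeval plas P = (0:ℝ))
    (S : Type) [CommRing S] (x : S) (hx : x ^ 3 = x + 1) :
    Polynomial.aeval x P = 0 := by
  obtain ⟨a0, a1, a2, hn⟩ := nf1 P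
  rw [hn ℝ _ plas_cube] at h
  obtain ⟨rfl, rfl, rfl⟩ := ind3 _ _ _ h
  rw [hn S x hx]
  simp

/-! ### The fundamental unit argument -/

lemma beta_exists : ∃ z : ℂ, z.re = - plas / 2 ∧ Complex.normSq z = plas ^ 2 - 1 := by
  refine ⟨⟨- plas / 2, Real.sqrt (3 * plas ^ 2 / 4 - 1)⟩, rfl, ?_⟩
  rw [Complex.normSq_mk, Real.mul_self_sqrt (by nlinarith [plas_gt])]
  ring

/-- The complex conjugate of the plastic number. -/
noncomputable def beta : ℂ := Classical.choose beta_exists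

lemma beta_re : beta.re = - plas / 2 := (Classical.choose_spec beta_exists).1
lemma beta_nsq : Complex.normSq beta = plas ^ 2 - 1 := (Classical.choose_spec beta_exists).2

lemma beta_add : beta + (starRingEnd ℂ) beta = - (plas : ℂ) := by
  rw [Complex.add_conj, beta_re]; push_cast; ring

lemma beta_mul : beta * (starRingEnd ℂ) beta = (plas : ℂ) ^ 2 - 1 := by
  rw [Complex.mul_conj, beta_nsq]; push_cast; ring

lemma plasC_cube : (plas : ℂ) ^ 3 = (plas : ℂ) + 1 := by exact_mod_cast plas_cube

lemma beta_cube : beta ^ 3 = beta + 1 := by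
  have h1 := beta_add
  have h2 := beta_mul
  have h3 := plasC_cube
  have h4 : beta ^ 2 + plas * beta + (plas ^ 2 - 1) = 0 := by
    linear_combination beta * h1 - h2
  linear_combination (beta - plas) * h4 + h3

lemma betac_cube : (starRingEnd ℂ) beta ^ 3 = (starRingEnd ℂ) beta + 1 := by
  have := congrArg (starRingEnd ℂ) beta_cube
  simpa using this

lemma plas_mul_nsq : plas * Complex.normSq beta = 1 := by
  rw [beta_nsq]; linear_combination plas_cube

lemma tr_int (V : Polynomial ℤ) : ∃ T : ℤ, Polynomial.aeval (plas : ℂ) V +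
    Polynomial.aeval beta V + Polynomial.aeval ((starRingEnd ℂ) beta) V = (T : ℂ) := by
  obtain ⟨a0, a1, a2, h⟩ := nf1 V
  rw [h ℂ _ plasC_cube, h ℂ _ beta_cube, h ℂ _ betac_cube]
  refine ⟨3 * a0 + 2 * a2, ?_⟩
  push_cast
  have h1 := beta_add
  have h2 := beta_mul
  linear_combination (a1 + a2 * (beta + (starRingEnd ℂ) beta - plas)) * h1 - 2 * a2 * h2

lemma int_of_integral (T Q : ℤ) (h : IsIntegral ℤ ((T : ℂ) / Q)) :
    ∃ A : ℤ, (T : ℂ) / Q = A := by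
  have h1 : IsIntegral ℤ ((T : ℚ) / Q) := by
    refine (isIntegral_algebraMap_iff (algebraMap ℚ ℂ).injective).1 ?_
    simpa using h
  obtain ⟨A, hA⟩ := IsIntegrallyClosed.isIntegral_iff.1 h1
  refine ⟨A, ?_⟩
  have := congrArg (Rat.cast : ℚ → ℂ) hA
  push_cast at this
  rw [← this]
  simp

lemma tr_int_div (V : Polynomial ℤ) (Q : ℤ)
    (h : ∀ x : ℂ, x ^ 3 = x + 1 → IsIntegral ℤ (Polynomial.aeval x V / (Q : ℂ))) :
    ∃ A : ℤ, Polynomial.aeval (plas : ℂ) V / (Q : ℂ) +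
    Polynomial.aeval beta V / (Q : ℂ) + Polynomial.aeval ((starRingEnd ℂ) beta) V / (Q : ℂ) = A := by
  obtain ⟨T, hT⟩ := tr_int V
  have hI := ((h _ plasC_cube).add (h _ beta_cube)).add (h _ betac_cube)
  rw [← add_div, ← add_div, hT] at hI ⊢
  exact int_of_integral T Q hI

lemma root_int (x : ℂ) (hx : x ^ 3 = x + 1) : IsIntegral ℤ x :=
  ⟨Polynomial.X ^ 3 - Polynomial.X - 1, by monicity!, by simp [hx]⟩

lemma aeval_conj (V : Polynomial ℤ) (z : ℂ) :
    Polynomial.aeval ((starRingEnd ℂ) z) V = (starRingEnd ℂ) (Polynomial.aeval z V) := by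
  rw [Polynomial.aeval_def, Polynomial.aeval_def, Polynomial.hom_eval₂]
  congr 1
  ext; simp

lemma aeval_real (V : Polynomial ℤ) (x : ℝ) :
    Polynomial.aeval (x : ℂ) V = ((Polynomial.aeval x V : ℝ) : ℂ) := by
  rw [Polynomial.aeval_def, Polynomial.aeval_def]
  have := Polynomial.hom_eval₂ V (algebraMap ℤ ℝ) Complex.ofRealHom x
  simp only [Complex.ofRealHom_eq_coe] at this
  rw [this]
  congr 1

lemma cubic_no (w : ℝ) (A B : ℤ) (h1 : 1 < w) (h2 : w < plas) (hA0 : -1 < (A : ℝ)) (hA1 : (A : ℝ) < 4)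
    (h : w ^ 3 - A * w ^ 2 + B * w - 1 = 0) : False := by
  have hw : w ^ 3 < w + 1 := by
    have := plas_cube
    nlinarith [mul_pos (sub_pos.2 h2) (sub_pos.2 h1), plas_gt, mul_pos (sub_pos.2 h2) (show 0 < w ^ 2 + w * plas + plas ^ 2 - 1 by nlinarith [plas_gt, plas_pos])]
  have hA2 : 0 ≤ A := by
    have : (-1 : ℤ) < A := by exact_mod_cast hA0
    omega
  have hA3 : A ≤ 3 := by
    have : A < (4 : ℤ) := by exact_mod_cast hA1
    omega
  have hA2' : (0:ℝ) ≤ A := by exact_mod_cast hA2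
  have hA3' : (A:ℝ) ≤ 3 := by exact_mod_cast hA3
  have hw0 : 0 < w := by linarith
  rcases lt_trichotomy A B with hAB | hAB | hAB
  · have : (A:ℝ) + 1 ≤ B := by exact_mod_cast hAB
    have h5 : w ^ 3 - A * w ^ 2 + (A + 1) * w - 1 ≤ 0 := by nlinarith
    nlinarith [mul_nonneg (sub_nonneg.2 hA3') (mul_pos hw0 (sub_pos.2 h1)).le, sq_nonneg (w - 1),
      mul_nonneg (sub_pos.2 h1).le (sq_nonneg (w-1))]
  · subst hAB
    have h5 : (w - 1) * (w ^ 2 + w + 1 - A * w) = 0 := by linear_combination h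
    have h6 : w ^ 2 + w + 1 - A * w = 0 := by
      rcases mul_eq_zero.1 h5 with h | h
      · linarith
      · exact h
    have hA4 : (A:ℝ) = 3 ∨ (A:ℝ) ≤ 2 := by
      rcases (by omega : A = 3 ∨ A ≤ 2) with h | h
      · left; exact_mod_cast h
      · right; exact_mod_cast h
    rcases hA4 with h7 | h7
    · rw [h7] at h6; nlinarith
    · nlinarith
  · have : (B:ℝ) ≤ A - 1 := by
      have : B + 1 ≤ A := hAB
      have : (B:ℝ) + 1 ≤ A := by exact_mod_cast this
      linarith
    have h5 : 0 ≤ w ^ 3 - A * w ^ 2 + (A - 1) * w - 1 := by nlinarith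
    nlinarith [mul_nonneg hA2' (mul_pos hw0 (sub_pos.2 h1)).le]

theorem unit_lemma (W : Polynomial ℤ) (Q : ℤ) (hQ : Q ≠ 0) (c u u' : ℕ) (hc : 1 ≤ c)
    (h : ∀ x : ℂ, x ^ 3 = x + 1 → Polynomial.aeval x W ^ c * x ^ u = (Q : ℂ) ^ c * x ^ u')
    (h1 : 1 < Polynomial.aeval plas W / (Q : ℝ)) (h2 : Polynomial.aeval plas W / (Q : ℝ) < plas) :
    False := by
  have hQC : (Q : ℂ) ≠ 0 := by exact_mod_cast hQ
  have hinv : ∀ x : ℂ, x ^ 3 = x + 1 → x * (x ^ 2 - 1) = 1 := fun x hx => by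
    linear_combination hx
  have hI0 : ∀ x : ℂ, x ^ 3 = x + 1 → (Polynomial.aeval x W / (Q : ℂ)) ^ c = x ^ u' * (x ^ 2 - 1) ^ u := by
    intro x hx
    rw [div_pow, div_eq_iff (pow_ne_zero _ hQC)]
    have e1 := h x hx
    have e2 : x ^ u * (x ^ 2 - 1) ^ u = 1 := by rw [← mul_pow, hinv x hx, one_pow]
    linear_combination (x ^ 2 - 1) ^ u * e1 - Polynomial.aeval x W ^ c * e2
  have hI1 : ∀ x : ℂ, x ^ 3 = x + 1 → IsIntegral ℤ (Polynomial.aeval x W / (Q : ℂ)) := by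
    intro x hx
    refine IsIntegral.of_pow hc ?_
    rw [hI0 x hx]
    have := root_int x hx
    exact (this.pow _).mul (((this.pow 2).sub isIntegral_one).pow _)
  set V : Polynomial ℤ := W ^ (c - 1) * Polynomial.X ^ u * (Polynomial.X ^ 2 - 1) ^ u' with hV
  have hVe : ∀ x : ℂ, Polynomial.aeval x V / ((Q ^ (c - 1) : ℤ) : ℂ) =
      (Polynomial.aeval x W / (Q : ℂ)) ^ (c - 1) * x ^ u * (x ^ 2 - 1) ^ u' := by
    intro x
    rw [hV]
    simp only [map_mul, map_pow, map_sub, map_one, Polynomial.aeval_X, Int.cast_pow]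
    rw [div_pow]
    ring
  have hI2 : ∀ x : ℂ, x ^ 3 = x + 1 → IsIntegral ℤ (Polynomial.aeval x V / ((Q ^ (c - 1) : ℤ) : ℂ)) := by
    intro x hx
    rw [hVe]
    have := root_int x hx
    exact (((hI1 x hx).pow _).mul (this.pow _)).mul (((this.pow 2).sub isIntegral_one).pow _)
  have hprod : ∀ x : ℂ, x ^ 3 = x + 1 → Polynomial.aeval x W / (Q : ℂ) *
      (Polynomial.aeval x V / ((Q ^ (c - 1) : ℤ) : ℂ)) = 1 := by
    intro x hx
    rw [hVe x, ← mul_assoc, ← mul_assoc, ← pow_succ', Nat.sub_add_cancel hc, hI0 x hx]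
    calc _ = (x * (x ^ 2 - 1)) ^ u' * (x * (x ^ 2 - 1)) ^ u := by rw [mul_pow, mul_pow]; ring
      _ = 1 := by rw [hinv x hx]; simp
  obtain ⟨A, hA⟩ := tr_int_div W Q hI1
  obtain ⟨B, hB⟩ := tr_int_div V (Q ^ (c - 1)) hI2
  have p1 := hprod _ plasC_cube
  have p2 := hprod _ beta_cube
  set w : ℝ := Polynomial.aeval plas W / (Q : ℝ) with hw
  set z : ℂ := Polynomial.aeval beta W / (Q : ℂ) with hz
  set w' : ℝ := Polynomial.aeval plas V / ((Q ^ (c - 1) : ℤ) : ℝ) with hw'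
  set z' : ℂ := Polynomial.aeval beta V / ((Q ^ (c - 1) : ℤ) : ℂ) with hz'
  have q1 : Polynomial.aeval (plas : ℂ) W / (Q : ℂ) = (w : ℂ) := by
    rw [aeval_real, hw]; push_cast; rfl
  have q2 : Polynomial.aeval (plas : ℂ) V / ((Q ^ (c - 1) : ℤ) : ℂ) = (w' : ℂ) := by
    rw [aeval_real, hw']; push_cast; rfl
  have q3 : Polynomial.aeval ((starRingEnd ℂ) beta) W / (Q : ℂ) = (starRingEnd ℂ) z := by
    rw [aeval_conj, hz, map_div₀]; simp
  have q4 : Polynomial.aeval ((starRingEnd ℂ) beta) V / ((Q ^ (c - 1) : ℤ) : ℂ) = (starRingEnd ℂ) z' := by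
    rw [aeval_conj, hz', map_div₀]; simp
  rw [q1, q3, add_assoc, Complex.add_conj] at hA
  rw [q2, q4, add_assoc, Complex.add_conj] at hB
  rw [q1, q2] at p1
  have pcast : w * w' = 1 := by exact_mod_cast p1
  have hA' : w + 2 * z.re = A := by exact_mod_cast hA
  have hB' : w' + 2 * z'.re = B := by exact_mod_cast hB
  have hn : w * Complex.normSq z = 1 := by
    have e1 := hI0 _ plasC_cube
    have e2 := congrArg Complex.normSq (hI0 _ beta_cube)
    rw [q1] at e1
    have e1' : w ^ c = plas ^ u' * (plas ^ 2 - 1) ^ u := by exact_mod_cast e1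
    have e3 : Complex.normSq (beta ^ 2 - 1) = plas := by
      have := congrArg Complex.normSq (hinv _ beta_cube)
      rw [map_mul, map_one] at this
      have h5 := plas_mul_nsq
      have h6 : Complex.normSq beta ≠ 0 := by intro h; rw [h] at h5; simp at h5
      have h7 : (Complex.normSq (beta ^ 2 - 1) - plas) * Complex.normSq beta = 0 := by
        linear_combination this - h5
      rcases mul_eq_zero.1 h7 with h | h
      · linarith
      · exact absurd h h6
    rw [map_pow, map_mul, map_pow, map_pow, e3, beta_nsq] at e2
    have e4 : (w * Complex.normSq z) ^ c = 1 := by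
      rw [mul_pow, e1', e2]
      calc _ = (plas * (plas ^ 2 - 1)) ^ u' * (plas * (plas ^ 2 - 1)) ^ u := by rw [mul_pow, mul_pow]; ring
        _ = 1 := by rw [show plas * (plas ^ 2 - 1) = 1 by linear_combination plas_cube]; simp
    exact (pow_eq_one_iff_of_nonneg (mul_nonneg (by linarith) (Complex.normSq_nonneg z))
      (by omega)).1 e4
  have hz'e : z' = (w : ℂ) * (starRingEnd ℂ) z := by
    have hz0 : z ≠ 0 := by intro h0; rw [h0] at p2; simp at p2
    apply mul_left_cancel₀ hz0
    rw [p2]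
    have : ((w * Complex.normSq z : ℝ) : ℂ) = 1 := by rw [hn]; simp
    rw [Complex.ofReal_mul, ← Complex.mul_conj] at this
    linear_combination -this
  have hz're : z'.re = w * z.re := by rw [hz'e]; simp
  have hw0 : 0 < w := by linarith
  have hns : Complex.normSq z < 1 := by nlinarith
  have hre : z.re ^ 2 < 1 := by
    rw [Complex.normSq_apply] at hns
    nlinarith [mul_self_nonneg z.im]
  have hr := (sq_lt_one_iff_abs_lt_one _).1 hre
  rw [abs_lt] at hr
  refine cubic_no w A B h1 h2 (by linarith) (by linarith [plas_lt]) ?_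
  rw [← hA', ← hB', hz're]
  linear_combination pcast

/-! ### Multiplicative independence -/

/-- The numerator of the factors. -/
def fk {S : Type} [CommRing S] (k : ℕ) (x : S) : S := if k = 0 then 1 else x ^ k - 1

lemma map_fk {S T F : Type} [CommRing S] [CommRing T] [FunLike F S T] [RingHomClass F S T]
    (f : F) (k : ℕ) (x : S) : f (fk k x) = fk k (f x) := by
  unfold fk; split_ifs <;> simp

lemma gd_fk (k : ℕ) : gd k = fk k plas / plas ^ k := by
  unfold gd fk
  split_ifs with h
  · simp [h]
  · have := plas_pos
    field_simp

lemma gp_fk (k : ℕ) : gp k = fk k Real.goldenRatio / Real.goldenRatio ^ k := by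
  unfold gp fk
  split_ifs with h
  · simp [h]
  · have := pow_ne_zero k (Real.goldenRatio_pos).ne'
    rw [sub_div, div_self this, one_div]

lemma fkd_pos (k : ℕ) : 0 < fk k plas := by
  have h := gd_pos k
  rw [gd_fk] at h
  have h2 := pow_pos plas_pos k
  exact (div_pos_iff_of_pos_right h2).1 h

lemma fkp_pos (k : ℕ) : 0 < fk k Real.goldenRatio := by
  have h := gp_pos k
  rw [gp_fk] at h
  have h2 := pow_pos Real.goldenRatio_pos k
  exact (div_pos_iff_of_pos_right h2).1 h

lemma D_pos : 0 < 3 * plas ^ 2 - 1 := by nlinarith [plas_gt]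

lemma sq5_pos : 0 < 2 * Real.goldenRatio - 1 := by linarith [gold_gt]

lemma log_gam (k l : ℕ) : Real.log (gam k l) = Real.log (2 * Real.goldenRatio - 1) +
    4 * Real.log plas + Real.log (fk k plas) - k * Real.log plas - Real.log (3 * plas ^ 2 - 1)
    - Real.log (fk l Real.goldenRatio) + l * Real.log Real.goldenRatio := by
  have h1 := fkd_pos k
  have h2 := fkp_pos l
  have h3 := D_pos
  have h4 := sq5_pos
  have h5 := plas_pos
  have h6 := Real.goldenRatio_pos
  unfold gam
  rw [gd_fk, gp_fk, Real.log_div (by positivity) (by positivity), Real.log_mul (by positivity) (by positivity),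
    Real.log_mul (by positivity) (by positivity), Real.log_mul (by positivity) (by positivity),
    Real.log_div (by positivity) (by positivity), Real.log_div (by positivity) (by positivity),
    Real.log_pow, Real.log_pow, Real.log_pow]
  push_cast
  ring

lemma rel_of_log (k l c a1 a2 b1 b2 : ℕ)
    (h : ((a1 : ℝ) - a2) * Real.log plas + ((b1 : ℝ) - b2) * Real.log Real.goldenRatio +
      c * Real.log (gam k l) = 0) :
    (2 * Real.goldenRatio - 1) ^ c * fk k plas ^ c * plas ^ (a1 + 4 * c) *
      Real.goldenRatio ^ (b1 + l * c) =
    (3 * plas ^ 2 - 1) ^ c * fk l Real.goldenRatio ^ c * plas ^ (a2 + k * c) *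
      Real.goldenRatio ^ b2 := by
  have h1 := fkd_pos k
  have h2 := fkp_pos l
  have h3 := D_pos
  have h4 := sq5_pos
  have h5 := plas_pos
  have h6 := Real.goldenRatio_pos
  apply Real.log_injOn_pos
  · simp only [Set.mem_Ioi]; positivity
  · simp only [Set.mem_Ioi]; positivity
  rw [Real.log_mul (by positivity) (by positivity), Real.log_mul (by positivity) (by positivity),
    Real.log_mul (by positivity) (by positivity), Real.log_mul (by positivity) (by positivity),
    Real.log_mul (by positivity) (by positivity), Real.log_mul (by positivity) (by positivity)]
  simp only [Real.log_pow]
  rw [log_gam] at h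
  push_cast
  linear_combination h

lemma tr_rel (k l c u v u' v' : ℕ)
    (h : (2 * Real.goldenRatio - 1) ^ c * fk k plas ^ c * plas ^ u * Real.goldenRatio ^ v =
    (3 * plas ^ 2 - 1) ^ c * fk l Real.goldenRatio ^ c * plas ^ u' * Real.goldenRatio ^ v')
    (S : Type) [CommRing S] (x y : S) (hx : x ^ 3 = x + 1) (hy : y ^ 2 = y + 1) :
    (2 * y - 1) ^ c * fk k x ^ c * x ^ u * y ^ v =
    (3 * x ^ 2 - 1) ^ c * fk l y ^ c * x ^ u' * y ^ v' := by
  set P : MvPolynomial (Fin 2) ℤ := (2 * MvPolynomial.X 1 - 1) ^ c * fk k (MvPolynomial.X 0) ^ c *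
    MvPolynomial.X 0 ^ u * MvPolynomial.X 1 ^ v -
    (3 * MvPolynomial.X 0 ^ 2 - 1) ^ c * fk l (MvPolynomial.X 1) ^ c *
    MvPolynomial.X 0 ^ u' * MvPolynomial.X 1 ^ v' with hP
  have he : ∀ (S : Type) [CommRing S] (x y : S), MvPolynomial.aeval ![x, y] P =
      (2 * y - 1) ^ c * fk k x ^ c * x ^ u * y ^ v -
      (3 * x ^ 2 - 1) ^ c * fk l y ^ c * x ^ u' * y ^ v' := by
    intro S _ x y
    rw [hP]
    simp [map_fk]
  have := tr2 P (by rw [he, h, sub_self]) S x y hx hy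
  rw [he] at this
  exact sub_eq_zero.1 this

lemma tr_rel2 (k c u v u' v' F : ℕ)
    (h : fk k plas ^ c * plas ^ u * Real.goldenRatio ^ v =
    (3 * plas ^ 2 - 1) ^ c * (F : ℝ) ^ c * plas ^ u' * Real.goldenRatio ^ v')
    (S : Type) [CommRing S] (x y : S) (hx : x ^ 3 = x + 1) (hy : y ^ 2 = y + 1) :
    fk k x ^ c * x ^ u * y ^ v =
    (3 * x ^ 2 - 1) ^ c * (F : S) ^ c * x ^ u' * y ^ v' := by
  set P : MvPolynomial (Fin 2) ℤ := fk k (MvPolynomial.X 0) ^ c *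
    MvPolynomial.X 0 ^ u * MvPolynomial.X 1 ^ v -
    (3 * MvPolynomial.X 0 ^ 2 - 1) ^ c * (F : MvPolynomial (Fin 2) ℤ) ^ c *
    MvPolynomial.X 0 ^ u' * MvPolynomial.X 1 ^ v' with hP
  have he : ∀ (S : Type) [CommRing S] (x y : S), MvPolynomial.aeval ![x, y] P =
      fk k x ^ c * x ^ u * y ^ v -
      (3 * x ^ 2 - 1) ^ c * (F : S) ^ c * x ^ u' * y ^ v' := by
    intro S _ x y
    rw [hP]
    simp [map_fk]
  have := tr2 P (by rw [he, h, sub_self]) S x y hx hy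
  rw [he] at this
  exact sub_eq_zero.1 this

lemma tr_rel1 (k c u u' F : ℕ)
    (h : fk k plas ^ c * plas ^ u = (3 * plas ^ 2 - 1) ^ c * (F : ℝ) ^ c * plas ^ u')
    (S : Type) [CommRing S] (x : S) (hx : x ^ 3 = x + 1) :
    fk k x ^ c * x ^ u = (3 * x ^ 2 - 1) ^ c * (F : S) ^ c * x ^ u' := by
  set P : Polynomial ℤ := fk k Polynomial.X ^ c * Polynomial.X ^ u -
    (3 * Polynomial.X ^ 2 - 1) ^ c * (F : Polynomial ℤ) ^ c * Polynomial.X ^ u' with hP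
  have he : ∀ (S : Type) [CommRing S] (x : S), Polynomial.aeval x P =
      fk k x ^ c * x ^ u - (3 * x ^ 2 - 1) ^ c * (F : S) ^ c * x ^ u' := by
    intro S _ x
    rw [hP]
    have h3 : Polynomial.aeval x (3 : Polynomial ℤ) = 3 := map_ofNat _ 3
    simp [map_fk, h3]
  have := tr1 P (by rw [he, h, sub_self]) S x hx
  rw [he] at this
  exact sub_eq_zero.1 this

lemma gold_exp_eq (X Y : ℝ) (hX : X ≠ 0) (hY : Y ≠ 0) (v v' : ℕ)
    (h1 : X * Real.goldenRatio ^ v = Y * Real.goldenRatio ^ v')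
    (h2 : X * Real.goldenConj ^ v = Y * Real.goldenConj ^ v') : v = v' := by
  have h3 : Real.goldenRatio ^ v * Real.goldenConj ^ v' = Real.goldenRatio ^ v' * Real.goldenConj ^ v := by
    have : X * Y * (Real.goldenRatio ^ v * Real.goldenConj ^ v') =
        X * Y * (Real.goldenRatio ^ v' * Real.goldenConj ^ v) := by
      linear_combination Y * Real.goldenConj ^ v' * h1 - Y * Real.goldenRatio ^ v' * h2
    exact mul_left_cancel₀ (mul_ne_zero hX hY) this
  have h4 : Real.goldenRatio ^ (2 * v) * (-1) ^ v' = Real.goldenRatio ^ (2 * v') * (-1) ^ v := by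
    rw [← Real.goldenRatio_mul_goldenConj, mul_pow, mul_pow]
    linear_combination Real.goldenRatio ^ (v + v') * h3
  have h5 := congrArg abs h4
  rw [abs_mul, abs_mul, abs_pow (-1), abs_pow (-1)] at h5
  simp only [abs_neg, abs_one, one_pow, mul_one] at h5
  rw [abs_of_pos (pow_pos Real.goldenRatio_pos _), abs_of_pos (pow_pos Real.goldenRatio_pos _)] at h5
  have := pow_right_injective₀ Real.goldenRatio_pos (Real.one_lt_goldenRatio.ne') h5
  omega

lemma conj_cond : Real.goldenConj ^ 2 = Real.goldenConj + 1 := Real.goldenConj_sq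

lemma fib_fact (s : ℕ) : Real.goldenRatio ^ (4 * s) - 1 =
    Real.goldenRatio ^ (2 * s) * (2 * Real.goldenRatio - 1) * (Nat.fib (2 * s) : ℝ) := by
  have h5 : Real.sqrt 5 = 2 * Real.goldenRatio - 1 := by unfold Real.goldenRatio; ring
  rw [Real.coe_fib_eq, h5]
  have hne := sq5_pos.ne'
  have h6 : Real.goldenRatio ^ (2 * s) * Real.goldenConj ^ (2 * s) = 1 := by
    rw [← mul_pow, Real.goldenRatio_mul_goldenConj, pow_mul]; simp
  have h7 : Real.goldenRatio ^ (4 * s) = Real.goldenRatio ^ (2 * s) * Real.goldenRatio ^ (2 * s) := by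
    rw [← pow_add]; congr 1; ring
  rw [h7]
  rw [mul_assoc, mul_div_cancel₀ _ hne]
  linear_combination h6

instance fact23 : Fact (Nat.Prime 23) := ⟨by norm_num⟩
instance fact5 : Fact (Nat.Prime 5) := ⟨by norm_num⟩

lemma ord10 (k : ℕ) (h : (10 : ZMod 23) ^ k = 1) : 22 ∣ k := by
  have h1 : (10 : ZMod 23) ^ 22 = 1 := by decide
  rw [← Nat.div_add_mod k 22, pow_add, pow_mul, h1, one_pow, one_mul] at h
  have h2 : ∀ r : Fin 22, (10 : ZMod 23) ^ (r : ℕ) = 1 → r = 0 := by decide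
  have h3 := h2 ⟨k % 22, Nat.mod_lt _ (by norm_num)⟩ h
  exact Nat.dvd_of_mod_eq_zero (by simpa using h3)

lemma pow3 (k : ℕ) (h : 22 ∣ k) : (3 : ZMod 23) ^ k = 1 := by
  obtain ⟨j, rfl⟩ := h
  rw [pow_mul, show (3 : ZMod 23) ^ 22 = 1 by decide, one_pow]

lemma ord3 (k : ℕ) (h : (3 : ZMod 5) ^ k = 1) : 4 ∣ k := by
  have h1 : (3 : ZMod 5) ^ 4 = 1 := by decide
  rw [← Nat.div_add_mod k 4, pow_add, pow_mul, h1, one_pow, one_mul] at h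
  have h2 : ∀ r : Fin 4, (3 : ZMod 5) ^ (r : ℕ) = 1 → r = 0 := by decide
  have h3 := h2 ⟨k % 4, Nat.mod_lt _ (by norm_num)⟩ h
  exact Nat.dvd_of_mod_eq_zero (by simpa using h3)

/-- Reduction to exponent one. -/
lemma rel_c_one (k c u u' F : ℕ) (hc : 1 ≤ c) (hk : k ≠ 0) (hF : 1 ≤ F)
    (h : fk k plas ^ c * plas ^ u = (3 * plas ^ 2 - 1) ^ c * (F : ℝ) ^ c * plas ^ u') :
    ∃ p q : ℕ, fk k plas * plas ^ p = (3 * plas ^ 2 - 1) * (F : ℝ) * plas ^ q := by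
  have hfk := fkd_pos k
  have hD := D_pos
  have hp := plas_pos
  have hF' : (0:ℝ) < F := by exact_mod_cast hF
  have hCD : (4 + 9 * plas - 6 * plas ^ 2) * (3 * plas ^ 2 - 1) = 23 := by
    linear_combination (27 - 18 * plas) * plas_cube
  have hC : 0 < 4 + 9 * plas - 6 * plas ^ 2 := by
    by_contra hcon
    push Not at hcon
    nlinarith
  set y : ℝ := fk k plas * (4 + 9 * plas - 6 * plas ^ 2) / (23 * F) with hy
  have hy0 : 0 < y := by positivity
  obtain ⟨r, hr1, hr2⟩ := exists_mem_Ico_zpow hy0 (show 1 < plas by linarith [plas_gt])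
  obtain ⟨i, j, hij⟩ : ∃ i j : ℕ, r = (i : ℤ) - j := ⟨r.toNat, (-r).toNat, by omega⟩
  rw [zpow_add₀ hp.ne', zpow_one] at hr2
  rw [hij, zpow_sub₀ hp.ne', zpow_natCast, zpow_natCast] at hr1 hr2
  -- the unit in the fundamental domain
  set W : Polynomial ℤ := fk k Polynomial.X * (4 + 9 * Polynomial.X - 6 * Polynomial.X ^ 2) *
    Polynomial.X ^ j * (Polynomial.X ^ 2 - 1) ^ i with hW
  have hWe : ∀ (S : Type) [CommRing S] (x : S), Polynomial.aeval x W =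
      fk k x * (4 + 9 * x - 6 * x ^ 2) * x ^ j * (x ^ 2 - 1) ^ i := by
    intro S _ x
    have h4 : Polynomial.aeval x (4 : Polynomial ℤ) = 4 := map_ofNat _ 4
    have h6 : Polynomial.aeval x (6 : Polynomial ℤ) = 6 := map_ofNat _ 6
    have h9 : Polynomial.aeval x (9 : Polynomial ℤ) = 9 := map_ofNat _ 9
    rw [hW]
    simp [map_fk, h4, h6, h9]
  have hinv : (plas ^ 2 - 1) ^ i * plas ^ i = 1 := by
    rw [← mul_pow, show (plas ^ 2 - 1) * plas = 1 by linear_combination plas_cube, one_pow]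
  have hw : Polynomial.aeval plas W / ((23 * F : ℤ) : ℝ) = y * plas ^ j / plas ^ i := by
    rw [hWe, hy]
    push_cast
    have := pow_pos hp i
    rw [eq_div_iff this.ne']
    rw [div_mul_eq_mul_div, div_mul_eq_mul_div]
    congr 1
    linear_combination fk k plas * (4 + 9 * plas - 6 * plas ^ 2) * plas ^ j * hinv
  have hpi := pow_pos hp i
  have hpj := pow_pos hp j
  have hge : 1 ≤ y * plas ^ j / plas ^ i := by
    rw [le_div_iff₀ hpi, one_mul]
    rwa [div_le_iff₀ hpj] at hr1
  have hlt : y * plas ^ j / plas ^ i < plas := by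
    rw [div_lt_iff₀ hpi]
    rw [div_mul_eq_mul_div, lt_div_iff₀ hpj] at hr2
    linarith
  rcases hge.lt_or_eq with hgt | heq
  · exfalso
    refine unit_lemma W (23 * F : ℤ) (by positivity) c (u + c * i) (u' + c * j) hc ?_
      (by rw [hw]; exact hgt) (by rw [hw]; exact hlt)
    intro x hx
    have e := tr_rel1 k c u u' F h ℂ x hx
    rw [hWe]
    have e1 : (x ^ 2 - 1) * x = 1 := by linear_combination hx
    have e2 : ((x ^ 2 - 1) ^ i) ^ c * x ^ (c * i) = 1 := by
      rw [mul_comm c i, pow_mul, ← mul_pow, ← mul_pow, e1]; simp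
    have e3 : (4 + 9 * x - 6 * x ^ 2) ^ c * (3 * x ^ 2 - 1) ^ c = 23 ^ c := by
      rw [← mul_pow]; congr 1
      linear_combination (27 - 18 * x) * hx
    push_cast
    rw [mul_pow, mul_pow, mul_pow, mul_pow, pow_add, pow_add, ← e3, mul_comm c j, pow_mul x j c]
    linear_combination fk k x ^ c * (4 + 9 * x - 6 * x ^ 2) ^ c * (x ^ j) ^ c * x ^ u * e2 +
      (4 + 9 * x - 6 * x ^ 2) ^ c * (x ^ j) ^ c * e
  · refine ⟨j, i, ?_⟩
    rw [eq_div_iff hpi.ne', one_mul, hy, div_mul_eq_mul_div, eq_div_iff (by positivity)] at heq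
    have : 23 * (fk k plas * plas ^ j) = 23 * ((3 * plas ^ 2 - 1) * (F : ℝ) * plas ^ i) := by
      linear_combination -(3 * plas ^ 2 - 1) * heq - fk k plas * plas ^ j * hCD
    linarith

/-! ### Multiplicative independence, conclusion -/

lemma plas_sq_bounds : 1.7548 < plas ^ 2 ∧ plas ^ 2 < 1.7551 := by
  have h1 := plas_gt
  have h2 := plas_lt
  constructor <;> nlinarith

lemma Dbeta : (3 * plas ^ 2 - 1) * Complex.normSq (3 * beta ^ 2 - 1) = 23 := by
  have h1 := beta_add
  have h2 := beta_mul
  have h3 := plasC_cube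
  have : (((3 * plas ^ 2 - 1) * Complex.normSq (3 * beta ^ 2 - 1) : ℝ) : ℂ) = 23 := by
    rw [Complex.ofReal_mul, ← Complex.mul_conj]
    simp only [map_sub, map_mul, map_pow, map_one]
    rw [show (starRingEnd ℂ) 3 = 3 from Complex.conj_ofNat 3]
    push_cast
    have e : (3 * beta ^ 2 - 1) * (3 * (starRingEnd ℂ) beta ^ 2 - 1) =
        9 * ((plas : ℂ) ^ 2 - 1) ^ 2 - 3 * ((plas : ℂ) ^ 2 - 2 * ((plas : ℂ) ^ 2 - 1)) + 1 := by
      linear_combination (9 * (beta * (starRingEnd ℂ) beta + (plas : ℂ) ^ 2 - 1) + 6) * h2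
        - 3 * (beta + (starRingEnd ℂ) beta - plas) * h1
    rw [e]
    linear_combination (27 * (plas : ℂ) ^ 3 - 27 * plas + 27) * h3
  exact_mod_cast this

lemma nsq_pow (k : ℕ) : Complex.normSq (beta ^ k) * plas ^ k = 1 := by
  rw [map_pow, ← mul_pow, mul_comm, plas_mul_nsq, one_pow]

lemma norm_beta_sub (k : ℕ) (e : ℝ) (he : 0 < e) (h : 1 ≤ e ^ 2 * plas ^ k) :
    1 - e ≤ ‖beta ^ k - 1‖ ∧ ‖beta ^ k - 1‖ ≤ 1 + e := by
  have h1 : ‖beta ^ k‖ ≤ e := by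
    have h2 := nsq_pow k
    rw [Complex.normSq_eq_norm_sq] at h2
    have h3 : ‖beta ^ k‖ ^ 2 ≤ e ^ 2 := by
      have := pow_pos plas_pos k
      by_contra hc
      push Not at hc
      nlinarith
    exact le_of_sq_le_sq h3 he.le
  have h4 := norm_sub_norm_le (1:ℂ) (beta ^ k)
  have h5 := norm_sub_le (beta ^ k) (1:ℂ)
  rw [norm_sub_rev] at h4
  rw [norm_one] at h4 h5
  constructor <;> linarith

set_option maxHeartbeats 1000000 in
lemma no_rel_one (k p q F : ℕ) (hk : 22 ∣ k) (hk0 : k ≠ 0) (hF : 23 ∣ F) (hF0 : F ≠ 0)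
    (h : fk k plas * plas ^ p = (3 * plas ^ 2 - 1) * (F : ℝ) * plas ^ q) : False := by
  have hD := D_pos
  have hp := plas_pos
  have hb := tr_rel1 k 1 p q F (by simpa using h) ℂ beta beta_cube
  have hk1 : ∀ {S : Type} [CommRing S] (x : S), fk k x = x ^ k - 1 := by
    intro S _ x; unfold fk; rw [if_neg hk0]
  rw [hk1] at h
  rw [hk1] at hb
  simp only [pow_one] at hb
  have hb2 := congrArg Complex.normSq hb
  rw [map_mul, map_mul, map_mul, map_pow, map_pow, Complex.normSq_natCast] at hb2
  set G := Complex.normSq (beta ^ k - 1) with hG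
  have hG2 : G = ‖beta ^ k - 1‖ ^ 2 := Complex.normSq_eq_norm_sq _
  have hDb := Dbeta
  set N := Complex.normSq (3 * beta ^ 2 - 1)
  have hpb := plas_mul_nsq
  set b := Complex.normSq beta
  have hb0 : 0 < b := by by_contra hc; push Not at hc; nlinarith
  have e1 : plas ^ p * b ^ p = 1 := by rw [← mul_pow, hpb, one_pow]
  have e2 : plas ^ q * b ^ q = 1 := by rw [← mul_pow, hpb, one_pow]
  have hF1 : (23:ℝ) ≤ F := by exact_mod_cast Nat.le_of_dvd (Nat.pos_of_ne_zero hF0) hF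
  have hpk := pow_pos hp k
  -- norm relation
  have hnorm : (plas ^ k - 1) * G = 23 * (F:ℝ) ^ 3 := by
    have : ((plas ^ k - 1) * plas ^ p) * (G * b ^ p) =
        ((3 * plas ^ 2 - 1) * F * plas ^ q) * (N * (F * F) * b ^ q) := by rw [h, hb2]
    linear_combination this - (plas ^ k - 1) * G * e1 +
      (3 * plas ^ 2 - 1) * N * F ^ 3 * e2 + F ^ 3 * hDb
  have hs := plas_sq_bounds
  have hc := plas_cube
  have h4 : plas ^ 4 = plas ^ 2 + plas := by rw [pow_succ, hc]; ring
  have h5 : plas ^ 5 = plas ^ 2 + plas + 1 := by rw [pow_succ, h4]; linear_combination hc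
  have h11 : plas ^ 11 = 5 * plas ^ 2 + 7 * plas + 4 := by
    rw [show 11 = 5 + 5 + 1 from rfl, pow_succ, pow_add, h5]
    linear_combination (plas ^ 2 + 2 * plas + 4) * hc
  have h11b : 22 < plas ^ 11 ∧ plas ^ 11 < 22.1 := by
    rw [h11]; constructor <;> linarith [plas_gt, plas_lt, hs.1, hs.2]
  obtain ⟨j, rfl⟩ := hk
  have hj : j = 1 ∨ 2 ≤ j := by
    rcases j with _ | _ | j
    · simp at hk0
    · left; rfl
    · right; omega
  rcases hj with rfl | hj
  · have hG4 : G ≤ 4 := by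
      have := (norm_beta_sub (22 * 1) 1 one_pos (by
        simpa using one_le_pow₀ (by linarith [plas_gt] : (1:ℝ) ≤ plas))).2
      rw [hG2]
      nlinarith [norm_nonneg (beta ^ (22 * 1) - 1)]
    have hG0 : 0 ≤ G := Complex.normSq_nonneg _
    have h22 : plas ^ (22 * 1) ≤ 500 := by
      rw [show 22 * 1 = 11 * 2 from rfl, pow_mul]; nlinarith [h11b.1, h11b.2]
    have : (23:ℝ) ^ 3 ≤ (F:ℝ) ^ 3 := by gcongr
    nlinarith
  · have h44 : 200000 ≤ plas ^ (22 * j) := by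
      calc (200000:ℝ) ≤ 22 ^ 4 := by norm_num
        _ ≤ (plas ^ 11) ^ 4 := by gcongr; exact h11b.1.le
        _ = plas ^ 44 := by rw [← pow_mul]
        _ ≤ plas ^ (22 * j) := pow_le_pow_right₀ (by linarith [plas_gt]) (by omega)
    obtain ⟨n1, n2⟩ := norm_beta_sub (22 * j) 0.003 (by norm_num) (by linarith)
    have hG3 : 0.99 ≤ G ∧ G ≤ 1.01 := by
      rw [hG2]
      clear_value G N b
      clear hnorm hb2 hb h
      generalize ‖beta ^ (22 * j) - 1‖ = t at *
      constructor
      · calc (0.99:ℝ) ≤ (1 - 0.003) ^ 2 := by norm_num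
          _ ≤ t ^ 2 := by gcongr
      · calc t ^ 2 ≤ (1 + 0.003) ^ 2 := by
              have : 0 ≤ t := by linarith
              gcongr
          _ ≤ 1.01 := by norm_num
    set Z := plas ^ (22 * j) with hZ
    have key : 23 * (Z - 1) ^ 2 * plas ^ (3 * p) = (3 * plas ^ 2 - 1) ^ 3 * G * plas ^ (3 * q) := by
      have h3 : (Z - 1) ^ 3 * plas ^ (3 * p) =
          (3 * plas ^ 2 - 1) ^ 3 * (F:ℝ) ^ 3 * plas ^ (3 * q) := by
        have := congrArg (fun t => t ^ 3) h
        rw [mul_pow, mul_pow, mul_pow, ← pow_mul, ← pow_mul, mul_comm p, mul_comm q] at this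
        exact this
      have hz : Z - 1 ≠ 0 := by intro h0; linarith
      apply mul_left_cancel₀ hz
      linear_combination 23 * h3 - (3 * plas ^ 2 - 1) ^ 3 * plas ^ (3 * q) * hnorm
    -- compare with powers
    set P3 := plas ^ (3 * p)
    set Q3 := plas ^ (3 * q)
    have hP3 : 0 < P3 := pow_pos hp _
    have hQ3 : 0 < Q3 := pow_pos hp _
    have hD3 : 77.5 < (3 * plas ^ 2 - 1) ^ 3 ∧ (3 * plas ^ 2 - 1) ^ 3 < 77.8 := by
      have a1 : 4.2644 < 3 * plas ^ 2 - 1 := by linarith [hs.1]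
      have a2 : 3 * plas ^ 2 - 1 < 4.2653 := by linarith [hs.2]
      constructor
      · calc (77.5:ℝ) < 4.2644 ^ 3 := by norm_num
          _ < _ := by gcongr
      · calc (3 * plas ^ 2 - 1) ^ 3 < 4.2653 ^ 3 := by gcongr
          _ < 77.8 := by norm_num
    have hEq : (2 * (22 * j) + 3 * p : ℕ) ≤ 3 * q + 4 ∨ 3 * q + 5 ≤ 2 * (22 * j) + 3 * p := by omega
    have hZ2 : Z ^ 2 * P3 = plas ^ (2 * (22 * j) + 3 * p) := by
      rw [pow_add, hZ, ← pow_mul, mul_comm 2]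
    have hZa : (Z - 1) ^ 2 ≤ Z ^ 2 := by clear_value Z; clear hnorm hb2 hb h key; nlinarith only [h44]
    have hZb : 0.99 * Z ^ 2 ≤ (Z - 1) ^ 2 := by clear_value Z; nlinarith only [h44]
    rcases hEq with hE | hE
    · have : Z ^ 2 * P3 ≤ Q3 * plas ^ 4 := by
        rw [hZ2, ← pow_add]; exact pow_le_pow_right₀ (by linarith [plas_gt]) hE
      rw [h4] at this
      have b1 : plas ^ 2 + plas ≤ 3.08 := by linarith [hs.2, plas_lt]
      have b2 : 23 * (Z - 1) ^ 2 * P3 ≤ 23 * (Q3 * 3.08) := by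
        have := mul_le_mul_of_nonneg_right hZa hP3.le
        have := mul_le_mul_of_nonneg_left b1 hQ3.le
        linarith
      have b3 : 76.7 * Q3 ≤ (3 * plas ^ 2 - 1) ^ 3 * G * Q3 := by
        gcongr; nlinarith only [hD3.1, hG3.1]
      linarith
    · have : Q3 * plas ^ 5 ≤ Z ^ 2 * P3 := by
        rw [hZ2, ← pow_add]; exact pow_le_pow_right₀ (by linarith [plas_gt]) hE
      rw [h5] at this
      have b1 : 4 ≤ plas ^ 2 + plas + 1 := by linarith [hs.1, plas_gt]
      have b2 : 23 * 0.99 * (Q3 * 4) ≤ 23 * (Z - 1) ^ 2 * P3 := by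
        have := mul_le_mul_of_nonneg_right hZb hP3.le
        have := mul_le_mul_of_nonneg_left b1 hQ3.le
        linarith
      have b3 : (3 * plas ^ 2 - 1) ^ 3 * G * Q3 ≤ 79 * Q3 := by
        gcongr; nlinarith only [hD3.2, hG3.2, hG3.1]
      linarith

lemma plas_pow_inj {a b : ℕ} (h : plas ^ a = plas ^ b) : a = b :=
  pow_right_injective₀ plas_pos (by linarith [plas_gt] : (1:ℝ) < plas).ne' h

lemma no_rel_F (k c u u' F : ℕ) (hc : 1 ≤ c) (hF : F ≠ 0)
    (h : fk k plas ^ c * plas ^ u = (3 * plas ^ 2 - 1) ^ c * (F : ℝ) ^ c * plas ^ u') : False := by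
  have h10 := tr_rel1 k c u u' F h (ZMod 23) 10 (by decide)
  have h3 := tr_rel1 k c u u' F h (ZMod 23) 3 (by decide)
  have hc0 : c ≠ 0 := by omega
  rw [show (3 * 10 ^ 2 - 1 : ZMod 23) = 0 by decide, zero_pow hc0, zero_mul, zero_mul] at h10
  have hu : (10 : ZMod 23) ^ u ≠ 0 := pow_ne_zero _ (by decide)
  have h11 : fk k (10 : ZMod 23) = 0 := by
    rcases mul_eq_zero.1 h10 with h | h
    · exact pow_eq_zero_iff hc0 |>.1 h
    · exact absurd h hu
  have hk0 : k ≠ 0 := by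
    rintro rfl
    simp [fk] at h11
  have hk22 : 22 ∣ k := by
    apply ord10
    unfold fk at h11
    rw [if_neg hk0] at h11
    exact sub_eq_zero.1 h11
  have hF23 : 23 ∣ F := by
    have e : fk k (3 : ZMod 23) = 0 := by
      unfold fk; rw [if_neg hk0, pow3 k hk22, sub_self]
    rw [e, zero_pow hc0, zero_mul] at h3
    have e1 : (3 * 3 ^ 2 - 1 : ZMod 23) ^ c ≠ 0 := pow_ne_zero _ (by decide)
    have e2 : (3 : ZMod 23) ^ u' ≠ 0 := pow_ne_zero _ (by decide)
    rcases mul_eq_zero.1 h3.symm with h | h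
    · rcases mul_eq_zero.1 h with h | h
      · exact absurd h e1
      · exact (ZMod.natCast_eq_zero_iff F 23).1 ((pow_eq_zero_iff hc0).1 h)
    · exact absurd h e2
  obtain ⟨p, q, hpq⟩ := rel_c_one k c u u' F hc hk0 (Nat.pos_of_ne_zero hF) h
  exact no_rel_one k p q F hk22 hk0 hF23 hF hpq

lemma no_rel (k l c u v u' v' : ℕ) (hc : 1 ≤ c)
    (h : (2 * Real.goldenRatio - 1) ^ c * fk k plas ^ c * plas ^ u * Real.goldenRatio ^ v =
    (3 * plas ^ 2 - 1) ^ c * fk l Real.goldenRatio ^ c * plas ^ u' * Real.goldenRatio ^ v') :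
    False := by
  have hc0 : c ≠ 0 := by omega
  have h5 := tr_rel k l c u v u' v' h (ZMod 5) 2 3 (by decide) (by decide)
  rw [show (2 * 3 - 1 : ZMod 5) = 0 by decide, zero_pow hc0, zero_mul, zero_mul, zero_mul] at h5
  have e0 : (3 * 2 ^ 2 - 1 : ZMod 5) ^ c ≠ 0 := pow_ne_zero _ (by decide)
  have e1 : (2 : ZMod 5) ^ u' ≠ 0 := pow_ne_zero _ (by decide)
  have e2 : (3 : ZMod 5) ^ v' ≠ 0 := pow_ne_zero _ (by decide)
  have e3 : fk l (3 : ZMod 5) = 0 := by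
    by_contra hne
    exact absurd h5.symm (mul_ne_zero (mul_ne_zero (mul_ne_zero e0 (pow_ne_zero _ hne)) e1) e2)
  have hl0 : l ≠ 0 := by
    rintro rfl
    simp [fk] at e3
  have hl4 : 4 ∣ l := by
    apply ord3
    unfold fk at e3
    rw [if_neg hl0] at e3
    exact sub_eq_zero.1 e3
  obtain ⟨s, rfl⟩ := hl4
  set F := Nat.fib (2 * s) with hF
  have hF0 : F ≠ 0 := by
    have : 0 < F := Nat.fib_pos.2 (by omega)
    omega
  have hfl : fk (4 * s) Real.goldenRatio = Real.goldenRatio ^ (2 * s) * (2 * Real.goldenRatio - 1) * F := by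
    unfold fk; rw [if_neg hl0, fib_fact]
  have h6 : fk k plas ^ c * plas ^ u * Real.goldenRatio ^ v =
    (3 * plas ^ 2 - 1) ^ c * (F : ℝ) ^ c * plas ^ u' * Real.goldenRatio ^ (2 * s * c + v') := by
    rw [hfl, mul_pow, mul_pow, ← pow_mul] at h
    apply mul_left_cancel₀ (pow_ne_zero c sq5_pos.ne')
    rw [pow_add]
    linear_combination h
  have h7 := tr_rel2 k c u v u' _ F h6 ℝ plas Real.goldenConj plas_cube conj_cond
  have hD := D_pos
  have hp := plas_pos
  have hfk := fkd_pos k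
  have hF1 : (0:ℝ) < F := by exact_mod_cast Nat.pos_of_ne_zero hF0
  have hv := gold_exp_eq _ _ (by positivity) (by positivity) _ _ h6 h7
  rw [← hv] at h6
  have h8 := mul_right_cancel₀ (pow_ne_zero v Real.goldenRatio_pos.ne') h6
  exact no_rel_F k c u u' F hc hF0 h8

theorem mult_ind (k l : ℕ) (a b c : ℤ) (h : a * Real.log plas + b * Real.log Real.goldenRatio +
      c * Real.log (gam k l) = 0) : a = 0 ∧ b = 0 ∧ c = 0 := by
  have main : ∀ (a b : ℤ) (c : ℕ), a * Real.log plas + b * Real.log Real.goldenRatio +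
      c * Real.log (gam k l) = 0 → a = 0 ∧ b = 0 ∧ c = 0 := by
    intro a b c h
    obtain ⟨a1, a2, ha⟩ : ∃ i j : ℕ, a = (i : ℤ) - j := ⟨a.toNat, (-a).toNat, by omega⟩
    obtain ⟨b1, b2, hb⟩ : ∃ i j : ℕ, b = (i : ℤ) - j := ⟨b.toNat, (-b).toNat, by omega⟩
    subst ha hb
    push_cast at h
    have hr := rel_of_log k l c a1 a2 b1 b2 h
    rcases Nat.eq_zero_or_pos c with rfl | hc
    · have h7 := tr_rel k l 0 _ _ _ _ hr ℝ plas Real.goldenConj plas_cube conj_cond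
      simp only [pow_zero, one_mul, mul_zero, add_zero] at hr h7
      have hp := plas_pos
      have hv := gold_exp_eq _ _ (by positivity) (by positivity) _ _ hr h7
      subst hv
      have h8 := mul_right_cancel₀ (pow_ne_zero _ Real.goldenRatio_pos.ne') hr
      have h9 := plas_pow_inj h8
      subst h9
      simp
    · exact (no_rel k l c _ _ _ _ hc hr).elim
  rcases le_total 0 c with hc | hc
  · lift c to ℕ using hc
    have := main a b c (by exact_mod_cast h)
    simpa using this
  · obtain ⟨d, rfl⟩ : ∃ d : ℤ, c = -d := ⟨-c, by ring⟩
    have hd : 0 ≤ d := by omega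
    lift d to ℕ using hd
    push_cast at h
    have := main (-a) (-b) d (by push_cast; linarith)
    simpa using this

theorem lower_bound (k l : ℕ) (m n : ℤ) (J : ℕ)
    (hJ : 1 ≤ J) (hN : 2^94*(8 + k + l)^2*J^12 ≤ 2^(5*J))
    (hm : 2^31*J^4*(m.natAbs + (8 + k + l)) ≤ 2^(8*J))
    (hn : 2^31*J^4*(n.natAbs + (8 + k + l)) ≤ 2^(8*J)) :
    1 ≤ |Real.log (gam k l) + m * Real.log plas - n * Real.log Real.goldenRatio| *
      2^(2^140 * (8 + k + l)^3 * J^17) :=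
  lower_of_ind k l m n J (mult_ind k l) hJ hN hm hn

/-! ### The linear forms attached to a solution -/

/-- The leading coefficient of the Padovan sequence. -/
noncomputable def aP : ℝ := plas ^ 4 / (3 * plas ^ 2 - 1)

/-- The error term of the Padovan sequence. -/
noncomputable def eP' (m : ℕ) : ℝ := padovan m - aP * plas ^ m

lemma aP_bounds : 0.721 < aP ∧ aP < 0.723 := by
  have hs := plas_sq_bounds
  have h4 : plas ^ 4 = plas ^ 2 + plas := by rw [pow_succ, plas_cube]; ring
  unfold aP
  rw [h4, lt_div_iff₀ D_pos, div_lt_iff₀ D_pos]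
  constructor <;> linarith [hs.1, hs.2, plas_gt, plas_lt]

lemma eP_rec (m : ℕ) : eP' (m + 3) = eP' (m + 1) + eP' m := by
  unfold eP'
  rw [show padovan (m + 3) = padovan (m + 1) + padovan m from rfl]
  push_cast
  rw [pow_add, plas_cube, pow_succ]; ring

lemma eP_quad (m : ℕ) : eP' (m + 2) + plas * eP' (m + 1) + (plas ^ 2 - 1) * eP' m = 0 := by
  induction m with
  | zero =>
    unfold eP'
    simp [padovan]
    have h : aP * (3 * plas ^ 2 - 1) = plas ^ 4 := by
      unfold aP; exact div_mul_cancel₀ _ D_pos.ne'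
    linear_combination -h - plas * plas_cube
  | succ m ih =>
    have h := eP_rec m
    rw [show m + 1 + 2 = m + 3 from rfl, show m + 1 + 1 = m + 2 from rfl, h]
    linear_combination plas * ih - eP' m * plas_cube

lemma eP_bound (m : ℕ) : |eP' m| ≤ 1 / 2 := by
  have hs := plas_sq_bounds
  have hQ : ∀ m, eP' (m + 1) ^ 2 + plas * eP' m * eP' (m + 1) + (plas ^ 2 - 1) * eP' m ^ 2 ≤ 0.0785 := by
    intro m
    induction m with
    | zero =>
      have h0 : eP' 0 = 1 - aP := by unfold eP'; simp [padovan]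
      have h1 : eP' 1 = 1 - aP * plas := by unfold eP'; simp [padovan]
      have ha := aP_bounds
      rw [h0, show eP' (0 + 1) = 1 - aP * plas from h1]
      have b1 : 0 ≤ 1 - aP := by linarith [ha.2]
      have b2 : 1 - aP ≤ 0.279 := by linarith [ha.1]
      have b3 : 0 ≤ 1 - aP * plas := by nlinarith [ha.1, ha.2, plas_gt, plas_lt]
      have b4 : 1 - aP * plas ≤ 0.0449 := by nlinarith [ha.1, ha.2, plas_gt, plas_lt]
      have c1 : (1 - aP * plas) ^ 2 ≤ 0.0449 ^ 2 := by gcongr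
      have c2 : (1 - aP) ^ 2 ≤ 0.279 ^ 2 := by gcongr
      have c3 : plas * (1 - aP) * (1 - aP * plas) ≤ 1.3248 * 0.279 * 0.0449 := by
        have := plas_pos
        gcongr
        exact plas_lt.le
      have c4 : (plas ^ 2 - 1) * (1 - aP) ^ 2 ≤ 0.7551 * 0.279 ^ 2 := by
        gcongr
        linarith [hs.2]
      norm_num at c1 c3 c4 ⊢
      linarith
    | succ m ih =>
      have hq := eP_quad m
      have he : eP' (m + 1 + 1) ^ 2 + plas * eP' (m + 1) * eP' (m + 1 + 1) +
          (plas ^ 2 - 1) * eP' (m + 1) ^ 2 = (plas ^ 2 - 1) * (eP' (m + 1) ^ 2 +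
          plas * eP' m * eP' (m + 1) + (plas ^ 2 - 1) * eP' m ^ 2) := by
        rw [show m + 1 + 1 = m + 2 from rfl]
        linear_combination (eP' (m + 2) - (plas ^ 2 - 1) * eP' m) * hq
      rw [he]
      nlinarith [hs.1, hs.2]
  have h := hQ m
  have h2 : 0.316 * eP' m ^ 2 ≤ 0.0785 := by
    nlinarith [sq_nonneg (eP' (m + 1) + plas / 2 * eP' m), mul_nonneg (sub_nonneg.2 hs.1.le) (sq_nonneg (eP' m))]
  have h3 : eP' m ^ 2 ≤ (1 / 2) ^ 2 := by norm_num at h2 ⊢; linarith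
  exact abs_le_of_sq_le_sq h3 (by norm_num)

lemma sqrt5_eq : Real.sqrt 5 = 2 * Real.goldenRatio - 1 := by unfold Real.goldenRatio; ring

lemma fib_err (n : ℕ) (hn : 1 ≤ n) : |(Nat.fib n : ℝ) - Real.goldenRatio ^ n / (2 * Real.goldenRatio - 1)| ≤ 0.3 := by
  rw [Real.coe_fib_eq, sqrt5_eq, ← sub_div, sub_sub_cancel_left, abs_div, abs_neg, abs_pow]
  have h1 : |Real.goldenConj| ≤ 0.6181 := by
    have := Real.goldenRatio_add_goldenConj
    rw [abs_le]; constructor <;> linarith [gold_gt, gold_lt]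
  have h2 : |Real.goldenConj| ^ n ≤ 0.6181 := by
    refine (pow_le_of_le_one (abs_nonneg _) (by linarith) (by omega)).trans h1
  have h3 : 2.236 ≤ |2 * Real.goldenRatio - 1| := by
    rw [abs_of_pos sq5_pos]; linarith [gold_gt]
  rw [div_le_iff₀ (by linarith)]
  linarith

/-- The linear form in logarithms. -/
noncomputable def Lam (k l m n : ℕ) : ℝ :=
  Real.log (gam k l) + m * Real.log plas - n * Real.log Real.goldenRatio

lemma exp_Lam (k l m n : ℕ) : Real.exp (Lam k l m n) =
    (aP * plas ^ m * gd k) / (Real.goldenRatio ^ n / (2 * Real.goldenRatio - 1) * gp l) := by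
  have h1 := plas_pos
  have h2 := Real.goldenRatio_pos
  have h3 := gp_pos l
  have h4 := sq5_pos
  have h5 := D_pos
  unfold Lam
  rw [Real.exp_sub, Real.exp_add, Real.exp_log (gam_pos k l), mul_comm (m:ℝ), mul_comm (n:ℝ),
    Real.exp_mul, Real.exp_mul, Real.exp_log h1, Real.exp_log h2, Real.rpow_natCast, Real.rpow_natCast]
  unfold gam aP
  rw [div_mul_eq_mul_div, div_div, div_mul_eq_mul_div, div_mul_eq_mul_div, div_mul_eq_mul_div,
    div_div_div_eq]
  congr 1 <;> ring

lemma abs_le_of_exp (x t : ℝ) (h : |Real.exp x - 1| ≤ t) (ht : t ≤ 1 / 2) : |x| ≤ 2 * t := by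
  have h1 := abs_le.1 h
  have hp := Real.exp_pos x
  rw [abs_le]
  constructor
  · have h2 := Real.add_one_le_exp (-x)
    have h3 : Real.exp x * Real.exp (-x) = 1 := by rw [← Real.exp_add]; simp
    have h4 : (1 - t) * (1 - x) ≤ 1 := by
      by_cases hx : 1 - x ≤ 0
      · nlinarith
      · push Not at hx
        calc (1 - t) * (1 - x) ≤ Real.exp x * Real.exp (-x) := by
              apply mul_le_mul <;> linarith
          _ = 1 := h3
    by_contra hc
    push Not at hc
    nlinarith
  · linarith [Real.add_one_le_exp x, (abs_nonneg (Real.exp x - 1)).trans h]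

lemma one_le_of_exp (x t U : ℝ) (h : |Real.exp x - 1| ≤ t) (hU : 1 ≤ U) (hx : 1 ≤ |x| * U) :
    1 ≤ 2 * t * U := by
  rcases le_or_gt t (1/2) with ht | ht
  · have := abs_le_of_exp x t h ht
    nlinarith
  · nlinarith

/-- The set of facts extracted from a solution. -/
structure Sol (k l m n : ℕ) : Prop where
  A : |Real.exp (Lam k l m n) - 1| ≤ 10 * (Real.goldenRatio ^ n)⁻¹
  B : |Real.exp (Lam k 0 m n) - 1| ≤ 5 * (Real.goldenRatio ^ l)⁻¹
  C : |Real.exp (-Lam 0 l m n) - 1| ≤ 4 * (plas ^ k)⁻¹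
  E : |Real.exp (Lam 0 0 m n) - 1| ≤ 5 * (Real.goldenRatio ^ l)⁻¹ + 7 * (plas ^ k)⁻¹
  R : plas ^ m ≤ 4 * Real.goldenRatio ^ n
  R' : Real.goldenRatio ^ n ≤ 9 * plas ^ m

set_option maxHeartbeats 1000000 in
lemma sol_of_eq (k l m1 n1 : ℕ) (hk : 1 ≤ k) (hl : 1 ≤ l) (hn1 : 1 ≤ n1) (hn : 7 ≤ n1 + l)
    (h : (padovan (m1 + k) : ℤ) - padovan m1 = Nat.fib (n1 + l) - Nat.fib n1) :
    Sol k l (m1 + k) (n1 + l) := by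
  have hr : (padovan (m1 + k) : ℝ) - padovan m1 = Nat.fib (n1 + l) - Nat.fib n1 := by exact_mod_cast h
  have e1 := abs_le.1 (eP_bound (m1 + k))
  have e2 := abs_le.1 (eP_bound m1)
  have f1 := abs_le.1 (fib_err (n1 + l) (by omega))
  have f2 := abs_le.1 (fib_err n1 hn1)
  unfold eP' at e1 e2
  have hp := plas_pos
  have hg := Real.goldenRatio_pos
  have hs := sq5_pos
  have ha := aP_bounds
  set X := aP * plas ^ (m1 + k) with hX
  set Y := Real.goldenRatio ^ (n1 + l) / (2 * Real.goldenRatio - 1) with hY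
  have hXk : aP * plas ^ m1 = X * (plas ^ k)⁻¹ := by
    rw [hX, pow_add]; field_simp
  have hYl : Real.goldenRatio ^ n1 / (2 * Real.goldenRatio - 1) = Y * (Real.goldenRatio ^ l)⁻¹ := by
    rw [hY, pow_add]
    have := pow_pos hg l
    generalize Real.goldenRatio ^ l = t at *
    generalize Real.goldenRatio ^ n1 = r at *
    rw [div_mul_eq_mul_div]
    congr 1
    field_simp
  rw [hXk] at e2
  rw [hYl] at f2
  have hpk : 0 < (plas ^ k)⁻¹ := by positivity
  have hgl : 0 < (Real.goldenRatio ^ l)⁻¹ := by positivity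
  set s := (plas ^ k)⁻¹ with hsdef
  set t := (Real.goldenRatio ^ l)⁻¹ with htdef
  have hgd : gd k = 1 - s := by unfold gd; rw [if_neg (by omega)]
  have hgp : gp l = 1 - t := by unfold gp; rw [if_neg (by omega)]
  have hgdb := gd_bounds k
  have hgpb := gp_bounds l
  have hgd0 : gd 0 = 1 := by unfold gd; simp
  have hgp0 : gp 0 = 1 := by unfold gp; simp
  have hX0 : 0 < X := by have : 0 < aP := by linarith [ha.1]
                         positivity
  have hY0 : 0 < Y := by positivity
  have hYg : Y * (2 * Real.goldenRatio - 1) = Real.goldenRatio ^ (n1 + l) := by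
    rw [hY]; exact div_mul_cancel₀ _ hs.ne'
  have hkey : |X * gd k - Y * gp l| ≤ 1.6 := by
    rw [hgd, hgp, abs_le]
    constructor <;> linarith [e1.1, e1.2, e2.1, e2.2, f1.1, f1.2, f2.1, f2.2]
  have hk2 := abs_le.1 hkey
  have hginv : (Real.goldenRatio ^ (n1 + l))⁻¹ = (Y * (2 * Real.goldenRatio - 1))⁻¹ := by rw [hYg]
  have hYg0 : 0 < Y * gp l := mul_pos hY0 (gp_pos l)
  have hA : |Real.exp (Lam k l (m1 + k) (n1 + l)) - 1| ≤ 10 * (Real.goldenRatio ^ (n1 + l))⁻¹ := by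
    rw [exp_Lam, ← hX, ← hY, hginv, div_sub_one hYg0.ne', abs_div,
      abs_of_pos hYg0, div_le_iff₀ hYg0]
    have : 10 * (Y * (2 * Real.goldenRatio - 1))⁻¹ * (Y * gp l) =
        10 * gp l / (2 * Real.goldenRatio - 1) := by field_simp
    rw [this]
    refine hkey.trans ?_
    rw [le_div_iff₀ hs]
    linarith [gold_lt, hgpb.1]
  have hg7 : 29 ≤ Real.goldenRatio ^ (n1 + l) := by
    calc (29:ℝ) ≤ 1.618 ^ 7 := by norm_num
      _ ≤ Real.goldenRatio ^ 7 := by gcongr; exact gold_gt.le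
      _ ≤ _ := pow_le_pow_right₀ (by linarith [gold_gt]) hn
  have hY12 : 12 ≤ Y := by
    rw [hY, le_div_iff₀ hs]; linarith [gold_lt]
  have q1 : 0.38 * Y ≤ Y * gp l := by rw [mul_comm]; exact mul_le_mul_of_nonneg_left hgpb.1.le hY0.le
  have q2 : Y * gp l ≤ Y := mul_le_of_le_one_right hY0.le hgpb.2
  have q3 : 0.24 * X ≤ X * gd k := by rw [mul_comm]; exact mul_le_mul_of_nonneg_left hgdb.1.le hX0.le
  have q4 : X * gd k ≤ X := mul_le_of_le_one_right hX0.le hgdb.2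
  have hXY1 : X * gd k ≤ 1.4 * (Y * gp l) := by linarith only [hk2.2, q1, hY12]
  have hXY2 : Y * gp l ≤ 1.6 * (X * gd k) := by linarith only [hk2.1, q1, hY12]
  have hXY3 : X ≤ 6 * Y := by linarith only [q3, hXY1, q2, hY12]
  have hXY4 : Y ≤ 5 * X := by linarith only [q1, q4, hXY2, hX0]
  have hn1t : 1 ≤ Real.goldenRatio ^ (n1 + l) * t := by
    rw [htdef, pow_add, mul_assoc, mul_inv_cancel₀ (pow_pos hg l).ne', mul_one]
    exact one_le_pow₀ (by linarith [gold_gt])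
  have hm1s : 0.72 ≤ X * s := by
    rw [← hXk]
    have : 1 ≤ plas ^ m1 := one_le_pow₀ (by linarith [plas_gt])
    nlinarith only [ha.1, this]
  have hYt : 0.44 ≤ Y * t := by
    rw [← hYg] at hn1t
    have h0 : 0 < Y * t := mul_pos hY0 hgl
    have h1 : Y * (2 * Real.goldenRatio - 1) * t ≤ Y * t * 2.2362 := by
      rw [mul_right_comm]
      exact mul_le_mul_of_nonneg_left (by linarith only [gold_lt]) h0.le
    linarith only [h1, hn1t]
  refine ⟨hA, ?_, ?_, ?_, ?_, ?_⟩
  · rw [exp_Lam, ← hX, ← hY, hgp0, mul_one, div_sub_one hY0.ne', abs_div, abs_of_pos hY0,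
      div_le_iff₀ hY0]
    have hk3 := hk2
    rw [hgp] at hk3
    rw [abs_le]
    constructor <;> nlinarith only [hk3.1, hk3.2, hYt, hm1s, hY0]
  · rw [Real.exp_neg, exp_Lam, ← hX, ← hY, hgd0, mul_one, inv_div, div_sub_one hX0.ne', abs_div,
      abs_of_pos hX0, div_le_iff₀ hX0]
    have hk3 := hk2
    rw [hgd] at hk3
    rw [abs_le]
    constructor <;> nlinarith only [hk3.1, hk3.2, hYt, hm1s, hX0]
  · rw [exp_Lam, ← hX, ← hY, hgp0, hgd0, mul_one, mul_one, div_sub_one hY0.ne', abs_div, abs_of_pos hY0,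
      div_le_iff₀ hY0]
    have hk3 := hk2
    rw [hgp, hgd] at hk3
    have : X * s ≤ 6 * Y * s := by gcongr
    rw [abs_le]
    constructor <;> nlinarith only [hk3.1, hk3.2, hYt, hm1s, this]
  · have hXa : X = aP * plas ^ (m1 + k) := hX
    have := pow_pos hp (m1 + k)
    have h3 : aP * plas ^ (m1 + k) ≤ 6 * Y := by rw [← hXa]; exact hXY3
    have h4 : 2.236 * Y ≤ Real.goldenRatio ^ (n1 + l) := by
      rw [← hYg]; nlinarith only [gold_gt, hY0]
    nlinarith only [ha.1, h3, h4, this]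
  · have h4 : Real.goldenRatio ^ (n1 + l) ≤ 2.2362 * Y := by
      rw [← hYg]; nlinarith only [gold_lt, hY0]
    have h5 := pow_pos hp (m1 + k)
    have : X ≤ 0.723 * plas ^ (m1 + k) := by rw [hX]; gcongr; exact ha.2.le
    linarith only [this, h4, h5, hXY4]

/-! ### The absolute bound for the indices -/

lemma plas_exp (k a : ℕ) (h : plas ^ k ≤ 2 ^ a) : k ≤ 3 * a := by
  by_contra hc
  push Not at hc
  have h1 : (1:ℝ) < plas := by linarith [plas_gt]
  have h2 : plas ^ (3 * a) < plas ^ k := pow_lt_pow_right₀ h1 hc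
  have h3 : (2:ℝ) ^ a ≤ plas ^ (3 * a) := by
    rw [pow_mul, plas_cube]
    exact pow_le_pow_left₀ (by norm_num) (by linarith) a
  linarith

lemma gold_exp (k a : ℕ) (h : Real.goldenRatio ^ k ≤ 2 ^ a) : k ≤ 2 * a := by
  by_contra hc
  push Not at hc
  have h1 : (1:ℝ) < Real.goldenRatio := by linarith [gold_gt]
  have h2 : Real.goldenRatio ^ (2 * a) < Real.goldenRatio ^ k := pow_lt_pow_right₀ h1 hc
  have h3 : (2:ℝ) ^ a ≤ Real.goldenRatio ^ (2 * a) := by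
    rw [pow_mul, Real.goldenRatio_sq]
    exact pow_le_pow_left₀ (by norm_num) (by linarith) a
  linarith

lemma lower_bound' (k l m n J H : ℕ) (hJ : 1 ≤ J) (hH : 8 + k + l ≤ H)
    (hN : 2^94 * H^2 * J^12 ≤ 2^(5*J)) (hm : 2^31 * J^4 * (m + H) ≤ 2^(8*J))
    (hn : 2^31 * J^4 * (n + H) ≤ 2^(8*J)) :
    1 ≤ |Lam k l m n| * 2^(2^140 * H^3 * J^17) := by
  have h := lower_bound k l (m:ℤ) (n:ℤ) J hJ (le_trans (by gcongr) hN)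
    (by rw [Int.natAbs_natCast]; exact le_trans (by gcongr) hm)
    (by rw [Int.natAbs_natCast]; exact le_trans (by gcongr) hn)
  rw [Int.cast_natCast, Int.cast_natCast] at h
  refine h.trans ?_
  unfold Lam
  refine mul_le_mul_of_nonneg_left ?_ (abs_nonneg _)
  refine pow_le_pow_right₀ (by norm_num) ?_
  gcongr

lemma inv_le_help (x : ℝ) (c a U : ℕ) (hx : 0 < x) (hc : (2:ℝ) * c ≤ 2 ^ a)
    (h : (1:ℝ) ≤ 2 * (c * x⁻¹) * 2 ^ U) : x ≤ 2 ^ (U + a) := by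
  have h1 : x ≤ 2 * c * 2 ^ U := by
    have := mul_le_mul_of_nonneg_right h hx.le
    rw [one_mul] at this
    refine this.trans (le_of_eq ?_)
    field_simp
  rw [pow_add, mul_comm ((2:ℝ)^U)]
  exact h1.trans (by gcongr)

lemma growth (A s e : ℕ) (he : 572 ^ e ≤ 2 * 571 ^ e) (hs : 1 ≤ s) (hb : 2 ^ A * 571 ^ e < 2 ^ (571 * s))
    (J : ℕ) (hJ : 571 ≤ J) : 2 ^ A * J ^ e < 2 ^ (s * J) := by
  induction J, hJ using Nat.le_induction with
  | base => rwa [mul_comm s]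
  | succ J hJ ih =>
    have h1 : (571 * (J + 1)) ^ e ≤ (572 * J) ^ e := Nat.pow_le_pow_left (by omega) e
    rw [mul_pow, mul_pow] at h1
    have h2 : (J + 1) ^ e ≤ 2 * J ^ e := by
      have h3 : 0 < 571 ^ e := by positivity
      refine Nat.le_of_mul_le_mul_left (h1.trans ?_) h3
      calc 572 ^ e * J ^ e ≤ 2 * 571 ^ e * J ^ e := Nat.mul_le_mul_right _ he
        _ = _ := by ring
    calc 2 ^ A * (J + 1) ^ e ≤ 2 ^ A * (2 * J ^ e) := Nat.mul_le_mul_left _ h2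
      _ = 2 * (2 ^ A * J ^ e) := by ring
      _ < 2 * 2 ^ (s * J) := by omega
      _ = 2 ^ (s * J + 1) := by ring
      _ ≤ _ := Nat.pow_le_pow_right (by norm_num) (by rw [mul_add]; omega)

set_option exponentiation.threshold 6000 in
lemma growth1 (J : ℕ) (hJ : 571 ≤ J) : 2 ^ 1948 * J ^ 221 < 2 ^ (7 * J) :=
  growth 1948 7 221 (by norm_num) (by norm_num) (by norm_num) J hJ

set_option exponentiation.threshold 6000 in
lemma growth2 (J : ℕ) (hJ : 571 ≤ J) : 2 ^ 1292 * J ^ 148 < 2 ^ (5 * J) :=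
  growth 1292 5 148 (by norm_num) (by norm_num) (by norm_num) J hJ

set_option exponentiation.threshold 6000 in
lemma growth3 (J : ℕ) (hJ : 571 ≤ J) : 2 ^ 33 * J ^ 4 < 2 ^ (1 * J) :=
  growth 33 1 4 (by norm_num) (by norm_num) (by norm_num) J hJ

set_option exponentiation.threshold 6000 in
lemma chain (k l m n J : ℕ) (hs : Sol k l m n) (hJ : 571 ≤ J) (hm : m < 2 ^ (7 * J))
    (hn : n < 2 ^ (7 * J)) : n ≤ 2 ^ 1939 * J ^ 221 ∧ m ≤ 2 ^ 1941 * J ^ 221 := by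
  have hp := plas_pos
  have hg := Real.goldenRatio_pos
  have hJ0 : 1 ≤ J := by omega
  have hcond : ∀ H x : ℕ, H ≤ 2 ^ 599 * J ^ 68 → x < 2 ^ (7 * J) →
      2^31 * J^4 * (x + H) ≤ 2^(8*J) := by
    intro H x hH hx
    have h1 := growth1 J hJ
    have h2 := growth3 J hJ
    have h3 : 2 ^ 599 * J ^ 68 ≤ 2 ^ 1948 * J ^ 221 := by
      gcongr <;> first | exact hJ0 | norm_num
    calc 2^31 * J^4 * (x + H) ≤ 2^31 * J^4 * (2 ^ (7 * J) + 2 ^ (7 * J)) := by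
          apply Nat.mul_le_mul_left
          exact add_le_add hx.le (hH.trans (h3.trans h1.le))
      _ = (2 ^ 32 * J ^ 4) * 2 ^ (7 * J) := by ring
      _ ≤ (2 ^ 33 * J ^ 4) * 2 ^ (7 * J) := by gcongr <;> norm_num
      _ ≤ 2 ^ (1 * J) * 2 ^ (7 * J) := Nat.mul_le_mul_right _ h2.le
      _ = 2 ^ (8 * J) := by rw [← pow_add]; congr 1; ring
  have hcond2 : ∀ H : ℕ, H ≤ 2 ^ 599 * J ^ 68 → 2^94 * H^2 * J^12 ≤ 2^(5*J) := by
    intro H hH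
    calc 2^94 * H^2 * J^12 ≤ 2^94 * (2 ^ 599 * J ^ 68)^2 * J^12 := by gcongr
      _ = 2 ^ 1292 * J ^ 148 := by ring
      _ ≤ _ := (growth2 J hJ).le
  have hLB : ∀ H k' l' : ℕ, 8 + k' + l' ≤ H → H ≤ 2 ^ 599 * J ^ 68 →
      1 ≤ |Lam k' l' m n| * 2^(2^140 * H^3 * J^17) := by
    intro H k' l' h1 h2
    exact lower_bound' k' l' m n J H hJ0 h1 (hcond2 H h2) (hcond H m h2 hm) (hcond H n h2 hn)
  have one_le : ∀ U : ℕ, (1:ℝ) ≤ 2 ^ U := fun U => one_le_pow₀ (by norm_num)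
  have hJp : ∀ e : ℕ, 1 ≤ J ^ e := fun e => Nat.one_le_pow _ _ hJ0
  have hge : ∀ a e : ℕ, 10 ≤ a → 1024 ≤ 2 ^ a * J ^ e := by
    intro a e ha
    calc 1024 = 2 ^ 10 * 1 := by norm_num
      _ ≤ 2 ^ a * J ^ e := Nat.mul_le_mul (Nat.pow_le_pow_right (by norm_num) ha) (hJp e)
  -- step 1
  have s1 : l ≤ 4 * (2 ^ 149 * J ^ 17) ∨ k ≤ 4 * (2 ^ 149 * J ^ 17) := by
    have h0 := hLB 8 0 0 (by norm_num) (le_trans (by norm_num) (hge 599 68 (by norm_num)))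
    rw [show 2 ^ 140 * 8 ^ 3 * J ^ 17 = 2 ^ 149 * J ^ 17 by ring] at h0
    have hU := hge 149 17 (by norm_num)
    generalize 2 ^ 149 * J ^ 17 = U at *
    have h1 := one_le_of_exp _ _ _ hs.E (one_le U) h0
    have h2 : (1:ℝ) ≤ 2 * ((10:ℕ) * (Real.goldenRatio ^ l)⁻¹) * 2 ^ U ∨
        (1:ℝ) ≤ 2 * ((14:ℕ) * (plas ^ k)⁻¹) * 2 ^ U := by
      by_contra hc
      push Not at hc
      push_cast at hc
      linarith [hc.1, hc.2]
    rcases h2 with h2 | h2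
    · left
      have := gold_exp _ _ (inv_le_help _ 10 5 U (by positivity) (by norm_num) h2)
      omega
    · right
      have := plas_exp _ _ (inv_le_help _ 14 5 U (by positivity) (by norm_num) h2)
      omega
  have s2 : 8 + k + l ≤ 2 ^ 599 * J ^ 68 := by
    have hH : 2 ^ 152 * J ^ 17 ≤ 2 ^ 599 * J ^ 68 := by
      gcongr <;> first | exact hJ0 | norm_num
    have hH' : 8 * (2 ^ 149 * J ^ 17) ≤ 2 ^ 596 * J ^ 68 := by
      rw [show 8 * (2 ^ 149 * J ^ 17) = 2 ^ 152 * J ^ 17 by ring]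
      gcongr <;> first | exact hJ0 | norm_num
    have hW := hge 149 17 (by norm_num)
    have key : ∀ k' l', 8 + k' + l' ≤ 8 * (2 ^ 149 * J ^ 17) →
        1 ≤ |Lam k' l' m n| * 2 ^ (2 ^ 596 * J ^ 68) := by
      intro k' l' h
      have h0 := hLB (2 ^ 152 * J ^ 17) k' l' (h.trans (le_of_eq (by ring))) hH
      rwa [show 2 ^ 140 * (2 ^ 152 * J ^ 17) ^ 3 * J ^ 17 = 2 ^ 596 * J ^ 68 by ring] at h0
    rw [show 2 ^ 599 * J ^ 68 = 8 * (2 ^ 596 * J ^ 68) by ring]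
    clear hLB hcond hcond2 hH
    have hU := hge 596 68 (by norm_num)
    generalize 2 ^ 596 * J ^ 68 = U at *
    generalize 2 ^ 149 * J ^ 17 = W at *
    rcases s1 with s1 | s1
    · have h0 := key 0 l (by omega)
      rw [← abs_neg] at h0
      have h1 := one_le_of_exp _ _ _ hs.C (one_le U) h0
      have := plas_exp _ _ (inv_le_help _ 4 5 U (by positivity) (by norm_num) (by exact_mod_cast h1))
      omega
    · have h0 := key k 0 (by omega)
      have h1 := one_le_of_exp _ _ _ hs.B (one_le U) h0
      have := gold_exp _ _ (inv_le_help _ 5 5 U (by positivity) (by norm_num) (by exact_mod_cast h1))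
      omega
  have h0 := hLB _ k l s2 le_rfl
  rw [show 2 ^ 140 * (2 ^ 599 * J ^ 68) ^ 3 * J ^ 17 = 2 ^ 1937 * J ^ 221 by ring] at h0
  rw [show 2 ^ 1939 * J ^ 221 = 4 * (2 ^ 1937 * J ^ 221) by ring,
    show 2 ^ 1941 * J ^ 221 = 16 * (2 ^ 1937 * J ^ 221) by ring]
  have hU := hge 1937 221 (by norm_num)
  clear s1 s2 hLB hcond hcond2
  generalize 2 ^ 1937 * J ^ 221 = U at *
  have h1 := one_le_of_exp _ _ _ hs.A (one_le U) h0
  have h2 := gold_exp _ _ (inv_le_help _ 10 5 U (by positivity) (by norm_num) (by exact_mod_cast h1))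
  have h3 : plas ^ m ≤ 2 ^ (n + 2) := by
    refine hs.R.trans ?_
    rw [pow_add, mul_comm]
    have : Real.goldenRatio ^ n ≤ 2 ^ n := pow_le_pow_left₀ hg.le (by linarith [gold_lt]) n
    linarith
  have h4 := plas_exp _ _ h3
  omega

set_option exponentiation.threshold 6000 in
theorem abs_bound (k l m n : ℕ) (hs : Sol k l m n) : m < 2 ^ 3990 ∧ n < 2 ^ 3990 := by
  by_contra hc
  have hB : 2 ^ 3990 ≤ max m n := by
    by_contra h
    push Not at h
    exact hc ⟨(le_max_left _ _).trans_lt h, (le_max_right _ _).trans_lt h⟩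
  set B := max m n with hBd
  have hB0 : B ≠ 0 := fun h => absurd (h ▸ hB) (by simp)
  set J := Nat.log 2 B / 7 + 1 with hJd
  have hlog : 3990 ≤ Nat.log 2 B := (Nat.le_log_iff_pow_le (by norm_num) hB0).2 hB
  have hJ : 571 ≤ J := by omega
  have hlt : B < 2 ^ (7 * J) :=
    (Nat.lt_pow_succ_log_self (by norm_num) B).trans_le (Nat.pow_le_pow_right (by norm_num) (by omega))
  have hge : 2 ^ (7 * (J - 1)) ≤ B :=
    (Nat.pow_le_pow_right (by norm_num) (by omega)).trans (Nat.pow_log_le_self 2 hB0)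
  obtain ⟨h1, h2⟩ := chain k l m n J hs hJ ((le_max_left _ _).trans_lt hlt) ((le_max_right _ _).trans_lt hlt)
  have h3 : B ≤ 2 ^ 1941 * J ^ 221 := max_le h2 (h1.trans (by gcongr <;> norm_num))
  have h4 := growth1 J hJ
  have h5 : 2 ^ (7 * J) = 128 * 2 ^ (7 * (J - 1)) := by
    rw [show 7 * J = 7 * (J - 1) + 7 by omega, pow_add]; norm_num; ring
  rw [show 2 ^ 1948 * J ^ 221 = 128 * (2 ^ 1941 * J ^ 221) by ring] at h4
  generalize 2 ^ 1941 * J ^ 221 = a at *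
  generalize 2 ^ (7 * J) = b at *
  generalize 2 ^ (7 * (J - 1)) = c at *
  omega

/-! ### Verified fixed point computation of the logarithms -/

/-- Call by value for the kernel: evaluates the number before passing it on. -/
def force {α : Type} (n : ℕ) (f : ℕ → α) : α := Nat.rec (f 0) (fun m _ => f (Nat.succ m)) n

/-- Call by value for lists. -/
def forceL {α : Type} (xs : List ℕ) (f : List ℕ → α) : α :=
  List.rec (f []) (fun a l _ => f (a :: l)) xs

lemma force_eq {α : Type} (n : ℕ) (f : ℕ → α) : force n f = f n := by cases n <;> rfl

lemma forceL_eq {α : Type} (xs : List ℕ) (f : List ℕ → α) : forceL xs f = f xs := by cases xs <;> rfl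

/-- Partial sums of the logarithmic series. -/
def lsum (N X J : ℕ) (fuel : ℕ) : ℕ → ℕ → ℕ :=
  Nat.rec (fun _ acc => acc)
    (fun i ih t acc => force (Nat.shiftRight (Nat.mul t X) N) fun t' =>
      force (Nat.add acc (Nat.div t' (Nat.sub J i))) fun acc' => ih t' acc') fuel

lemma lsum_succ (N X J i t acc : ℕ) : lsum N X J (i + 1) t acc =
    lsum N X J i (t * X / 2 ^ N) (acc + t * X / 2 ^ N / (J - i)) := by
  rw [← Nat.shiftRight_eq_div_pow]
  have h : lsum N X J (i + 1) t acc = force (Nat.shiftRight (Nat.mul t X) N) fun t' =>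
      force (Nat.add acc (Nat.div t' (Nat.sub J i))) fun acc' => lsum N X J i t' acc' := rfl
  rw [h, force_eq, force_eq]
  rfl

/-- One table entry. -/
def entry (N C u F off J pw : ℕ) : ℕ :=
  force (lsum N pw (Nat.succ J) J pw pw) fun L =>
    Nat.mod (Nat.add (Nat.shiftRight (Nat.mul C L) (Nat.sub (Nat.add N u) F)) off) (Nat.pow 2 F)

/-- The table of entries. -/
def tbl (N Y C u F off T K : ℕ) (fuel : ℕ) : ℕ → List ℕ → List ℕ :=
  Nat.rec (fun _ acc => acc)
    (fun i ih pw acc => force (Nat.shiftRight (Nat.mul pw Y) N) fun pw' =>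
      force (Nat.div T (Nat.sub K i)) fun J =>
      force (entry N C u F off J pw') fun x => ih pw' (x :: acc)) fuel

lemma tbl_succ (N Y C u F off T K i pw : ℕ) (acc : List ℕ) :
    tbl N Y C u F off T K (i + 1) pw acc = tbl N Y C u F off T K i (pw * Y / 2 ^ N)
      (entry N C u F off (T / (K - i)) (pw * Y / 2 ^ N) :: acc) := by
  rw [← Nat.shiftRight_eq_div_pow]
  have h : tbl N Y C u F off T K (i + 1) pw acc = force (Nat.shiftRight (Nat.mul pw Y) N) fun pw' =>
      force (Nat.div T (Nat.sub K i)) fun J =>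
      force (entry N C u F off J pw') fun x => tbl N Y C u F off T K i pw' (x :: acc) := rfl
  rw [h, force_eq, force_eq, force_eq]
  rfl

/-- Powers in fixed point arithmetic. -/
def fpow (N Y : ℕ) (fuel : ℕ) : ℕ → ℕ :=
  Nat.rec (fun pw => pw) (fun _ ih pw => force (Nat.shiftRight (Nat.mul pw Y) N) fun pw' => ih pw') fuel

lemma fpow_succ (N Y i pw : ℕ) : fpow N Y (i + 1) pw = fpow N Y i (pw * Y / 2 ^ N) := by
  rw [← Nat.shiftRight_eq_div_pow]
  change force _ _ = _
  rw [force_eq]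
  rfl

/-- The logarithm of the `k`-th factor. -/
noncomputable def Av (y : ℝ) (k : ℕ) : ℝ := if k = 0 then 0 else - Real.log (1 - y ^ k)

lemma floor_bounds (a b : ℕ) (hb : 0 < b) :
    ((a / b : ℕ) : ℝ) * b ≤ a ∧ (a : ℝ) ≤ ((a / b : ℕ) : ℝ) * b + b := by
  have h1 : a / b * b ≤ a := Nat.div_mul_le_self a b
  have h2 : a ≤ a / b * b + b := by
    have := Nat.lt_div_mul_add (a := a) hb
    omega
  exact ⟨by exact_mod_cast h1, by exact_mod_cast h2⟩

lemma lsum_spec (N X J : ℕ) (x d : ℝ) (hx0 : 0 ≤ x) (hx1 : x ≤ 1) (hd : 0 ≤ d)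
    (hX : (X:ℝ) ≤ x * 2 ^ N) (hX' : x * 2 ^ N ≤ X + d) (i : ℕ) :
    ∀ (j t acc : ℕ), j + i = J → 1 ≤ j → (t:ℝ) ≤ x ^ j * 2 ^ N → x ^ j * 2 ^ N ≤ t + j * (d + 1) →
    (acc:ℝ) ≤ 2 ^ N * ∑ r ∈ Finset.range j, x ^ (r + 1) / (r + 1) →
    2 ^ N * ∑ r ∈ Finset.range j, x ^ (r + 1) / (r + 1) ≤ acc + j * (d + 2) →
    (lsum N X J i t acc : ℝ) ≤ 2 ^ N * ∑ r ∈ Finset.range J, x ^ (r + 1) / (r + 1) ∧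
    2 ^ N * ∑ r ∈ Finset.range J, x ^ (r + 1) / (r + 1) ≤ lsum N X J i t acc + J * (d + 2) := by
  induction i with
  | zero =>
    intro j t acc hj _ _ _ h1 h2
    obtain rfl : j = J := by omega
    exact ⟨h1, h2⟩
  | succ i ih =>
    intro j t acc hj hj1 ht1 ht2 ha1 ha2
    rw [lsum_succ]
    have hJi : J - i = j + 1 := by omega
    rw [hJi]
    obtain ⟨f1, f2⟩ := floor_bounds (t * X) (2 ^ N) (by positivity)
    set t' := t * X / 2 ^ N with ht'
    push_cast at f1 f2
    obtain ⟨g1, g2⟩ := floor_bounds t' (j + 1) (by positivity)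
    set a' := t' / (j + 1) with ha'
    push_cast at g1 g2
    have hS : (0:ℝ) < 2 ^ N := by positivity
    set S : ℝ := 2 ^ N with hSd
    have hxj : x ^ j ≤ 1 := pow_le_one₀ hx0 hx1
    have hxj0 : 0 ≤ x ^ j := pow_nonneg hx0 j
    have htS : (t:ℝ) ≤ S := ht1.trans (mul_le_of_le_one_left hS.le hxj)
    have ht0 : (0:ℝ) ≤ t := Nat.cast_nonneg t
    have hX0 : (0:ℝ) ≤ X := Nat.cast_nonneg X
    have hj0 : (0:ℝ) < (j:ℝ) + 1 := by positivity
    have t1 : (t':ℝ) ≤ x ^ (j + 1) * S := by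
      have : (t:ℝ) * X ≤ (x ^ j * S) * (x * S) := mul_le_mul ht1 hX hX0 (by positivity)
      refine le_of_mul_le_mul_right ?_ hS
      calc (t':ℝ) * S ≤ t * X := f1
        _ ≤ _ := this
        _ = x ^ (j + 1) * S * S := by ring
    have t2 : x ^ (j + 1) * S ≤ t' + ((j + 1 : ℕ) : ℝ) * (d + 1) := by
      refine le_of_mul_le_mul_right ?_ hS
      have e1 : x ^ (j + 1) * S * S = (x ^ j * S - t) * (x * S) + t * (x * S - X) + t * X := by ring
      have e2 : (x ^ j * S - t) * (x * S) ≤ (j * (d + 1)) * S := by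
        apply mul_le_mul (by linarith) (mul_le_of_le_one_left hS.le hx1) (by positivity) (by positivity)
      have e3 : (t:ℝ) * (x * S - X) ≤ S * d := mul_le_mul htS (by linarith) (by linarith) hS.le
      rw [e1]
      push_cast
      calc _ ≤ (j * (d + 1)) * S + S * d + (t' * S + S) := by linarith
        _ = _ := by ring
    have hsum : S * ∑ r ∈ Finset.range (j + 1), x ^ (r + 1) / (r + 1) =
        S * ∑ r ∈ Finset.range j, x ^ (r + 1) / (r + 1) + x ^ (j + 1) * S / (j + 1) := by
      rw [Finset.sum_range_succ]; ring
    refine ih (j + 1) t' (acc + a') (by omega) (by omega) t1 t2 ?_ ?_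
    · rw [hsum]
      push_cast
      have : (a':ℝ) ≤ x ^ (j + 1) * S / (j + 1) := by
        rw [le_div_iff₀ hj0]; exact g1.trans t1
      linarith
    · rw [hsum]
      push_cast at t2 ⊢
      have : x ^ (j + 1) * S / (j + 1) ≤ a' + 1 + (d + 1) := by
        rw [div_le_iff₀ hj0]; linarith
      linarith

lemma log_spec (N X J : ℕ) (x : ℝ) (hx0 : 0 ≤ x) (hx1 : x ≤ 0.76)
    (hX : (X:ℝ) ≤ x * 2 ^ N) (hX' : x * 2 ^ N ≤ X + 9) (hT : x ^ (J + 1) * 2 ^ N ≤ 1) :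
    |-Real.log (1 - x) * 2 ^ N - lsum N X (Nat.succ J) J X X| ≤ 11 * (J + 1) + 5 := by
  obtain ⟨h1, h2⟩ := lsum_spec N X (J + 1) x 9 hx0 (by linarith) (by norm_num) hX hX' J 1 X X
    (by omega) le_rfl (by simpa using hX) (by rw [pow_one]; push_cast; linarith) (by simp; linarith) (by simp; linarith)
  have h3 := Real.abs_log_sub_add_sum_range_le (x := x) (by rw [abs_of_nonneg hx0]; linarith) (J + 1)
  rw [abs_of_nonneg hx0] at h3
  have hS : (0:ℝ) < 2 ^ N := by positivity
  set S : ℝ := 2 ^ N with hSd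
  have h4 : x ^ (J + 1 + 1) / (1 - x) * S ≤ 5 := by
    rw [div_mul_eq_mul_div, div_le_iff₀ (by linarith)]
    have : x ^ (J + 1 + 1) * S = (x ^ (J + 1) * S) * x := by ring
    rw [this]
    have : (x ^ (J + 1) * S) * x ≤ 1 * x := mul_le_mul_of_nonneg_right hT hx0
    linarith
  have h5 := abs_le.1 (h3)
  have h6 := mul_le_mul_of_nonneg_right h5.1 hS.le
  have h7 := mul_le_mul_of_nonneg_right h5.2 hS.le
  rw [show Nat.succ J = J + 1 from rfl]
  push_cast at h1 h2 ⊢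
  rw [abs_le]
  constructor <;> nlinarith only [h1, h2, h4, h6, h7]

/-- A fixed point approximation to a power. -/
def PwOk (N : ℕ) (y : ℝ) (k pw : ℕ) : Prop := (pw:ℝ) ≤ y ^ k * 2 ^ N ∧ y ^ k * 2 ^ N ≤ pw + 9

lemma pw_step (N Y k pw : ℕ) (y : ℝ) (hy0 : 0 ≤ y) (hy1 : y ≤ 0.76) (hY : (Y:ℝ) ≤ y * 2 ^ N)
    (hY' : y * 2 ^ N ≤ Y + 1) (h : PwOk N y k pw) : PwOk N y (k + 1) (pw * Y / 2 ^ N) := by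
  obtain ⟨h1, h2⟩ := h
  obtain ⟨f1, f2⟩ := floor_bounds (pw * Y) (2 ^ N) (by positivity)
  unfold PwOk
  set t' := pw * Y / 2 ^ N with ht'
  push_cast at f1 f2
  have hS : (0:ℝ) < 2 ^ N := by positivity
  set S : ℝ := 2 ^ N with hSd
  have hxj : y ^ k ≤ 1 := pow_le_one₀ hy0 (by linarith)
  have htS : (pw:ℝ) ≤ S := h1.trans (mul_le_of_le_one_left hS.le hxj)
  have ht0 : (0:ℝ) ≤ pw := Nat.cast_nonneg pw
  have hX0 : (0:ℝ) ≤ Y := Nat.cast_nonneg Y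
  have hyk := pow_nonneg hy0 k
  constructor
  · have : (pw:ℝ) * Y ≤ (y ^ k * S) * (y * S) := mul_le_mul h1 hY hX0 (by positivity)
    refine le_of_mul_le_mul_right ?_ hS
    calc (t':ℝ) * S ≤ pw * Y := f1
      _ ≤ _ := this
      _ = y ^ (k + 1) * S * S := by ring
  · refine le_of_mul_le_mul_right ?_ hS
    have e1 : y ^ (k + 1) * S * S = (y ^ k * S - pw) * (y * S) + pw * (y * S - Y) + pw * Y := by ring
    have e2 : (y ^ k * S - pw) * (y * S) ≤ 9 * (0.76 * S) :=
      mul_le_mul (by linarith) (mul_le_mul_of_nonneg_right hy1 hS.le) (by positivity) (by positivity)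
    have e3 : (pw:ℝ) * (y * S - Y) ≤ S * 1 := mul_le_mul htS (by linarith) (by linarith) hS.le
    rw [e1]
    linarith

lemma fpow_spec (N Y : ℕ) (y : ℝ) (hy0 : 0 ≤ y) (hy1 : y ≤ 0.76) (hY : (Y:ℝ) ≤ y * 2 ^ N)
    (hY' : y * 2 ^ N ≤ Y + 1) (i : ℕ) : ∀ k pw, PwOk N y k pw → PwOk N y (k + i) (fpow N Y i pw) := by
  induction i with
  | zero => intro k pw h; exact h
  | succ i ih =>
    intro k pw h
    rw [fpow_succ, show k + (i + 1) = (k + 1) + i by ring]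
    exact ih _ _ (pw_step N Y k pw y hy0 hy1 hY hY' h)

/-- `x` is a table entry (with offset) for the `k`-th factor, up to `E` units. -/
def Good (N C u F off E : ℕ) (y : ℝ) (k x : ℕ) : Prop :=
  ∃ L : ℕ, |Av y k * 2 ^ N - L| ≤ E ∧ x = (C * L / 2 ^ (N + u - F) + off) % 2 ^ F

lemma good_entry (N C u F off T k pw : ℕ) (y : ℝ) (hy0 : 0 ≤ y) (hy1 : y ≤ 0.76)
    (hT : y ^ T * 2 ^ N ≤ 1) (hk : 1 ≤ k) (h : PwOk N y k pw) :
    Good N C u F off (11 * (T + 1) + 5) y k (entry N C u F off (T / k) pw) := by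
  refine ⟨lsum N pw (Nat.succ (T / k)) (T / k) pw pw, ?_, ?_⟩
  · have hle : y ^ k ≤ 0.76 := (pow_le_of_le_one hy0 (by linarith) (by omega)).trans hy1
    have hT' : (y ^ k) ^ (T / k + 1) * 2 ^ N ≤ 1 := by
      refine le_trans ?_ hT
      refine mul_le_mul_of_nonneg_right ?_ (by positivity)
      rw [← pow_mul]
      refine pow_le_pow_of_le_one hy0 (by linarith) ?_
      have := Nat.lt_mul_div_succ T (show 0 < k by omega)
      omega
    have := log_spec N pw (T / k) (y ^ k) (pow_nonneg hy0 k) hle h.1 h.2 hT'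
    unfold Av
    rw [if_neg (by omega)]
    refine this.trans ?_
    push_cast
    have : ((T / k : ℕ) : ℝ) ≤ T := by exact_mod_cast Nat.div_le_self T k
    linarith
  · unfold entry
    rw [force_eq, ← Nat.shiftRight_eq_div_pow]
    rfl

lemma tbl_spec (N Y C u F off T K : ℕ) (y : ℝ) (hy0 : 0 ≤ y) (hy1 : y ≤ 0.76) (hY : (Y:ℝ) ≤ y * 2 ^ N)
    (hY' : y * 2 ^ N ≤ Y + 1) (hT : y ^ T * 2 ^ N ≤ 1) (i : ℕ) : ∀ k pw acc, PwOk N y k pw → k + i = K →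
    (∀ x ∈ acc, x ∈ tbl N Y C u F off T K i pw acc) ∧
    ∀ k', k < k' → k' ≤ K → ∃ x ∈ tbl N Y C u F off T K i pw acc,
      Good N C u F off (11 * (T + 1) + 5) y k' x := by
  induction i with
  | zero =>
    intro k pw acc _ hk
    exact ⟨fun x hx => hx, fun k' h1 h2 => by omega⟩
  | succ i ih =>
    intro k pw acc h hk
    rw [tbl_succ]
    have h' := pw_step N Y k pw y hy0 hy1 hY hY' h
    have hki : K - i = k + 1 := by omega
    rw [hki]
    have hg := good_entry N C u F off T (k + 1) _ y hy0 hy1 hT (by omega) h'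
    obtain ⟨h1, h2⟩ := ih (k + 1) _ (entry N C u F off (T / (k + 1)) (pw * Y / 2 ^ N) :: acc) h' (by omega)
    refine ⟨fun x hx => h1 x (List.mem_cons_of_mem _ hx), fun k' a b => ?_⟩
    rcases Nat.lt_or_ge (k + 1) k' with hc | hc
    · exact h2 k' hc b
    · obtain rfl : k' = k + 1 := by omega
      exact ⟨_, h1 _ List.mem_cons_self, hg⟩

lemma good_zero (N C u F off E : ℕ) (y : ℝ) : Good N C u F off E y 0 (off % 2 ^ F) :=
  ⟨0, by simp [Av], by simp⟩

lemma pw_zero (N : ℕ) (y : ℝ) : PwOk N y 0 (2 ^ N) := by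
  unfold PwOk; simp

/-- The full table, including the entry for index zero. -/
def table (N Y C u F off T K : ℕ) : List ℕ :=
  tbl N Y C u F off T K K (Nat.pow 2 N) [Nat.mod off (Nat.pow 2 F)]

lemma table_spec (N Y C u F off T K : ℕ) (y : ℝ) (hy0 : 0 ≤ y) (hy1 : y ≤ 0.76) (hY : (Y:ℝ) ≤ y * 2 ^ N)
    (hY' : y * 2 ^ N ≤ Y + 1) (hT : y ^ T * 2 ^ N ≤ 1) (k : ℕ) (hk : k ≤ K) :
    ∃ x ∈ table N Y C u F off T K, Good N C u F off (11 * (T + 1) + 5) y k x := by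
  obtain ⟨h1, h2⟩ := tbl_spec N Y C u F off T K y hy0 hy1 hY hY' hT K 0 (2 ^ N) [off % 2 ^ F]
    (pw_zero N y) (by omega)
  rcases Nat.eq_zero_or_pos k with rfl | h
  · exact ⟨_, h1 _ (List.mem_singleton.2 rfl), good_zero _ _ _ _ _ _ _⟩
  · exact h2 k h hk

/-- A single entry. -/
def single (N Y C u F T k : ℕ) : ℕ :=
  force (fpow N Y k (Nat.pow 2 N)) fun pw => entry N C u F 0 (Nat.div T k) pw

lemma single_spec (N Y C u F T k : ℕ) (y : ℝ) (hy0 : 0 ≤ y) (hy1 : y ≤ 0.76) (hY : (Y:ℝ) ≤ y * 2 ^ N)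
    (hY' : y * 2 ^ N ≤ Y + 1) (hT : y ^ T * 2 ^ N ≤ 1) (hk : 1 ≤ k) :
    Good N C u F 0 (11 * (T + 1) + 5) y k (single N Y C u F T k) := by
  unfold single
  rw [force_eq]
  have h := fpow_spec N Y y hy0 hy1 hY hY' k 0 (2 ^ N) (pw_zero N y)
  rw [zero_add] at h
  exact good_entry N C u F 0 T k _ y hy0 hy1 hT hk h

/-- The logarithm of a single factor in fixed point arithmetic. -/
def slog (N Y T k : ℕ) : ℕ :=
  force (fpow N Y k (Nat.pow 2 N)) fun pw => force (Nat.div T k) fun J => lsum N pw (Nat.succ J) J pw pw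

lemma slog_spec (N Y T k : ℕ) (y : ℝ) (hy0 : 0 ≤ y) (hy1 : y ≤ 0.76) (hY : (Y:ℝ) ≤ y * 2 ^ N)
    (hY' : y * 2 ^ N ≤ Y + 1) (hT : y ^ T * 2 ^ N ≤ 1) (hk : 1 ≤ k) :
    |Av y k * 2 ^ N - slog N Y T k| ≤ ((11 * (T + 1) + 5 : ℕ) : ℝ) := by
  unfold slog
  rw [force_eq, force_eq]
  have h := fpow_spec N Y y hy0 hy1 hY hY' k 0 (2 ^ N) (pw_zero N y)
  rw [zero_add] at h
  have hle : y ^ k ≤ 0.76 := (pow_le_of_le_one hy0 (by linarith) (by omega)).trans hy1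
  have hT' : (y ^ k) ^ (T / k + 1) * 2 ^ N ≤ 1 := by
    refine le_trans ?_ hT
    refine mul_le_mul_of_nonneg_right ?_ (by positivity)
    rw [← pow_mul]
    refine pow_le_pow_of_le_one hy0 (by linarith) ?_
    have := Nat.lt_mul_div_succ T (show 0 < k by omega)
    omega
  have := log_spec N _ (T / k) (y ^ k) (pow_nonneg hy0 k) hle h.1 h.2 hT'
  unfold Av
  rw [if_neg (by omega)]
  refine this.trans ?_
  push_cast
  have : ((T / k : ℕ) : ℝ) ≤ T := by exact_mod_cast Nat.div_le_self T k
  linarith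

/-! ### The separation test -/

/-- Case distinction, with the values for `false` and `true` first. -/
def bsel {α : Type} (a b : α) (c : Bool) : α := Bool.rec a b c

/-- Elements below a bound. -/
def fltLt (b : ℕ) (xs : List ℕ) : List ℕ → List ℕ :=
  List.rec (fun acc => acc) (fun x _ ih acc => bsel (ih acc) (ih (x :: acc)) (Nat.blt x b)) xs

/-- Elements `x` with `b ≤ x + g`. -/
def fltGe (b g : ℕ) (xs : List ℕ) : List ℕ → List ℕ :=
  List.rec (fun acc => acc) (fun x _ ih acc => bsel (ih acc) (ih (x :: acc)) (Nat.ble b (Nat.add x g))) xs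

lemma fltLt_mem (b : ℕ) (xs : List ℕ) : ∀ acc x, (x ∈ acc ∨ (x ∈ xs ∧ x < b)) → x ∈ fltLt b xs acc := by
  induction xs with
  | nil => intro acc x h; rcases h with h | h; exacts [h, absurd h.1 List.not_mem_nil]
  | cons a xs ih =>
    intro acc x h
    change x ∈ Bool.rec (motive := fun _ => List ℕ) (fltLt b xs acc) (fltLt b xs (a :: acc)) (Nat.blt a b)
    cases hb : Nat.blt a b with
    | false =>
      have h' : ¬ a < b := by rw [← Nat.blt_eq, hb]; simp
      refine ih acc x ?_
      rcases h with h | ⟨h1, h2⟩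
      · exact Or.inl h
      · rcases List.mem_cons.1 h1 with rfl | h1
        · exact absurd h2 h'
        · exact Or.inr ⟨h1, h2⟩
    | true =>
      refine ih (a :: acc) x ?_
      rcases h with h | ⟨h1, h2⟩
      · exact Or.inl (List.mem_cons_of_mem _ h)
      · rcases List.mem_cons.1 h1 with rfl | h1
        · exact Or.inl List.mem_cons_self
        · exact Or.inr ⟨h1, h2⟩

lemma fltGe_mem (b g : ℕ) (xs : List ℕ) : ∀ acc x, (x ∈ acc ∨ (x ∈ xs ∧ b ≤ x + g)) → x ∈ fltGe b g xs acc := by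
  induction xs with
  | nil => intro acc x h; rcases h with h | h; exacts [h, absurd h.1 List.not_mem_nil]
  | cons a xs ih =>
    intro acc x h
    change x ∈ Bool.rec (motive := fun _ => List ℕ) (fltGe b g xs acc) (fltGe b g xs (a :: acc)) (Nat.ble b (a + g))
    cases hb : Nat.ble b (a + g) with
    | false =>
      have h' : ¬ b ≤ a + g := by rw [← Nat.ble_eq, hb]; simp
      refine ih acc x ?_
      rcases h with h | ⟨h1, h2⟩
      · exact Or.inl h
      · rcases List.mem_cons.1 h1 with rfl | h1
        · exact absurd h2 h'
        · exact Or.inr ⟨h1, h2⟩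
    | true =>
      refine ih (a :: acc) x ?_
      rcases h with h | ⟨h1, h2⟩
      · exact Or.inl (List.mem_cons_of_mem _ h)
      · rcases List.mem_cons.1 h1 with rfl | h1
        · exact Or.inl List.mem_cons_self
        · exact Or.inr ⟨h1, h2⟩

/-- All elements keep distance `g` from `y`. -/
def farOne (g y : ℕ) (xs : List ℕ) : Bool :=
  List.rec true (fun x _ ih => bsel (bsel false ih (Nat.ble (Nat.add y g) x)) ih (Nat.ble (Nat.add x g) y)) xs

/-- All pairs keep distance `g`. -/
def farAll (g : ℕ) (xs ys : List ℕ) : Bool :=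
  List.rec true (fun y _ ih => bsel false ih (farOne g y xs)) ys

lemma farOne_spec (g y : ℕ) (xs : List ℕ) (h : farOne g y xs = true) :
    ∀ x ∈ xs, x + g ≤ y ∨ y + g ≤ x := by
  induction xs with
  | nil => intro x hx; exact absurd hx List.not_mem_nil
  | cons a xs ih =>
    change Bool.rec (motive := fun _ => Bool) (Bool.rec (motive := fun _ => Bool) false (farOne g y xs) (Nat.ble (y + g) a))
      (farOne g y xs) (Nat.ble (a + g) y) = true at h
    intro x hx
    cases h1 : Nat.ble (a + g) y <;> cases h2 : Nat.ble (y + g) a <;> rw [h1] at h <;>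
      (try rw [h2] at h) <;> simp only [Bool.false_eq_true] at h
    all_goals
      rcases List.mem_cons.1 hx with rfl | hx
      · first
        | exact Or.inl (Nat.le_of_ble_eq_true h1)
        | exact Or.inr (Nat.le_of_ble_eq_true h2)
      · exact ih h x hx

lemma farAll_spec (g : ℕ) (xs ys : List ℕ) (h : farAll g xs ys = true) :
    ∀ x ∈ xs, ∀ y ∈ ys, x + g ≤ y ∨ y + g ≤ x := by
  induction ys with
  | nil => intro x _ y hy; exact absurd hy List.not_mem_nil
  | cons a ys ih =>
    change Bool.rec (motive := fun _ => Bool) false (farAll g xs ys) (farOne g a xs) = true at h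
    cases h1 : farOne g a xs <;> rw [h1] at h
    · exact absurd h (by simp)
    · intro x hx y hy
      rcases List.mem_cons.1 hy with rfl | hy
      · exact farOne_spec g y xs h1 x hx
      · exact ih h x hx y hy

/-- Divide and conquer version of `farAll`. -/
def sep (g : ℕ) (fuel : ℕ) : ℕ → ℕ → List ℕ → List ℕ → Bool :=
  Nat.rec (fun _ _ xs ys => farAll g xs ys)
    (fun _ ih lo w xs ys => List.rec true (fun _ _ _ => List.rec true (fun _ _ _ =>
      force (Nat.add lo w) fun mid => force (Nat.div w 2) fun w' =>
      forceL (fltLt (Nat.add mid g) xs []) fun xs1 => forceL (fltLt mid ys []) fun ys1 =>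
      Bool.rec false
        (forceL (fltGe mid g xs []) fun xs2 => forceL (fltGe mid 0 ys []) fun ys2 => ih mid w' xs2 ys2)
        (ih lo w' xs1 ys1)) xs) ys) fuel

lemma sep_spec (g : ℕ) (fuel : ℕ) : ∀ lo w xs ys, sep g fuel lo w xs ys = true →
    ∀ x ∈ xs, ∀ y ∈ ys, x + g ≤ y ∨ y + g ≤ x := by
  induction fuel with
  | zero => intro lo w xs ys h; exact farAll_spec g xs ys h
  | succ i ih =>
    intro lo w xs ys h x hx y hy
    cases xs with
    | nil => exact absurd hx List.not_mem_nil
    | cons a xs =>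
    cases ys with
    | nil => exact absurd hy List.not_mem_nil
    | cons b ys =>
      have h' : sep g (i + 1) lo w (a :: xs) (b :: ys) =
          force (Nat.add lo w) fun mid => force (Nat.div w 2) fun w' =>
          forceL (fltLt (Nat.add mid g) (a :: xs) []) fun xs1 => forceL (fltLt mid (b :: ys) []) fun ys1 =>
          Bool.rec false
            (forceL (fltGe mid g (a :: xs) []) fun xs2 => forceL (fltGe mid 0 (b :: ys) []) fun ys2 =>
              sep g i mid w' xs2 ys2)
            (sep g i lo w' xs1 ys1) := rfl
      rw [h'] at h
      rw [force_eq, force_eq, forceL_eq, forceL_eq] at h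
      set mid := lo + w
      change Bool.rec (motive := fun _ => Bool) false _ (sep g i lo (w / 2) (fltLt (mid + g) (a :: xs) [])
        (fltLt mid (b :: ys) [])) = true at h
      cases h1 : sep g i lo (w / 2) (fltLt (mid + g) (a :: xs) []) (fltLt mid (b :: ys) [])
      · rw [h1] at h; exact absurd h (by simp)
      · rw [h1] at h
        change forceL _ _ = true at h
        rw [forceL_eq, forceL_eq] at h
        change sep g i mid (w / 2) _ _ = true at h
        by_cases hc : x + g ≤ y ∨ y + g ≤ x
        · exact hc
        · push Not at hc
          rcases Nat.lt_or_ge y mid with hm | hm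
          · exact ih _ _ _ _ h1 x (fltLt_mem _ _ _ _ (Or.inr ⟨hx, by omega⟩)) y
              (fltLt_mem _ _ _ _ (Or.inr ⟨hy, hm⟩))
          · exact ih _ _ _ _ h x (fltGe_mem _ _ _ _ _ (Or.inr ⟨hx, show lo + w ≤ x + g by omega⟩)) y
              (fltGe_mem _ _ _ _ _ (Or.inr ⟨hy, show lo + w ≤ y + 0 by omega⟩))

/-- All elements lie in `[g, B - g]`. -/
def inRange (g B : ℕ) (ys : List ℕ) : Bool :=
  List.rec true (fun y _ ih => bsel false (bsel false ih (Nat.ble (Nat.add y g) B)) (Nat.ble g y)) ys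

lemma inRange_spec (g B : ℕ) (ys : List ℕ) (h : inRange g B ys = true) : ∀ y ∈ ys, g ≤ y ∧ y + g ≤ B := by
  induction ys with
  | nil => intro y hy; exact absurd hy List.not_mem_nil
  | cons a ys ih =>
    change Bool.rec (motive := fun _ => Bool) false (Bool.rec (motive := fun _ => Bool) false (inRange g B ys)
      (Nat.ble (a + g) B)) (Nat.ble g a) = true at h
    cases h1 : Nat.ble g a <;> rw [h1] at h
    · exact absurd h (by simp)
    · cases h2 : Nat.ble (a + g) B <;> rw [h2] at h
      · exact absurd h (by simp)
      · intro y hy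
        rcases List.mem_cons.1 hy with rfl | hy
        · exact ⟨Nat.le_of_ble_eq_true h1, Nat.le_of_ble_eq_true h2⟩
        · exact ih h y hy

/-! ### The reduction step -/

lemma good_real (N C u F off E : ℕ) (y : ℝ) (k x : ℕ) (hF : F ≤ N + u) (hE : 2 * C * E * 2 ^ F ≤ 2 ^ (N + u))
    (h : Good N C u F off E y k x) :
    ∃ z : ℤ, |(C:ℝ) / 2 ^ u * Av y k * 2 ^ F + off - x - 2 ^ F * z| ≤ 2 := by
  obtain ⟨L, h1, h2⟩ := h
  obtain ⟨f1, f2⟩ := floor_bounds (C * L) (2 ^ (N + u - F)) (by positivity)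
  set v := C * L / 2 ^ (N + u - F) with hv
  refine ⟨((v + off) / 2 ^ F : ℕ), ?_⟩
  have hx : (x:ℝ) = v + off - 2 ^ F * ((v + off) / 2 ^ F : ℕ) := by
    have := Nat.mod_add_div (v + off) (2 ^ F)
    rw [← h2] at this
    have h3 : ((x + 2 ^ F * ((v + off) / 2 ^ F) : ℕ) : ℝ) = ((v + off : ℕ) : ℝ) := by rw [this]
    push_cast at h3 ⊢
    linarith
  rw [hx, Int.cast_natCast]
  have hP : (0:ℝ) < 2 ^ (N + u - F) := by positivity
  have hPF : (2:ℝ) ^ (N + u - F) * 2 ^ F = 2 ^ N * 2 ^ u := by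
    rw [← pow_add, ← pow_add]; congr 1; omega
  have hE' : (2:ℝ) * C * E ≤ 2 ^ (N + u - F) := by
    have h4 : ((2 * C * E * 2 ^ F : ℕ) : ℝ) ≤ ((2 ^ (N + u) : ℕ) : ℝ) := by exact_mod_cast hE
    push_cast at h4
    rw [pow_add, ← hPF] at h4
    exact le_of_mul_le_mul_right h4 (by positivity)
  push_cast at f1 f2
  set P : ℝ := 2 ^ (N + u - F) with hPd
  have e1 : (C:ℝ) / 2 ^ u * Av y k * 2 ^ F = C * (Av y k * 2 ^ N) / P := by
    rw [div_mul_eq_mul_div, div_mul_eq_mul_div, div_eq_div_iff (by positivity) hP.ne']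
    linear_combination (C:ℝ) * Av y k * hPF
  have e2 : |(C:ℝ) * (Av y k * 2 ^ N) - C * L| ≤ C * E := by
    rw [← mul_sub, abs_mul, abs_of_nonneg (Nat.cast_nonneg C)]
    exact mul_le_mul_of_nonneg_left h1 (Nat.cast_nonneg C)
  rw [abs_le] at e2
  have e3 : (C:ℝ) / 2 ^ u * Av y k * 2 ^ F + off - (v + off - 2 ^ F * (((v + off) / 2 ^ F : ℕ):ℝ)) -
      2 ^ F * (((v + off) / 2 ^ F : ℕ) : ℝ) = C * (Av y k * 2 ^ N) / P - v := by
    rw [e1]; ring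
  rw [e3, abs_le]
  constructor
  · rw [le_sub_iff_add_le, le_div_iff₀ hP]; linarith
  · rw [sub_le_iff_le_add, div_le_iff₀ hP]; linarith

lemma Av_pos_eq (y : ℝ) (k : ℕ) (hk : k ≠ 0) : Av y k = -Real.log (1 - y ^ k) := if_neg hk

lemma log_gd (k : ℕ) : Real.log (gd k) = - Av plas⁻¹ k := by
  unfold gd Av
  split_ifs
  · simp
  · rw [inv_pow, neg_neg]

lemma log_gp (k : ℕ) : Real.log (gp k) = - Av Real.goldenRatio⁻¹ k := by
  unfold gp Av
  split_ifs
  · simp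
  · rw [inv_pow, neg_neg]

lemma log_plas_Av : Real.log plas = Av plas⁻¹ 5 := by
  rw [Av_pos_eq _ _ (by norm_num)]
  have : 1 - plas⁻¹ ^ 5 = plas⁻¹ := by
    rw [plas_inv]
    have h := plas_cube
    grind
  rw [this, Real.log_inv, neg_neg]

lemma log_gold_Av : Real.log Real.goldenRatio = Av Real.goldenRatio⁻¹ 2 := by
  rw [Av_pos_eq _ _ (by norm_num)]
  have : 1 - Real.goldenRatio⁻¹ ^ 2 = Real.goldenRatio⁻¹ := by
    rw [gold_inv]
    have h := Real.goldenRatio_sq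
    grind
  rw [this, Real.log_inv, neg_neg]

lemma log_sq5 : Real.log (2 * Real.goldenRatio - 1) =
    2 * Real.log Real.goldenRatio - Av Real.goldenRatio⁻¹ 4 := by
  rw [Av_pos_eq _ _ (by norm_num)]
  have hg := Real.goldenRatio_pos
  have h1 : 2 * Real.goldenRatio - 1 = Real.goldenRatio ^ 2 * (1 - Real.goldenRatio⁻¹ ^ 4) := by
    rw [gold_inv]
    have h := Real.goldenRatio_sq
    grind
  have h2 : 1 - Real.goldenRatio⁻¹ ^ 4 ≠ 0 := by
    intro h
    rw [h, mul_zero] at h1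
    linarith [sq5_pos]
  rw [h1, Real.log_mul (by positivity) h2, Real.log_pow]
  push_cast
  ring

lemma log_D : Real.log (3 * plas ^ 2 - 1) = 5 * Real.log plas + Av plas⁻¹ 11 - Av plas⁻¹ 22 := by
  rw [Av_pos_eq _ _ (by norm_num), Av_pos_eq _ _ (by norm_num)]
  have hp := plas_pos
  have h1 : (3 * plas ^ 2 - 1) * (1 - plas⁻¹ ^ 11) = plas ^ 5 * (1 - plas⁻¹ ^ 22) := by
    have h := plas_cube
    have h0 : 3 * plas ^ 2 - 1 = plas ^ 5 * (1 + plas⁻¹ ^ 11) := by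
      have h5 : plas ^ 6 * (3 * plas ^ 2 - 1) = plas ^ 11 + 1 := by grind
      have h6 : plas ^ 6 ≠ 0 := by positivity
      apply mul_left_cancel₀ h6
      rw [h5]
      field_simp
    rw [h0]; ring
  have hi : plas⁻¹ < 1 := inv_lt_one_of_one_lt₀ (by linarith [plas_gt])
  have hi0 : 0 ≤ plas⁻¹ := by positivity
  have h2 : 0 < 1 - plas⁻¹ ^ 11 := by linarith [pow_lt_one₀ hi0 hi (show 11 ≠ 0 by norm_num)]
  have h3 : 0 < 1 - plas⁻¹ ^ 22 := by linarith [pow_lt_one₀ hi0 hi (show 22 ≠ 0 by norm_num)]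
  have h4 := congrArg Real.log h1
  rw [Real.log_mul D_pos.ne' h2.ne', Real.log_mul (by positivity) h3.ne', Real.log_pow] at h4
  push_cast at h4
  linarith

lemma Lam_decomp (k l m n : ℕ) : Lam k l m n = ((m:ℝ) - 1) * Av plas⁻¹ 5 - ((n:ℝ) - 2) * Av Real.goldenRatio⁻¹ 2
    - Av Real.goldenRatio⁻¹ 4 - Av plas⁻¹ 11 + Av plas⁻¹ 22 - Av plas⁻¹ k + Av Real.goldenRatio⁻¹ l := by
  have h1 := gd_pos k
  have h2 := gp_pos l
  have h3 := D_pos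
  have h4 := sq5_pos
  have h5 := plas_pos
  unfold Lam gam
  rw [Real.log_div (by positivity) (by positivity), Real.log_mul (by positivity) (by positivity),
    Real.log_mul (by positivity) (by positivity), Real.log_mul (by positivity) (by positivity),
    log_gd, log_gp, log_D, log_sq5, Real.log_pow, log_plas_Av, log_gold_Av]
  push_cast
  ring

/-- The separation test for a given multiplier. -/
def sepTest (N Y G TA TB C u F s g fuel K L : ℕ) : Bool :=
  force (Nat.add (Nat.add s (single N G C u F TB 4)) (Nat.add (single N Y C u F TA 11)
    (Nat.sub (Nat.pow 2 F) (single N Y C u F TA 22)))) fun off =>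
  forceL (table N G C u F s TB L) fun ys =>
  Bool.rec false
    (forceL (table N Y C u F off TA K) fun xs => sep g fuel 0 (Nat.pow 2 (Nat.sub F 1)) xs ys)
    (inRange g (Nat.pow 2 F) ys)

/-- The fixed point data approximate the two reciprocals. -/
def baseTest (N Y G : ℕ) : Bool :=
  Nat.ble (Y ^ 3 + Y ^ 2 * 2 ^ N) (2 ^ N * 2 ^ N * 2 ^ N) &&
  Nat.ble (2 ^ N * 2 ^ N * 2 ^ N) ((Y + 1) ^ 3 + (Y + 1) ^ 2 * 2 ^ N) &&
  Nat.ble (G ^ 2 + G * 2 ^ N) (2 ^ N * 2 ^ N) &&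
  Nat.ble (2 ^ N * 2 ^ N) ((G + 1) ^ 2 + (G + 1) * 2 ^ N)

lemma plas_inv_eq : plas⁻¹ ^ 3 + plas⁻¹ ^ 2 = 1 := by
  rw [plas_inv]
  have h := plas_cube
  grind

lemma gold_inv_eq : Real.goldenRatio⁻¹ ^ 2 + Real.goldenRatio⁻¹ = 1 := by
  rw [gold_inv]
  have h := Real.goldenRatio_sq
  grind

lemma base_spec (N Y G : ℕ) (h : baseTest N Y G = true) :
    ((Y:ℝ) ≤ plas⁻¹ * 2 ^ N ∧ plas⁻¹ * 2 ^ N ≤ Y + 1) ∧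
    ((G:ℝ) ≤ Real.goldenRatio⁻¹ * 2 ^ N ∧ Real.goldenRatio⁻¹ * 2 ^ N ≤ G + 1) := by
  unfold baseTest at h
  simp only [Bool.and_eq_true, Nat.ble_eq] at h
  obtain ⟨⟨⟨h1, h2⟩, h3⟩, h4⟩ := h
  have h1' : (Y:ℝ) ^ 3 + Y ^ 2 * 2 ^ N ≤ 2 ^ N * 2 ^ N * 2 ^ N := by exact_mod_cast h1
  have h2' : (2:ℝ) ^ N * 2 ^ N * 2 ^ N ≤ (Y + 1) ^ 3 + (Y + 1) ^ 2 * 2 ^ N := by exact_mod_cast h2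
  have h3' : (G:ℝ) ^ 2 + G * 2 ^ N ≤ 2 ^ N * 2 ^ N := by exact_mod_cast h3
  have h4' : (2:ℝ) ^ N * 2 ^ N ≤ (G + 1) ^ 2 + (G + 1) * 2 ^ N := by exact_mod_cast h4
  have hS : (0:ℝ) < 2 ^ N := by positivity
  set S : ℝ := 2 ^ N with hSd
  have hp := plas_inv_eq
  have hg := gold_inv_eq
  have hp0 : 0 < plas⁻¹ := by have := plas_pos; positivity
  have hg0 : 0 < Real.goldenRatio⁻¹ := by have := Real.goldenRatio_pos; positivity
  set a := plas⁻¹ with had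
  set b := Real.goldenRatio⁻¹ with hbd
  have mono3 : ∀ x y : ℝ, 0 ≤ x → x < y → x ^ 3 + x ^ 2 * S < y ^ 3 + y ^ 2 * S := by
    intro x y hx hxy
    have e1 : x ^ 3 < y ^ 3 := pow_lt_pow_left₀ hxy hx (by norm_num)
    have e2 : x ^ 2 < y ^ 2 := pow_lt_pow_left₀ hxy hx (by norm_num)
    have := mul_lt_mul_of_pos_right e2 hS
    linarith
  have mono2 : ∀ x y : ℝ, 0 ≤ x → x < y → x ^ 2 + x * S < y ^ 2 + y * S := by
    intro x y hx hxy
    have e2 : x ^ 2 < y ^ 2 := pow_lt_pow_left₀ hxy hx (by norm_num)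
    have := mul_lt_mul_of_pos_right hxy hS
    linarith
  have ea : (a * S) ^ 3 + (a * S) ^ 2 * S = S * S * S := by linear_combination S ^ 3 * hp
  have eb : (b * S) ^ 2 + (b * S) * S = S * S := by linear_combination S ^ 2 * hg
  refine ⟨⟨?_, ?_⟩, ⟨?_, ?_⟩⟩
  · by_contra hc
    push Not at hc
    have := mono3 _ _ (by positivity) hc
    linarith
  · by_contra hc
    push Not at hc
    have := mono3 _ _ (by positivity) hc
    linarith
  · by_contra hc
    push Not at hc
    have := mono2 _ _ (by positivity) hc
    linarith
  · by_contra hc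
    push Not at hc
    have := mono2 _ _ (by positivity) hc
    linarith

lemma plas_five : 4 < plas ^ 5 := by
  have : (1.3247:ℝ) ^ 5 < plas ^ 5 := pow_lt_pow_left₀ plas_gt (by norm_num) (by norm_num)
  norm_num at this
  linarith

lemma gold_three : 4 < Real.goldenRatio ^ 3 := by
  have : (1.618:ℝ) ^ 3 < Real.goldenRatio ^ 3 := pow_lt_pow_left₀ gold_gt (by norm_num) (by norm_num)
  norm_num at this
  linarith

lemma plas_tail (N T : ℕ) (h : 5 * N ≤ 2 * T) : plas⁻¹ ^ T * 2 ^ N ≤ 1 := by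
  have hp := plas_pos
  have h1 : (2:ℝ) ^ N ≤ plas ^ T := by
    refine le_of_sq_le_sq ?_ (by positivity)
    calc ((2:ℝ) ^ N) ^ 2 = 4 ^ N := by rw [← pow_mul, mul_comm, pow_mul]; norm_num
      _ ≤ (plas ^ 5) ^ N := pow_le_pow_left₀ (by norm_num) plas_five.le N
      _ = plas ^ (5 * N) := by rw [pow_mul]
      _ ≤ plas ^ (2 * T) := pow_le_pow_right₀ (by linarith [plas_gt]) h
      _ = (plas ^ T) ^ 2 := by rw [← pow_mul, mul_comm]
  rw [inv_pow, inv_mul_le_iff₀ (by positivity)]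
  linarith

lemma gold_tail (N T : ℕ) (h : 3 * N ≤ 2 * T) : Real.goldenRatio⁻¹ ^ T * 2 ^ N ≤ 1 := by
  have hp := Real.goldenRatio_pos
  have h1 : (2:ℝ) ^ N ≤ Real.goldenRatio ^ T := by
    refine le_of_sq_le_sq ?_ (by positivity)
    calc ((2:ℝ) ^ N) ^ 2 = 4 ^ N := by rw [← pow_mul, mul_comm, pow_mul]; norm_num
      _ ≤ (Real.goldenRatio ^ 3) ^ N := pow_le_pow_left₀ (by norm_num) gold_three.le N
      _ = Real.goldenRatio ^ (3 * N) := by rw [pow_mul]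
      _ ≤ Real.goldenRatio ^ (2 * T) := pow_le_pow_right₀ (by linarith [gold_gt]) h
      _ = (Real.goldenRatio ^ T) ^ 2 := by rw [← pow_mul, mul_comm]
  rw [inv_pow, inv_mul_le_iff₀ (by positivity)]
  linarith

lemma plas_inv_bd : 0 ≤ plas⁻¹ ∧ plas⁻¹ ≤ 0.76 := by
  have hp := plas_pos
  refine ⟨by positivity, ?_⟩
  rw [inv_le_comm₀ hp (by norm_num)]
  have := plas_gt
  norm_num at this ⊢
  linarith

lemma gold_inv_bd : 0 ≤ Real.goldenRatio⁻¹ ∧ Real.goldenRatio⁻¹ ≤ 0.76 := by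
  have hp := Real.goldenRatio_pos
  refine ⟨by positivity, ?_⟩
  rw [inv_le_comm₀ hp (by norm_num)]
  have := gold_gt
  norm_num at this ⊢
  linarith

/-- `C / 2 ^ u` times a logarithm is close to the integer `p`. -/
def precTest (N C u h p L E : ℕ) : Bool :=
  Nat.ble (C * (L + E)) (p * 2 ^ (u + N) + 2 ^ (u + N - h)) &&
  Nat.ble (p * 2 ^ (u + N) + C * E) (C * L + 2 ^ (u + N - h))

lemma prec_spec (N C u h p L E : ℕ) (A : ℝ) (hh : h ≤ u + N) (hA : |A * 2 ^ N - L| ≤ (E:ℝ))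
    (ht : precTest N C u h p L E = true) : |(C:ℝ) / 2 ^ u * A - p| * 2 ^ h ≤ 1 := by
  unfold precTest at ht
  simp only [Bool.and_eq_true, Nat.ble_eq] at ht
  obtain ⟨h1, h2⟩ := ht
  have h1' : (C:ℝ) * (L + E) ≤ p * 2 ^ (u + N) + 2 ^ (u + N - h) := by exact_mod_cast h1
  have h2' : (p:ℝ) * 2 ^ (u + N) + C * E ≤ C * L + 2 ^ (u + N - h) := by exact_mod_cast h2
  have hP : (0:ℝ) < 2 ^ (u + N - h) := by positivity
  have hPF : (2:ℝ) ^ (u + N - h) * 2 ^ h = 2 ^ (u + N) := by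
    rw [← pow_add]; congr 1; omega
  have hC : (0:ℝ) ≤ C := Nat.cast_nonneg C
  rw [abs_le] at hA
  have a1 := mul_le_mul_of_nonneg_left hA.1 hC
  have a2 := mul_le_mul_of_nonneg_left hA.2 hC
  have key : |(C:ℝ) * (A * 2 ^ N) - p * 2 ^ (u + N)| ≤ 2 ^ (u + N - h) := by
    rw [abs_le]; constructor <;> linarith
  have e : (C:ℝ) * (A * 2 ^ N) - p * 2 ^ (u + N) = ((C:ℝ) / 2 ^ u * A - p) * 2 ^ (u + N) := by
    rw [pow_add]; field_simp
  rw [e, abs_mul, abs_of_pos (show (0:ℝ) < 2 ^ (u + N) by positivity), ← hPF] at key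
  refine le_of_mul_le_mul_right ?_ hP
  linarith

lemma sub_abs_le (m e : ℕ) (r : ℝ) (hr : 0 ≤ r) (hr2 : r ≤ 2) (he : 1 ≤ e) (hm : m < 2 ^ e) : |(m:ℝ) - r| ≤ 2 ^ e := by
  have h1 : (m:ℝ) ≤ 2 ^ e := by exact_mod_cast hm.le
  have h2 : (2:ℝ) ≤ 2 ^ e := by
    calc (2:ℝ) = 2 ^ 1 := by norm_num
      _ ≤ _ := pow_le_pow_right₀ (by norm_num) he
  have h3 : (0:ℝ) ≤ m := Nat.cast_nonneg m
  rw [abs_le]; constructor <;> linarith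

lemma far_mod (x y g B : ℕ) (z : ℤ) (hx : x < B) (hy : g ≤ y ∧ y + g ≤ B) (h : x + g ≤ y ∨ y + g ≤ x) :
    (g:ℝ) ≤ |(y:ℝ) - x - B * z| := by
  have key : (g:ℤ) ≤ |(y:ℤ) - x - B * z| := by
    rcases lt_trichotomy z 0 with hz | hz | hz
    · have : (B:ℤ) * z ≤ B * (-1) := mul_le_mul_of_nonneg_left (by omega) (by omega)
      exact le_trans (by omega) (le_abs_self _)
    · subst hz
      rcases h with h | h
      · exact le_trans (by omega) (le_abs_self _)
      · exact le_trans (by omega) (neg_le_abs _)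
    · have : (B:ℤ) * 1 ≤ B * z := mul_le_mul_of_nonneg_left (by omega) (by omega)
      exact le_trans (by omega) (neg_le_abs _)
  exact_mod_cast key

lemma good_lt (N C u F off E : ℕ) (y : ℝ) (k x : ℕ) (h : Good N C u F off E y k x) : x < 2 ^ F := by
  obtain ⟨L, _, h2⟩ := h
  rw [h2]
  exact Nat.mod_lt _ (by positivity)

set_option maxHeartbeats 1000000 in
theorem reduce (N0 Y0 G0 TA TB C u F s gb fuel K L N1 Y1 G1 TA1 TB1 p q h e cb U : ℕ)
    (hb0 : baseTest N0 Y0 G0 = true) (hb1 : baseTest N1 Y1 G1 = true)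
    (hTA : 5 * N0 ≤ 2 * TA) (hTB : 3 * N0 ≤ 2 * TB) (hTA1 : 5 * N1 ≤ 2 * TA1) (hTB1 : 3 * N1 ≤ 2 * TB1)
    (hF : F ≤ N0 + u) (hEA : 2 * C * (11 * (TA + 1) + 5) * 2 ^ F ≤ 2 ^ (N0 + u))
    (hEB : 2 * C * (11 * (TB + 1) + 5) * 2 ^ F ≤ 2 ^ (N0 + u))
    (hh : h ≤ u + N1) (hhF : h ≤ F + 2 + e) (he : 1 ≤ e)
    (hg : 20 + 2 ^ (F + 2 + e - h) ≤ 2 ^ gb) (hU : U + gb = cb + F + 1) (hC : C ≤ 2 ^ (u + cb))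
    (hp : precTest N1 C u h p (slog N1 Y1 TA1 5) (11 * (TA1 + 1) + 5) = true)
    (hq : precTest N1 C u h q (slog N1 G1 TB1 2) (11 * (TB1 + 1) + 5) = true)
    (hs : sepTest N0 Y0 G0 TA TB C u F s (2 ^ gb) fuel K L = true)
    (k l m n : ℕ) (hk : k ≤ K) (hl : l ≤ L) (hm : m < 2 ^ e) (hn : n < 2 ^ e) :
    1 ≤ |Lam k l m n| * 2 ^ U := by
  obtain ⟨⟨y1, y2⟩, ⟨g1, g2⟩⟩ := base_spec _ _ _ hb0
  obtain ⟨⟨y3, y4⟩, ⟨g3, g4⟩⟩ := base_spec _ _ _ hb1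
  obtain ⟨pa, pb⟩ := plas_inv_bd
  obtain ⟨ga, gb'⟩ := gold_inv_bd
  have tA := plas_tail N0 TA hTA
  have tB := gold_tail N0 TB hTB
  have P := prec_spec N1 C u h p _ _ (Av plas⁻¹ 5) hh
    (slog_spec N1 Y1 TA1 5 plas⁻¹ pa pb y3 y4 (plas_tail N1 TA1 hTA1) (by norm_num)) hp
  have Q := prec_spec N1 C u h q _ _ (Av Real.goldenRatio⁻¹ 2) hh
    (slog_spec N1 G1 TB1 2 Real.goldenRatio⁻¹ ga gb' g3 g4 (gold_tail N1 TB1 hTB1) (by norm_num)) hq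
  unfold sepTest at hs
  rw [force_eq, forceL_eq] at hs
  have s4 := single_spec N0 G0 C u F TB 4 Real.goldenRatio⁻¹ ga gb' g1 g2 tB (by norm_num)
  have s11 := single_spec N0 Y0 C u F TA 11 plas⁻¹ pa pb y1 y2 tA (by norm_num)
  have s22 := single_spec N0 Y0 C u F TA 22 plas⁻¹ pa pb y1 y2 tA (by norm_num)
  set x4 := single N0 G0 C u F TB 4
  set x11 := single N0 Y0 C u F TA 11
  set x22 := single N0 Y0 C u F TA 22
  change Bool.rec (motive := fun _ => Bool) false (forceL (table N0 Y0 C u F (s + x4 + (x11 + (2 ^ F - x22))) TA K)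
    fun xs => sep (2 ^ gb) fuel 0 (2 ^ (F - 1)) xs (table N0 G0 C u F s TB L))
    (inRange (2 ^ gb) (2 ^ F) (table N0 G0 C u F s TB L)) = true at hs
  cases hr : inRange (2 ^ gb) (2 ^ F) (table N0 G0 C u F s TB L)
  · rw [hr] at hs; exact absurd hs (by simp)
  rw [hr] at hs
  change forceL _ _ = true at hs
  rw [forceL_eq] at hs
  set off := s + x4 + (x11 + (2 ^ F - x22)) with hoff
  obtain ⟨y, hy, gy⟩ := table_spec N0 G0 C u F s TB L Real.goldenRatio⁻¹ ga gb' g1 g2 tB l hl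
  obtain ⟨x, hx, gx⟩ := table_spec N0 Y0 C u F off TA K plas⁻¹ pa pb y1 y2 tA k hk
  have hsep := sep_spec _ _ _ _ _ _ hs x hx y hy
  have hran := inRange_spec _ _ _ hr y hy
  have hxlt := good_lt _ _ _ _ _ _ _ _ _ gx
  have h22 := good_lt _ _ _ _ _ _ _ _ _ s22
  obtain ⟨z4, r4⟩ := good_real _ _ _ _ _ _ _ _ _ hF hEB s4
  obtain ⟨z11, r11⟩ := good_real _ _ _ _ _ _ _ _ _ hF hEA s11
  obtain ⟨z22, r22⟩ := good_real _ _ _ _ _ _ _ _ _ hF hEA s22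
  obtain ⟨zy, ry⟩ := good_real _ _ _ _ _ _ _ _ _ hF hEB gy
  obtain ⟨zx, rx⟩ := good_real _ _ _ _ _ _ _ _ _ hF hEA gx
  have hoffR : (off:ℝ) = s + x4 + (x11 + (2 ^ F - x22)) := by
    rw [hoff]; push_cast [Nat.cast_sub h22.le]; ring
  set c : ℝ := (C:ℝ) / 2 ^ u with hc
  have hm' := sub_abs_le m e 1 (by norm_num) (by norm_num) he hm
  have hn' := sub_abs_le n e 2 (by norm_num) (by norm_num) he hn
  -- error in the integer parts
  have hS : (0:ℝ) < 2 ^ F := by positivity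
  have hpow : (2:ℝ) ^ (F + 2 + e - h) * 2 ^ h = 2 ^ F * 4 * 2 ^ e := by
    rw [← pow_add, Nat.sub_add_cancel hhF, pow_add, pow_add]; norm_num
  have hhp : (0:ℝ) < 2 ^ h := by positivity
  have errs : ∀ w v : ℝ, |w| * 2 ^ h ≤ 1 → |v| ≤ 2 ^ e → |v * w * 2 ^ F| ≤ 2 ^ (F + 2 + e - h) / 4 := by
    intro w v hw hv
    rw [abs_mul, abs_mul, abs_of_pos hS]
    refine le_of_mul_le_mul_right ?_ hhp
    calc |v| * |w| * 2 ^ F * 2 ^ h = |v| * (|w| * 2 ^ h) * 2 ^ F := by ring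
      _ ≤ 2 ^ e * 1 * 2 ^ F := by gcongr
      _ = 2 ^ (F + 2 + e - h) * 2 ^ h / 4 := by rw [hpow]; ring
      _ = _ := by ring
  have ep := errs _ _ P hm'
  have eq := errs _ _ Q hn'
  set Z : ℤ := -((m:ℤ) - 1) * p + ((n:ℤ) - 2) * q - 1 + z4 + z11 - z22 + zx - zy with hZ
  have hfar := far_mod x y (2 ^ gb) (2 ^ F) Z hxlt hran hsep
  push_cast at hfar
  have hgR : (20:ℝ) + 2 ^ (F + 2 + e - h) ≤ 2 ^ gb := by exact_mod_cast hg
  have hid : c * Lam k l m n * 2 ^ F = ((y:ℝ) - x - 2 ^ F * Z) + ((m:ℝ) - 1) * (c * Av plas⁻¹ 5 - p) * 2 ^ F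
      - ((n:ℝ) - 2) * (c * Av Real.goldenRatio⁻¹ 2 - q) * 2 ^ F - (c * Av Real.goldenRatio⁻¹ 4 * 2 ^ F + (0:ℕ) - x4 - 2 ^ F * z4)
      - (c * Av plas⁻¹ 11 * 2 ^ F + (0:ℕ) - x11 - 2 ^ F * z11)
      + (c * Av plas⁻¹ 22 * 2 ^ F + (0:ℕ) - x22 - 2 ^ F * z22)
      - (c * Av plas⁻¹ k * 2 ^ F + off - x - 2 ^ F * zx)
      + (c * Av Real.goldenRatio⁻¹ l * 2 ^ F + s - y - 2 ^ F * zy) := by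
    rw [Lam_decomp, hoffR, hZ]
    push_cast
    ring
  have hlow : (2:ℝ) ^ gb / 2 ≤ |c * Lam k l m n * 2 ^ F| := by
    have k1 := abs_le.1 ep
    have k2 := abs_le.1 eq
    have k3 := abs_le.1 r4
    have k4 := abs_le.1 r11
    have k5 := abs_le.1 r22
    have k6 := abs_le.1 rx
    have k7 := abs_le.1 ry
    have hd : |c * Lam k l m n * 2 ^ F - ((y:ℝ) - x - 2 ^ F * Z)| ≤ 2 ^ gb / 2 := by
      rw [hid, abs_le]
      constructor <;> linarith [k1.1, k1.2, k2.1, k2.2, k3.1, k3.2, k4.1, k4.2, k5.1, k5.2, k6.1, k6.2, k7.1, k7.2]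
    have tri := abs_sub_abs_le_abs_sub ((y:ℝ) - x - 2 ^ F * Z) (c * Lam k l m n * 2 ^ F)
    rw [abs_sub_comm ((y:ℝ) - x - 2 ^ F * Z)] at tri
    linarith
  have hc0 : 0 ≤ c := by positivity
  have hcle : c ≤ 2 ^ cb := by
    rw [hc, div_le_iff₀ (by positivity), ← pow_add, add_comm]
    exact_mod_cast hC
  rw [abs_mul, abs_mul, abs_of_nonneg hc0, abs_of_pos hS] at hlow
  have hfin : (2:ℝ) ^ gb / 2 ≤ 2 ^ cb * |Lam k l m n| * 2 ^ F := by
    refine hlow.trans ?_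
    gcongr
  have hgp : (0:ℝ) < 2 ^ gb := by positivity
  refine le_of_mul_le_mul_right ?_ hgp
  have : |Lam k l m n| * 2 ^ U * 2 ^ gb = 2 * (2 ^ cb * |Lam k l m n| * 2 ^ F) := by
    rw [mul_assoc, ← pow_add, hU, pow_succ, pow_add]; ring
  rw [this]
  linarith

lemma plas_exp2 (k a : ℕ) (h : plas ^ k ≤ 2 ^ a) : 2 * k ≤ 5 * a := by
  by_contra hc
  push Not at hc
  have hp := plas_pos
  have h1 : (4:ℝ) ^ a * 1 < (2 ^ a) ^ 2 := by
    calc (4:ℝ) ^ a * 1 ≤ (plas ^ 5) ^ a * 1 :=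
          mul_le_mul_of_nonneg_right (pow_le_pow_left₀ (by norm_num) plas_five.le a) (by norm_num)
      _ = plas ^ (5 * a) := by rw [pow_mul, mul_one]
      _ < plas ^ (2 * k) := pow_lt_pow_right₀ (by linarith [plas_gt]) hc
      _ = (plas ^ k) ^ 2 := by rw [← pow_mul, mul_comm]
      _ ≤ (2 ^ a) ^ 2 := pow_le_pow_left₀ (by positivity) h 2
  rw [← pow_mul, mul_comm a 2, pow_mul] at h1
  norm_num at h1

lemma gold_exp2 (k a : ℕ) (h : Real.goldenRatio ^ k ≤ 2 ^ a) : 2 * k ≤ 3 * a := by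
  by_contra hc
  push Not at hc
  have hp := Real.goldenRatio_pos
  have h1 : (4:ℝ) ^ a * 1 < (2 ^ a) ^ 2 := by
    calc (4:ℝ) ^ a * 1 ≤ (Real.goldenRatio ^ 3) ^ a * 1 :=
          mul_le_mul_of_nonneg_right (pow_le_pow_left₀ (by norm_num) gold_three.le a) (by norm_num)
      _ = Real.goldenRatio ^ (3 * a) := by rw [pow_mul, mul_one]
      _ < Real.goldenRatio ^ (2 * k) := pow_lt_pow_right₀ (by linarith [gold_gt]) hc
      _ = (Real.goldenRatio ^ k) ^ 2 := by rw [← pow_mul, mul_comm]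
      _ ≤ (2 ^ a) ^ 2 := pow_le_pow_left₀ (by positivity) h 2
  rw [← pow_mul, mul_comm a 2, pow_mul] at h1
  norm_num at h1

theorem reduce_sol (k l m n K L U : ℕ) (hs : Sol k l m n) (hK : 5 * (U + 5) ≤ 2 * K + 1)
    (hL : 3 * (U + 5) ≤ 2 * L + 1)
    (hred : ∀ k' l', k' ≤ K → l' ≤ L → 1 ≤ |Lam k' l' m n| * 2 ^ U) :
    2 * n ≤ 3 * (U + 5) ∧ 2 * m ≤ 5 * (U + 7) := by
  have hp := plas_pos
  have hg := Real.goldenRatio_pos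
  have one_le : (1:ℝ) ≤ 2 ^ U := one_le_pow₀ (by norm_num)
  have s1 : l ≤ L ∨ k ≤ K := by
    have h0 := hred 0 0 (by omega) (by omega)
    have h1 := one_le_of_exp _ _ _ hs.E one_le h0
    have h2 : (1:ℝ) ≤ 2 * ((10:ℕ) * (Real.goldenRatio ^ l)⁻¹) * 2 ^ U ∨
        (1:ℝ) ≤ 2 * ((14:ℕ) * (plas ^ k)⁻¹) * 2 ^ U := by
      by_contra hc
      push Not at hc
      push_cast at hc
      linarith [hc.1, hc.2]
    rcases h2 with h2 | h2
    · left
      have := gold_exp2 _ _ (inv_le_help _ 10 5 U (by positivity) (by norm_num) h2)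
      omega
    · right
      have := plas_exp2 _ _ (inv_le_help _ 14 5 U (by positivity) (by norm_num) h2)
      omega
  have s2 : l ≤ L ∧ k ≤ K := by
    rcases s1 with s1 | s1
    · have h0 := hred 0 l (by omega) s1
      rw [← abs_neg] at h0
      have h1 := one_le_of_exp _ _ _ hs.C one_le h0
      have := plas_exp2 _ _ (inv_le_help _ 4 5 U (by positivity) (by norm_num) (by exact_mod_cast h1))
      omega
    · have h0 := hred k 0 s1 (by omega)
      have h1 := one_le_of_exp _ _ _ hs.B one_le h0
      have := gold_exp2 _ _ (inv_le_help _ 5 5 U (by positivity) (by norm_num) (by exact_mod_cast h1))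
      omega
  have h0 := hred k l s2.2 s2.1
  have h1 := one_le_of_exp _ _ _ hs.A one_le h0
  have h2 := inv_le_help (Real.goldenRatio ^ n) 10 5 U (by positivity) (by norm_num) (by exact_mod_cast h1)
  refine ⟨gold_exp2 _ _ h2, plas_exp2 _ _ (hs.R.trans ?_)⟩
  rw [show U + 7 = U + 5 + 2 by ring, pow_add _ (U + 5)]
  linarith

/-! ### The numerical data of the first reduction -/

/-- `2 ^ 8250` divided by the plastic number. -/
def cYb : ℕ :=
  2373235326787968925214290823626651875847484543337324933323307152367218283867202442404652085998920558534508485041409795496931547370437014172789585171162569023588399115111776283508864253777203905869299879636119544449724730898300891368637799327272418112541460233982788307741133967389250743649878061592941055436290332978645076139746081217608599212319537522319348390132430070711159157931358568837596472227024625821218500679987819802700181590622487472554618420326995111007442059211794326240710735021519211727351623260012773155490082905550088555156487075691132013316648880683349587433976439103889108237232813419885145561535885746965083737864523963979675566021780588260939099453645914523251650677138993644206217976305158218427205262664023637345071167139872725392377409753313872262488969818367956027949605262969730840002274128858117591344850461283593862110962959337676456019305440937044584758108456064783724204326444625024847295406907998700730553341691396310163701487914217801528983904675974325518876487301731454985548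96946640556538905666136330927200577066505493167566391001389312341086666570999234705101942749165796109594180996922835955151514991665423916875812090111032248349943439298876981024098085144141178730269965315675490071118654985928706299231402083852286681782041677004149384737844668999565357527732973636222058280278141127928322621594240500052022964898103221674858546925737000278573047768912487679678205508621495261222340661719005903121474445119837940801492961413664371118587158105127702985963624352731313491989870863716167484476594082198304154729436223972673444819425091784267542586068129396034166337397177769536405738061695201229360074358168175619240412353884158472684879133899004853240280313464176475823983744969308789807642280697554110561663483993132876089695464142765632612033314439442807157285250778600807401086671432906180614625642068390576535561795266301569216984538163632293386771009590312015871982933139384160181374052150833292677408140212793716131371654789504814958102398138073891515475305309064948440717093031294059810550865699362767888176643063252655623844338580321632785065289004927119717517126995635764405172967752112964752442592826424129063158603584245380138118153188721368799198123375476439462419631745172456664172700413295852607880818031074503773990425103385527296586047131029340787308859552287885948379454157817029587482385019673076919740287830671211559868486787560007449834188670079745681017421684865882171946368001315020981928199216315913134460259039239421749780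

/-- `2 ^ 8250` divided by the golden ratio. -/
def cGb : ℕ :=
  1943016942797722668303131317214288614659927178274338320965232035569668588423324181259220987867963611195950402778477146238210964759408688663690783899333276544460484733769682965848340077971231180366568146852911705665788760022922430193932633581527427340929916931897376691406408088111468974271651356365450494003322604489184000437008428473087250182831350724421338989188894117508263558857824601496678452251215007450360543577017924299906609291397600327679489698627699197802604654851351875674885800385902914264560786197771633418632473701988076063120084793557762177193726990355142418184562702076943006913194445292041645192145998984290356740809577384535931121660361521669311376985738670167113072915006837132720906025916804788498049525029032278742498225512852026863420779340508613516907164526444806972198625203351470917106790452986098705573518641242328639995342079207300068004959702303865381102732709405635240952846681854209103568558016227148191165438834852308793812837002675265983568174642306161612456629251158677366734209403051363946565965564632494565770615431973927413718651952823659702685378769772781075116776983629765756782861446487531939850838788099897201794031213564408753023764085000577259464824797480750889264657448449881869045403887501254014911761781776251238534708643378959837817886764562031320818967348037845175638475773870839408661964969655455493221926625447785664883229335686074279310852720688511757898809663844270807663276604068365197329833668327218934278775365765397447935062706525835950299196556283473315279278059964471838727971464817260548080238922927259995349345540041706086626993147452351832654209575300347984446303590713843310063712421836328996603520202386306105805553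53347097273072656270341418869985655574004689119679572144199869785360726404629404706903335627871833177044805095737722815895637910397889620932789851535452373570663452343703160990780655035633787980004130266469683465581924401583243872628991687675693116642748896902471789122094104680954998965435402528854822107616697634095735752326472005814124754858395701214463143523567352940230316243485047262053721588041261711420139815423151957954174251408283983938620429488864242471928140525469096045993852684545885717511051453051616516498320440394670203483915736896892161462974094790789193675702536094670412609920593269232404657729913941357228972615662241652719285676253317984396644066169387802752784816982841553195120754983645974329491398776976185071128085223957391731126997755474578700632178184655281849242775486666440502

/-- `2 ^ 4100` divided by the plastic number. -/
def cYa : ℕ :=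
  12614173463282472346789592012472464427729446556271367764319715922559898180322791038829575944468280852283223191049375312708408145768978601652061603831235133412330125070598121305141579557984112594687769521694486896552687440954563382962822145867901800683902783718733820687111418559962994044313377678585366102736422940068741827996635667850036201332045670367157738299657865920299517128650286290270642861637309386449677476174929511033046280968076704014353692164480465771882480451890045530887222925310143948141961173820619111376183024099164357581120704603122541054393940502261908719456595884618553864609493524904350294231936239501528537652708279380403884880253908865611717241957106875395899925847602573288482542298599029769058609004468289195143147305830209304831985664427247708475604508676952193456996826313243690303080345457950551654608620446566633490151371519016871688797750349120373808863409033322804487879665041716531260376236849374638309521462453931699388824104895718163042401474815031691512937430543607649147975204116094727121592805649764527791569294864562105979234882182641645816708174019712011366485479194339435953545002112570129614489182452119159679687723249697269744988320823615210215260522572847555080442537472104201853180753400143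

/-- `2 ^ 4100` divided by the golden ratio. -/
def cGa : ℕ :=
  10327485218972984976908397661046772623864285237281221879749563185479474327724553817013554216128010837132317804075158762720025292373117011050963083334037784877165120067487835476055937161109065906598071892061546469836528507748295528371377120497410705732693176191733766619009938495771651973447305727753706877103640264725900701531461020009931883905446007577205406083647790012341471393593573947739754782378980822788888663809348528541567057125620019045943808908621460183632466774814265219061371060458726701844257535359745454876999629086410208298651366770436147313176908757879964169753209184822745021833935713790315226404309189327132838794339426800765253076651834806494637050632491550641862858468048401203516268423139792049082876005337564366294771885657129137185113184855472774811304457147159693894686154786929111659753823986665240188841785970467188020193861615123719942066366406133970659883781101348269907576030738001279347040391512604441336198164775222886113471529797840302995838697261170025436180226405052434966380907340983863119618965646594246913062612316535500079189703039100408172348180764907486250757298761249654747273935106672804624342469695824043995072297137086758757428669622948776370826237362908454608960930264283813027768436798390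

/-- Numerator of a convergent. -/
def cP : ℕ :=
  539520849786812149161212593547158805506532068949982552373162553168598138986713152481081449952852989329285646349286205264485615680503836441082559052240725314205138482959038693349622061304404033104481395746374310568771213112226652173857313258710080148635091875716546408841091366823105863407286778598546630671248139371296433846618550922212601778695893498086994461115690380770853603937723726669497903188749775513665938566370014684009498201474386256666399715878235840928110391311568068914947463487015046243258900246606994105227866957799593943612868449846266429923171807837775832761951403471837298950293601093642522137570113052347353604206781693031871435074834933683013299783783579958145681650205244936247743285752547556634044547973832605432045114301864926178082863657200590744824422160470044357010524804481769780663596990691306300843946740882033580878968692572840977098457306414191264250809232161644648786284855345180153203656976801901850959405504211405350332506136811622136605550631159719884213721843468422513655293536917627978372567109003770553387750331675605890202263147912329177306170174981393010621205485234651220601907308935700415881497896498744381645335673584218924287279412689148864772611198677805323828088555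

/-- Denominator of a convergent. -/
def cQ : ℕ :=
  923272424607009791520935253168182708809758398954856477098773217126508015565546010422726118161557168738675212987197467011422761983554113414998709411930084486276689247296202672217460903372283514510890894554268936100687233518441338670818114177148954925864891295905735113361507909379931624100111936195412213622267613184009986027626039658216588188868201798724521266981089530497401036274258936566125328668268341597489513367724249909141572212439379817706439715847775841165620103446578046433116164603341038032497305717909513306287477335426815324986505198000688802673242207695821157471394280984677466393255696563366793121823527147954570475926654213017211403293869307716463974560678715971410847722134825400256747935087680268119691925384428298101293436734570413456272908544821837667500606419521984803079030893933320486850465852988978130262389482736334336260836984256030591133408628528251481647519896805482715498740231006477604012594010807322063955146888846888778876196929790465315603356555764121137985443097433452325504950071747889644207997097455013821512826970393530794811633066957597193134365704491281130807960071276009597876809135199193605592171233485500128933532801797169606735615750925173414498059505374030846900362848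

/-- The multiplier, scaled by `2 ^ 4070`. -/
def cC : ℕ :=
  2985904588248287788149273561275527243098648043179482090289136569243937196555066632486645597686631201458915284222969917377812988458336597447631072153426607761265900362248213866553588333151611700630148857116025105535255857201140924913939334223110514006327389918537542616459632065687739303918739837172682311396365471000536756825913598302525212874571881934146986728925317011854638874023636994538451629256910416013153131387942805533662820299406678013434742580412055324717843012728478593247940781852780841066883496109912701014086693347254785733286460074411675796794615681791884214728226726547911992477923444851502517740307920259596422838462334610762902777773819241320217297649466797454757408536396479462977928251327941776721019878900060988980118326599926498361407261282247806756756740204761655154392920457314260129560003884108856979900090518920267888733137568813645732959844343433436488570310250751354630908446079568025582956296674114750548946747100999796927607186361691161100517943744530482965492666647660689200583814829267606023504832240243219754376981794263199389265206436192992590498249397753439446117442758187786203247123852075905633111702510405485662085343892713103204259655383978789918526311270953158134249279178218099943557835299081423282026966995759387865670680525156917267989174411823758708483014191139654734222100051134749944211269946756300532227204827778216292982591089933348737478653103143222103017289945234568338382614104480073251844187755324326624048736135141244519138785363777098192173815721442442686520089999092813875409811794728158944324942909603945277675835558743925546118520358034716310384569515292514300542303187827115801648302893352256921631166844910609368159932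9338927079201241087717409981813738903117978257223597706127296056103649814107802778413642893007344648022808565776520941091784137939780194067277629877433816037842507373010223991844037307494302345438240127707838031582491754681557896974944026301562423150835461022764568279796637524955252558852643482501241606439310920592405870214292769038785253362594883569777970656163626656847928712010096110409164932337386331141012167105889026208002400186154497383153234914389852144721054779132127338052474396252589943244794222166542369310198295582829065673662373904854681181916666543859635217455437608550379969641976436050977324509739473152426486229363480269552594318948392456135086190629358218384700801739537757395337243298558498552334391494049825411571192242455195998401031106

set_option maxRecDepth 1000000 in
set_option exponentiation.threshold 30000 in
lemma first_base : baseTest 4100 cYa cGa = true := by decide +kernel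

set_option maxRecDepth 1000000 in
set_option exponentiation.threshold 30000 in
lemma first_base' : baseTest 8250 cYb cGb = true := by decide +kernel

set_option maxRecDepth 1000000 in
set_option exponentiation.threshold 30000 in
lemma first_errA : 2 * cC * (11 * (10250 + 1) + 5) * 2 ^ 48 ≤ 2 ^ (4100 + 4070) := by decide +kernel

set_option maxRecDepth 1000000 in
set_option exponentiation.threshold 30000 in
lemma first_errB : 2 * cC * (11 * (6150 + 1) + 5) * 2 ^ 48 ≤ 2 ^ (4100 + 4070) := by decide +kernel

set_option maxRecDepth 1000000 in
set_option exponentiation.threshold 30000 in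
lemma first_bound : cC ≤ 2 ^ (4070 + 4028) := by decide +kernel

set_option maxRecDepth 1000000 in
set_option exponentiation.threshold 30000 in
lemma first_precP : precTest 8250 cC 4070 4028 cP (slog 8250 cYb 20625 5) (11 * (20625 + 1) + 5) = true := by decide +kernel

set_option maxRecDepth 1000000 in
set_option exponentiation.threshold 30000 in
lemma first_precQ : precTest 8250 cC 4070 4028 cQ (slog 8250 cGb 12375 2) (11 * (12375 + 1) + 5) = true := by decide +kernel

set_option maxRecDepth 1000000 in
set_option exponentiation.threshold 30000 in
lemma first_sep : sepTest 4100 cYa cGa 10250 6150 cC 4070 48 87960930222080 (2 ^ 22) 13 10150 6090 = true := by decide +kernel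

lemma first_lower (k l m n : ℕ) (hk : k ≤ 10150) (hl : l ≤ 6090) (hm : m < 2 ^ 3990) (hn : n < 2 ^ 3990) :
    1 ≤ |Lam k l m n| * 2 ^ 4055 :=
  reduce 4100 cYa cGa 10250 6150 cC 4070 48 87960930222080 22 13 10150 6090 8250 cYb cGb 20625 12375 cP cQ 4028 3990 4028 4055
    first_base first_base' (by norm_num) (by norm_num) (by norm_num) (by norm_num) (by norm_num)
    first_errA first_errB (by norm_num) (by norm_num) (by norm_num) (by norm_num) (by norm_num) first_bound
    first_precP first_precQ first_sep k l m n hk hl hm hn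

/-! ### The second reduction -/

set_option maxRecDepth 1000000 in
set_option exponentiation.threshold 30000 in
lemma second_base : baseTest 100 956921126716505103263126745522 783451156800250981620462126597 = true := by decide +kernel

set_option maxRecDepth 1000000 in
set_option exponentiation.threshold 30000 in
lemma second_base' : baseTest 200 1213041640653251260084623424301375567074134175232364650293813 993142329167338825620188846082107258957123816704228717646328 = true := by decide +kernel

set_option maxRecDepth 1000000 in
set_option exponentiation.threshold 30000 in
lemma second_errA : 2 * 276410342970583704738360096224 * (11 * (250 + 1) + 5) * 2 ^ 40 ≤ 2 ^ (100 + 60) := by decide +kernel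

set_option maxRecDepth 1000000 in
set_option exponentiation.threshold 30000 in
lemma second_errB : 2 * 276410342970583704738360096224 * (11 * (150 + 1) + 5) * 2 ^ 40 ≤ 2 ^ (100 + 60) := by decide +kernel

set_option maxRecDepth 1000000 in
set_option exponentiation.threshold 30000 in
lemma second_bound : 276410342970583704738360096224 ≤ 2 ^ (60 + 38) := by decide +kernel

set_option maxRecDepth 1000000 in
set_option exponentiation.threshold 30000 in
lemma second_precP : precTest 200 276410342970583704738360096224 60 36 67416966785 (slog 200 1213041640653251260084623424301375567074134175232364650293813 500 5) (11 * (500 + 1) + 5) = true := by decide +kernel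

set_option maxRecDepth 1000000 in
set_option exponentiation.threshold 30000 in
lemma second_precQ : precTest 200 276410342970583704738360096224 60 36 115369454967 (slog 200 993142329167338825620188846082107258957123816704228717646328 300 2) (11 * (300 + 1) + 5) = true := by decide +kernel

set_option maxRecDepth 1000000 in
set_option exponentiation.threshold 30000 in
lemma second_sep : sepTest 100 956921126716505103263126745522 783451156800250981620462126597 250 150 276410342970583704738360096224 60 40 343597383680 (2 ^ 26) 8 145 87 = true := by decide +kernel

lemma second_lower (k l m n : ℕ) (hk : k ≤ 145) (hl : l ≤ 87) (hm : m < 2 ^ 14) (hn : n < 2 ^ 14) :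
    1 ≤ |Lam k l m n| * 2 ^ 53 :=
  reduce 100 956921126716505103263126745522 783451156800250981620462126597 250 150 276410342970583704738360096224 60 40 343597383680 26 8 145 87 200 1213041640653251260084623424301375567074134175232364650293813 993142329167338825620188846082107258957123816704228717646328 500 300 67416966785 115369454967 36 14 38 53
    second_base second_base' (by norm_num) (by norm_num) (by norm_num) (by norm_num) (by norm_num)
    second_errA second_errB (by norm_num) (by norm_num) (by norm_num) (by norm_num) (by norm_num) second_bound
    second_precP second_precQ second_sep k l m n hk hl hm hn

lemma small_of_sol (k l m n : ℕ) (hs : Sol k l m n) : m ≤ 150 ∧ n ≤ 87 := by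
  obtain ⟨h1, h2⟩ := abs_bound k l m n hs
  obtain ⟨h3, h4⟩ := reduce_sol k l m n 10150 6090 4055 hs (by norm_num) (by norm_num)
    (fun k' l' hk hl => first_lower k' l' m n hk hl h1 h2)
  obtain ⟨h5, h6⟩ := reduce_sol k l m n 145 87 53 hs (by norm_num) (by norm_num)
    (fun k' l' hk hl => second_lower k' l' m n hk hl (by norm_num; omega) (by norm_num; omega))
  omega

/-! ### The remaining finite search -/

/-- Fibonacci numbers in decreasing order. -/
def fl (fuel : ℕ) : ℕ → ℕ → List ℕ → List ℕ :=
  Nat.rec (fun _ _ acc => acc) (fun _ ih a b acc => force (Nat.add a b) fun c => ih b c (a :: acc)) fuel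

/-- Padovan numbers in decreasing order. -/
def pl (fuel : ℕ) : ℕ → ℕ → ℕ → List ℕ → List ℕ :=
  Nat.rec (fun _ _ _ acc => acc) (fun _ ih a b c acc => force (Nat.add a b) fun d => ih b c d (a :: acc)) fuel

lemma fl_succ (i a b : ℕ) (acc : List ℕ) : fl (i + 1) a b acc = fl i b (a + b) (a :: acc) := by
  have h : fl (i + 1) a b acc = force (Nat.add a b) fun c => fl i b c (a :: acc) := rfl
  rw [h, force_eq]
  rfl

lemma pl_succ (i a b c : ℕ) (acc : List ℕ) : pl (i + 1) a b c acc = pl i b c (a + b) (a :: acc) := by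
  have h : pl (i + 1) a b c acc = force (Nat.add a b) fun d => pl i b c d (a :: acc) := rfl
  rw [h, force_eq]
  rfl

lemma fl_spec (i : ℕ) : ∀ j acc, (∀ x ∈ acc, x ∈ fl i (Nat.fib j) (Nat.fib (j + 1)) acc) ∧
    ∀ n, j ≤ n → n < j + i → Nat.fib n ∈ fl i (Nat.fib j) (Nat.fib (j + 1)) acc := by
  induction i with
  | zero => intro j acc; exact ⟨fun x hx => hx, fun n h1 h2 => by omega⟩
  | succ i ih =>
    intro j acc
    rw [fl_succ, ← Nat.fib_add_two]
    obtain ⟨h1, h2⟩ := ih (j + 1) (Nat.fib j :: acc)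
    refine ⟨fun x hx => h1 x (List.mem_cons_of_mem _ hx), fun n a b => ?_⟩
    rcases Nat.eq_or_lt_of_le a with rfl | a
    · exact h1 _ List.mem_cons_self
    · exact h2 n a (by omega)

lemma pad_three (j : ℕ) : padovan (j + 3) = padovan (j + 1) + padovan j := rfl

lemma pl_spec (i : ℕ) : ∀ j acc,
    (∀ x ∈ acc, x ∈ pl i (padovan j) (padovan (j + 1)) (padovan (j + 2)) acc) ∧
    ∀ n, j ≤ n → n < j + i → padovan n ∈ pl i (padovan j) (padovan (j + 1)) (padovan (j + 2)) acc := by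
  induction i with
  | zero => intro j acc; exact ⟨fun x hx => hx, fun n h1 h2 => by omega⟩
  | succ i ih =>
    intro j acc
    rw [pl_succ, add_comm (padovan j), ← pad_three]
    obtain ⟨h1, h2⟩ := ih (j + 1) (padovan j :: acc)
    refine ⟨fun x hx => h1 x (List.mem_cons_of_mem _ hx), fun n a b => ?_⟩
    rcases Nat.eq_or_lt_of_le a with rfl | a
    · exact h1 _ List.mem_cons_self
    · exact h2 n a (by omega)

/-- Search in a decreasing list. -/
def hit (t : ℕ) (xs : List ℕ) : Bool :=
  List.rec false (fun x _ ih => Bool.rec (Bool.rec false ih (Nat.blt t x)) true (Nat.beq x t)) xs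

lemma hit_spec (t : ℕ) (xs : List ℕ) (hs : xs.Pairwise (· > ·)) (h : t ∈ xs) : hit t xs = true := by
  induction xs with
  | nil => exact absurd h List.not_mem_nil
  | cons a xs ih =>
    change Bool.rec (motive := fun _ => Bool) (Bool.rec (motive := fun _ => Bool) false (hit t xs) (Nat.blt t a))
      true (Nat.beq a t) = true
    cases hb : Nat.beq a t with
    | true => rfl
    | false =>
      have hne : a ≠ t := fun he => by
        have h5 : Nat.beq a t = true := by rw [Nat.beq_eq]; exact he
        rw [hb] at h5; simp at h5
      have ht : t ∈ xs := by
        rcases List.mem_cons.1 h with h | h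
        · exact absurd h.symm hne
        · exact h
      have hlt : t < a := (List.pairwise_cons.1 hs).1 t ht
      have : Nat.blt t a = true := by rw [Nat.blt_eq]; exact hlt
      rw [this]
      exact ih (List.pairwise_cons.1 hs).2 ht

/-- The exceptional values, shifted by `226`. -/
def exc : List ℕ := [0, 144, 174, 196, 199, 208, 217, 220, 221, 222, 223, 225, 226, 227, 228, 229, 230, 232, 233,
  234, 236, 237, 239, 241, 242, 246, 251, 257, 258, 262, 270, 278, 288, 337, 488]

/-- Membership in the exceptional set. -/
def inS (P F : ℕ) : Bool := exc.any fun c => Nat.beq (P + 226) (F + c)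

/-- Search over the Fibonacci numbers. -/
def scanF (d P : ℕ) (fs : List ℕ) : Bool :=
  List.rec true (fun F Fs ih => Bool.rec true (Bool.rec ih (Bool.rec false ih (inS P F)) (hit (Nat.sub F d) Fs))
    (Nat.blt d F)) fs

lemma scanF_spec (d P : ℕ) (fs : List ℕ) (hs : fs.Pairwise (· > ·)) (h : scanF d P fs = true) :
    ∀ F ∈ fs, ∀ F1 ∈ fs, F1 < F → 1 ≤ F1 → F = d + F1 → inS P F = true := by
  induction fs with
  | nil => intro F hF; exact absurd hF List.not_mem_nil
  | cons a fs ih =>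
    intro F hF F1 hF1 hlt h1 he
    obtain ⟨p1, p2⟩ := List.pairwise_cons.1 hs
    change Bool.rec (motive := fun _ => Bool) true (Bool.rec (motive := fun _ => Bool) (scanF d P fs)
      (Bool.rec (motive := fun _ => Bool) false (scanF d P fs) (inS P a)) (hit (a - d) fs)) (Nat.blt d a) = true at h
    have haF : F ≤ a := by
      rcases List.mem_cons.1 hF with rfl | hF
      · exact le_rfl
      · exact (p1 F hF).le
    have hb : Nat.blt d a = true := by rw [Nat.blt_eq]; omega
    rw [hb] at h
    change Bool.rec (motive := fun _ => Bool) (scanF d P fs)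
      (Bool.rec (motive := fun _ => Bool) false (scanF d P fs) (inS P a)) (hit (a - d) fs) = true at h
    have hF1' : F1 ∈ fs := by
      rcases List.mem_cons.1 hF1 with rfl | hF1
      · omega
      · exact hF1
    rcases List.mem_cons.1 hF with rfl | hF
    · have hh : hit (F - d) fs = true := hit_spec _ _ p2 (by rwa [show F - d = F1 by omega])
      rw [hh] at h
      cases hi : inS P F with
      | true => rfl
      | false => rw [hi] at h; exact h
    · refine ih p2 ?_ F hF F1 hF1' hlt h1 he
      cases hh : hit (a - d) fs with
      | false => rw [hh] at h; exact h
      | true =>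
        rw [hh] at h
        cases hi : inS P a with
        | true => rw [hi] at h; exact h
        | false => rw [hi] at h; exact absurd h (by simp)

/-- Search over pairs of Padovan numbers with the same larger one. -/
def scanQ (P : ℕ) (fs : List ℕ) (ps : List ℕ) : Bool :=
  List.rec true (fun Q _ ih => force (Nat.sub P Q) fun d => Bool.rec false ih (scanF d P fs)) ps

lemma scanQ_spec (P : ℕ) (fs ps : List ℕ) (h : scanQ P fs ps = true) : ∀ Q ∈ ps, scanF (P - Q) P fs = true := by
  induction ps with
  | nil => intro Q hQ; exact absurd hQ List.not_mem_nil
  | cons a ps ih =>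
    change (force (Nat.sub P a) fun d => Bool.rec (motive := fun _ => Bool) false (scanQ P fs ps) (scanF d P fs)) = true at h
    rw [force_eq] at h
    change Bool.rec (motive := fun _ => Bool) false (scanQ P fs ps) (scanF (P - a) P fs) = true at h
    cases hb : scanF (P - a) P fs with
    | false => rw [hb] at h; exact absurd h (by simp)
    | true =>
      rw [hb] at h
      intro Q hQ
      rcases List.mem_cons.1 hQ with rfl | hQ
      · exact hb
      · exact ih h Q hQ

/-- Search over all pairs of Padovan numbers. -/
def scanP (fs : List ℕ) (ps : List ℕ) : Bool :=
  List.rec true (fun P Ps ih => Bool.rec false ih (scanQ P fs Ps)) ps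

lemma scanP_spec (fs ps : List ℕ) (hs : ps.Pairwise (· > ·)) (h : scanP fs ps = true) :
    ∀ P ∈ ps, ∀ Q ∈ ps, Q < P → scanF (P - Q) P fs = true := by
  induction ps with
  | nil => intro P hP; exact absurd hP List.not_mem_nil
  | cons a ps ih =>
    obtain ⟨p1, p2⟩ := List.pairwise_cons.1 hs
    change Bool.rec (motive := fun _ => Bool) false (scanP fs ps) (scanQ a fs ps) = true at h
    cases hb : scanQ a fs ps with
    | false => rw [hb] at h; exact absurd h (by simp)
    | true =>
      rw [hb] at h
      intro P hP Q hQ hlt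
      have haP : P ≤ a := by
        rcases List.mem_cons.1 hP with rfl | hP
        · exact le_rfl
        · exact (p1 P hP).le
      have hQ' : Q ∈ ps := by
        rcases List.mem_cons.1 hQ with rfl | hQ
        · omega
        · exact hQ
      rcases List.mem_cons.1 hP with rfl | hP
      · exact scanQ_spec P fs ps hb Q hQ'
      · exact ih p2 h P hP Q hQ' hlt

/-- Strictly decreasing lists. -/
def desc (xs : List ℕ) : Bool :=
  List.rec (fun _ => true) (fun x _ ih b => Bool.rec false (ih x) (Nat.blt x b)) xs (Nat.pow 2 200)

lemma desc_aux (xs : List ℕ) : ∀ b : ℕ, (List.rec (motive := fun _ => ℕ → Bool) (fun _ => true)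
    (fun x _ ih b => Bool.rec false (ih x) (Nat.blt x b)) xs b) = true →
    xs.Pairwise (· > ·) ∧ ∀ x ∈ xs, x < b := by
  induction xs with
  | nil => intro b _; exact ⟨List.Pairwise.nil, fun x hx => absurd hx List.not_mem_nil⟩
  | cons a xs ih =>
    intro b h
    change Bool.rec (motive := fun _ => Bool) false (List.rec (motive := fun _ => ℕ → Bool) (fun _ => true)
      (fun x _ ih b => Bool.rec false (ih x) (Nat.blt x b)) xs a) (Nat.blt a b) = true at h
    cases hb : Nat.blt a b with
    | false => rw [hb] at h; exact absurd h (by simp)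
    | true =>
      rw [hb] at h
      obtain ⟨h1, h2⟩ := ih a h
      have hab : a < b := by rw [← Nat.blt_eq]; exact hb
      refine ⟨List.pairwise_cons.2 ⟨h2, h1⟩, fun x hx => ?_⟩
      rcases List.mem_cons.1 hx with rfl | hx
      · exact hab
      · exact (h2 x hx).trans hab

lemma desc_spec (xs : List ℕ) (h : desc xs = true) : xs.Pairwise (· > ·) := (desc_aux xs _ h).1

/-- The complete finite search. -/
def bigScan : Bool :=
  forceL (fl 86 1 2 []) fun fs => forceL (pl 147 2 3 4 []) fun ps => scanP fs ps

set_option maxRecDepth 1000000 in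
lemma bigScan_true : bigScan = true := by decide +kernel

set_option maxRecDepth 1000000 in
lemma desc_fl : desc (fl 86 1 2 []) = true := by decide +kernel

set_option maxRecDepth 1000000 in
lemma desc_pl : desc (pl 147 2 3 4 []) = true := by decide +kernel

lemma finite_search (m m1 n n1 : ℕ) (hm1 : 4 ≤ m1) (hm : m ≤ 150) (hm1' : m1 ≤ 150) (hn1 : 2 ≤ n1) (hn : n ≤ 87)
    (hn1' : n1 ≤ 87) (hm' : 4 ≤ m) (hn' : 2 ≤ n)
    (hP : padovan m1 < padovan m) (hF : Nat.fib n1 < Nat.fib n)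
    (h : padovan m + Nat.fib n1 = padovan m1 + Nat.fib n) : inS (padovan m) (Nat.fib n) = true := by
  have hb := bigScan_true
  unfold bigScan at hb
  rw [forceL_eq, forceL_eq] at hb
  have hp : ∀ j, 4 ≤ j → j ≤ 150 → padovan j ∈ pl 147 2 3 4 [] := fun j h1 h2 =>
    (pl_spec 147 4 []).2 j h1 (by omega)
  have hf : ∀ j, 2 ≤ j → j ≤ 87 → Nat.fib j ∈ fl 86 1 2 [] := fun j h1 h2 =>
    (fl_spec 86 2 []).2 j h1 (by omega)
  have h1 := scanP_spec _ _ (desc_spec _ desc_pl) hb _ (hp m hm' hm) _ (hp m1 hm1 hm1') hP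
  exact scanF_spec _ _ _ (desc_spec _ desc_fl) h1 _ (hf n hn' hn) _ (hf n1 hn1 hn1') hF
    (Nat.fib_pos.2 (by omega)) (by omega)

/-! ### Monotonicity and assembly -/

lemma pad_pos (j : ℕ) : 1 ≤ padovan j := by
  have : ∀ j, 1 ≤ padovan j ∧ 1 ≤ padovan (j + 1) ∧ 1 ≤ padovan (j + 2) := by
    intro j
    induction j with
    | zero => decide
    | succ j ih =>
      refine ⟨ih.2.1, ih.2.2, ?_⟩
      rw [show j + 1 + 2 = j + 3 by ring, pad_three]
      omega
  exact (this j).1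

lemma pad_five (j : ℕ) : padovan (j + 5) = padovan (j + 4) + padovan j := by
  induction j using Nat.strong_induction_on with
  | _ j ih =>
    match j with
    | 0 => decide
    | 1 => decide
    | 2 => decide
    | j + 3 =>
      have h0 := ih j (by omega)
      have h1 := ih (j + 1) (by omega)
      have e1 := pad_three (j + 5)
      have e2 := pad_three (j + 4)
      have e3 := pad_three j
      simp only [add_assoc, Nat.reduceAdd] at *
      omega

lemma pad_strict (j i : ℕ) (hj : 4 ≤ j) : padovan j < padovan (j + (i + 1)) := by
  have step : ∀ r, 4 ≤ r → padovan r < padovan (r + 1) := by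
    intro r hr
    obtain ⟨t, rfl⟩ := Nat.exists_eq_add_of_le' hr
    have := pad_five t
    have := pad_pos t
    rw [show t + 4 + 1 = t + 5 by ring]
    omega
  induction i with
  | zero => exact step j hj
  | succ i ih => exact ih.trans (step _ (by omega))

lemma pad_lt (a b : ℕ) (ha : 4 ≤ a) (h : a < b) : padovan a < padovan b := by
  obtain ⟨t, rfl⟩ := Nat.exists_eq_add_of_lt h
  exact pad_strict a t ha

lemma pad_le (a b : ℕ) (ha : 4 ≤ a) (h : a ≤ b) : padovan a ≤ padovan b := by
  rcases Nat.eq_or_lt_of_le h with rfl | h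
  · exact le_rfl
  · exact (pad_lt a b ha h).le

lemma fib_lt (a b : ℕ) (ha : 2 ≤ a) (h : a < b) : Nat.fib a < Nat.fib b :=
  Nat.fib_strictMonoOn (Set.mem_Ici.2 ha) (Set.mem_Ici.2 (by omega)) h

lemma core (m m1 n n1 : ℕ) (hm1 : 4 ≤ m1) (hn1 : 2 ≤ n1) (hm : m1 < m) (hn : n1 < n)
    (h : padovan m + Nat.fib n1 = padovan m1 + Nat.fib n) : inS (padovan m) (Nat.fib n) = true := by
  have hb : m ≤ 150 ∧ n ≤ 87 := by
    rcases Nat.lt_or_ge n 7 with h7 | h7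
    · refine ⟨?_, by omega⟩
      by_contra hc
      have h1 : Nat.fib n ≤ Nat.fib 7 := Nat.fib_mono (by omega)
      have h2 : padovan m1 ≤ padovan (m - 5 + 4) := pad_le _ _ hm1 (by omega)
      have h3 := pad_five (m - 5)
      rw [show m - 5 + 5 = m by omega] at h3
      have h4 : padovan 20 ≤ padovan (m - 5) := pad_le _ _ (by norm_num) (by omega)
      have h5 : Nat.fib 7 = 13 := by norm_num
      have h6 : padovan 20 = 200 := by decide +kernel
      omega
    · obtain ⟨k, rfl⟩ := Nat.exists_eq_add_of_lt hm
      obtain ⟨l, rfl⟩ := Nat.exists_eq_add_of_lt hn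
      refine small_of_sol (k + 1) (l + 1) _ _ (sol_of_eq (k + 1) (l + 1) m1 n1 (by omega) (by omega) (by omega)
        (by omega) ?_)
      have h' : ((padovan (m1 + k + 1) + Nat.fib n1 : ℕ) : ℤ) = ((padovan m1 + Nat.fib (n1 + l + 1) : ℕ) : ℤ) := by
        rw [h]
      push_cast at h'
      rw [← add_assoc, ← add_assoc]
      linarith
  exact finite_search m m1 n n1 hm1 hb.1 (by omega) hn1 hb.2 (by omega) (by omega) (by omega)
    (pad_lt _ _ hm1 hm) (fib_lt _ _ hn1 hn) h

lemma inS_spec (P F : ℕ) (h : inS P F = true) : ((P:ℤ) - F) ∈ ({-226, -82, -52, -30, -27, -18, -9, -6, -5, -4, -3, -1,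
    0, 1, 2, 3, 4, 6, 7, 8, 10, 11, 13, 15, 16, 20, 25, 31, 32, 36, 44, 52, 62, 111, 262} : Set ℤ) := by
  unfold inS at h
  obtain ⟨c, hc, he⟩ := List.any_eq_true.1 h
  have he' : P + 226 = F + c := Nat.eq_of_beq_eq_true he
  have hPF : (P:ℤ) - F = c - 226 := by omega
  rw [hPF]
  clear he he' hPF h
  simp only [Set.mem_insert_iff, Set.mem_singleton_iff]
  revert c
  decide +kernel

/-- An integer `c` admits at least two representations of the form `c = P m - F n`
with `m > 3` and `n > 1` if and only if `c` belongs to the given set. -/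
theorem pillai_iff (c : ℤ) :
    (∃ m n m₁ n₁ : ℕ, 3 < m ∧ 3 < m₁ ∧ 1 < n ∧ 1 < n₁ ∧ (m, n) ≠ (m₁, n₁) ∧
      (padovan m : ℤ) - (Nat.fib n : ℤ) = c ∧
      (padovan m₁ : ℤ) - (Nat.fib n₁ : ℤ) = c) ↔
    c ∈ ({-226, -82, -52, -30, -27, -18, -9, -6, -5, -4, -3, -1, 0, 1, 2, 3, 4,
      6, 7, 8, 10, 11, 13, 15, 16, 20, 25, 31, 32, 36, 44, 52, 62, 111, 262} : Set ℤ) := by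
  constructor
  · rintro ⟨m, n, m1, n1, hm, hm1, hn, hn1, hne, h1, h2⟩
    have hZ : (padovan m : ℤ) + Nat.fib n1 = padovan m1 + Nat.fib n := by linarith
    have hN : padovan m + Nat.fib n1 = padovan m1 + Nat.fib n := by exact_mod_cast hZ
    rcases lt_trichotomy m1 m with h | h | h
    · have hP := pad_lt m1 m (by omega) h
      have hnn : n1 < n := by
        by_contra hc
        have : Nat.fib n ≤ Nat.fib n1 := Nat.fib_mono (by omega)
        omega
      rw [← h1]
      exact inS_spec _ _ (core m m1 n n1 (by omega) (by omega) h hnn hN)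
    · exfalso
      subst h
      rcases lt_trichotomy n1 n with h' | h' | h'
      · have := fib_lt n1 n (by omega) h'
        omega
      · subst h'
        exact hne rfl
      · have := fib_lt n n1 (by omega) h'
        omega
    · have hP := pad_lt m m1 (by omega) h
      have hnn : n < n1 := by
        by_contra hc
        have : Nat.fib n1 ≤ Nat.fib n := Nat.fib_mono (by omega)
        omega
      rw [← h2]
      exact inS_spec _ _ (core m1 m n1 n (by omega) (by omega) h hnn hN.symm)
  · intro hc
    simp only [Set.mem_insert_iff, Set.mem_singleton_iff] at hc
    rcases hc with rfl | rfl | rfl | rfl | rfl | rfl | rfl |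
      rfl | rfl | rfl | rfl | rfl | rfl | rfl |
      rfl | rfl | rfl | rfl | rfl | rfl | rfl |
      rfl | rfl | rfl | rfl | rfl | rfl | rfl |
      rfl | rfl | rfl | rfl | rfl | rfl | rfl
    · exact ⟨8, 13, 19, 14, by decide +kernel⟩
    · exact ⟨8, 11, 19, 13, by decide +kernel⟩
    · exact ⟨5, 10, 14, 11, by decide +kernel⟩
    · exact ⟨6, 9, 18, 12, by decide +kernel⟩
    · exact ⟨8, 9, 13, 10, by decide +kernel⟩
    · exact ⟨5, 8, 11, 9, by decide +kernel⟩
    · exact ⟨6, 7, 10, 8, by decide +kernel⟩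
    · exact ⟨4, 6, 8, 7, by decide +kernel⟩
    · exact ⟨5, 6, 11, 8, by decide +kernel⟩
    · exact ⟨6, 6, 9, 7, by decide +kernel⟩
    · exact ⟨4, 5, 7, 6, by decide +kernel⟩
    · exact ⟨4, 4, 6, 5, by decide +kernel⟩
    · exact ⟨4, 3, 5, 4, by decide +kernel⟩
    · exact ⟨4, 2, 5, 3, by decide +kernel⟩
    · exact ⟨5, 2, 6, 3, by decide +kernel⟩
    · exact ⟨6, 2, 7, 3, by decide +kernel⟩
    · exact ⟨7, 2, 8, 4, by decide +kernel⟩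
    · exact ⟨8, 2, 9, 4, by decide +kernel⟩
    · exact ⟨9, 3, 10, 5, by decide +kernel⟩
    · exact ⟨9, 2, 11, 6, by decide +kernel⟩
    · exact ⟨10, 3, 16, 10, by decide +kernel⟩
    · exact ⟨10, 2, 11, 5, by decide +kernel⟩
    · exact ⟨11, 4, 12, 6, by decide +kernel⟩
    · exact ⟨11, 2, 13, 7, by decide +kernel⟩
    · exact ⟨12, 5, 14, 8, by decide +kernel⟩
    · exact ⟨12, 2, 13, 6, by decide +kernel⟩
    · exact ⟨13, 4, 18, 11, by decide +kernel⟩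
    · exact ⟨16, 9, 17, 10, by decide +kernel⟩
    · exact ⟨14, 5, 21, 13, by decide +kernel⟩
    · exact ⟨14, 2, 15, 7, by decide +kernel⟩
    · exact ⟨15, 5, 16, 8, by decide +kernel⟩
    · exact ⟨16, 7, 17, 9, by decide +kernel⟩
    · exact ⟨16, 4, 19, 11, by decide +kernel⟩
    · exact ⟨18, 4, 20, 11, by decide +kernel⟩
    · exact ⟨21, 4, 22, 11, by decide +kernel⟩
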